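/- There exists a constant C = C(q) such that the following holds. Let l ≥ 0 be an integer, let Q ∈ F_q[t] be a nonzero polynomial of degree m ≥ 0 with m + l ≥ 16, and let λ be a non-principal character of G_{l,Q}. Then for every d ≥ 1, |∑_{f monic, deg f = d} μ(f) λ(f)| ≤ q^{d/2 + d·(log log(m+l))/log(m+l) + C·(m+l)/log²(m+l)}, where log denotes the natural logarithm. -/

import Mathlib

open Polynomial

/- The Möbius function on `F_q[t]`. -/
open scoped Classical in
noncomputable def polyMu {F : Type*} [Field F] (f : Polynomial F) : ℤ :=
  if Squarefree f then (-1) ^ (UniqueFactorizationMonoid.normalizedFactors f).card else 0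

/-- The monic polynomial of degree `d` whose lower coefficient vector is `x ∈ F_q^d`. -/
noncomputable def monicPoly (F : Type*) [Field F] (d : ℕ) (x : Fin d → F) : Polynomial F :=
  X ^ d + ∑ i : Fin d, C (x i) * X ^ (i : ℕ)

/-- The `i`-th coefficient from the top of `f = t^d + a_1 t^{d-1} + ⋯ + a_d`:
`a_i = coeff (d - i)` for `i ≤ d`, and `0` for `i > d`. -/
noncomputable def firstCoeff {F : Type*} [Field F] (f : Polynomial F) (i : ℕ) : F :=
  if i ≤ f.natDegree then f.coeff (f.natDegree - i) else 0

section Filtration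

variable {k A ι : Type*} [Field k] [CommRing A] [Algebra k[X] A]

/-- All coordinates of `u` in the basis `b` have degree at most `E`. -/
def DegLE (b : Module.Basis ι k[X] A) (E : ℕ) (u : A) : Prop :=
  ∀ i, (b.repr u i).natDegree ≤ E

theorem DegLE.mono {b : Module.Basis ι k[X] A} {E E' : ℕ} {u : A} (h : DegLE b E u)
    (hE : E ≤ E') : DegLE b E' u := fun i => (h i).trans hE

theorem DegLE.sum {κ : Type*} {b : Module.Basis ι k[X] A} {E : ℕ} (s : Finset κ) {u : κ → A}
    (h : ∀ j ∈ s, DegLE b E (u j)) : DegLE b E (∑ j ∈ s, u j) := by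
  intro i
  rw [map_sum, Finsupp.finsetSum_apply]
  exact natDegree_sum_le_of_forall_le _ _ fun j hj => h j hj i

theorem DegLE.smul {b : Module.Basis ι k[X] A} {D E : ℕ} {u : A} (h : DegLE b E u) {p : k[X]}
    (hp : p.natDegree ≤ D) : DegLE b (D + E) (p • u) := by
  intro i
  rw [map_smul, Finsupp.smul_apply, smul_eq_mul]
  exact natDegree_mul_le.trans (Nat.add_le_add hp (h i))

theorem natDegree_le_of_eq_smul {b : Module.Basis ι k[X] A} {E : ℕ} {u v : A} {M : k[X]}
    (hu : DegLE b E u) (h0 : u ≠ 0) (h : u = M • v) : M.natDegree ≤ E := by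
  obtain ⟨i, hi⟩ : ∃ i, b.repr u i ≠ 0 := by
    by_contra! hcon
    exact h0 (b.repr.map_eq_zero_iff.1 (Finsupp.ext hcon))
  have hd : M ∣ b.repr u i := ⟨b.repr v i, by rw [h, map_smul, Finsupp.smul_apply, smul_eq_mul]⟩
  exact (natDegree_le_of_dvd hd hi).trans (hu i)

theorem DegLE.pow {b : Module.Basis ι k[X] A} {c : ℕ}
    (hc : ∀ E E' u v, DegLE b E u → DegLE b E' v → DegLE b (E + E' + c) (u * v))
    {E : ℕ} {u : A} (hu : DegLE b E u) {N : ℕ} (hN : N ≠ 0) : DegLE b (N * (E + c)) (u ^ N) := by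
  induction N with
  | zero => exact absurd rfl hN
  | succ N ih =>
    rcases eq_or_ne N 0 with rfl | h0
    · simpa using hu.mono (Nat.le_add_right E c)
    · rw [pow_succ]
      exact (hc _ _ _ _ (ih h0) hu).mono (by ring_nf; omega)

variable [Fintype ι]

theorem exists_degLE {b : Module.Basis ι k[X] A} (u : A) : ∃ E, DegLE b E u :=
  ⟨Finset.univ.sup fun i => (b.repr u i).natDegree,
    fun i => Finset.le_sup (f := fun i => (b.repr u i).natDegree) (Finset.mem_univ i)⟩

theorem exists_degLE_family {κ : Type*} [Fintype κ] {b : Module.Basis ι k[X] A} (u : κ → A) :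
    ∃ E, ∀ j, DegLE b E (u j) := by
  choose E hE using fun j => exists_degLE (b := b) (u j)
  exact ⟨Finset.univ.sup E, fun j => (hE j).mono (Finset.le_sup (Finset.mem_univ j))⟩

theorem exists_degLE_map (b : Module.Basis ι k[X] A) (T : A →ₗ[k[X]] A) :
    ∃ c, ∀ E u, DegLE b E u → DegLE b (E + c) (T u) := by
  obtain ⟨c, hc⟩ := exists_degLE_family (b := b) fun j => T (b j)
  refine ⟨c, fun E u hu => ?_⟩
  rw [← b.sum_repr u, map_sum]
  refine DegLE.sum _ fun j _ => ?_
  rw [map_smul]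
  exact (hc j).smul (hu j)

theorem exists_degLE_mul (b : Module.Basis ι k[X] A) :
    ∃ c, ∀ E E' u v, DegLE b E u → DegLE b E' v → DegLE b (E + E' + c) (u * v) := by
  obtain ⟨c, hc⟩ := exists_degLE_family (b := b) fun j : ι × ι => b j.1 * b j.2
  refine ⟨c, fun E E' u v hu hv => ?_⟩
  rw [← b.sum_repr u, ← b.sum_repr v, Finset.sum_mul_sum]
  refine DegLE.sum _ fun i _ => DegLE.sum _ fun j _ => ?_
  rw [smul_mul_smul_comm]
  exact (hc (i, j)).smul (natDegree_mul_le.trans (Nat.add_le_add (hu i) (hv j)))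

end Filtration

section Order

variable {k A ι : Type*} [Field k] [CommRing A] [IsDomain A] [Algebra k[X] A] [Fintype ι]

theorem natDegree_det_le [DecidableEq ι] (M : Matrix ι ι k[X]) {D : ℕ}
    (hM : ∀ i j, (M i j).natDegree ≤ D) : M.det.natDegree ≤ Fintype.card ι * D := by
  rw [Matrix.det_apply]
  refine natDegree_sum_le_of_forall_le _ _ fun σ _ => ?_
  refine (natDegree_smul_le _ _).trans ((natDegree_prod_le _ _).trans ?_)
  exact (Finset.sum_le_card_nsmul _ _ D fun i _ => hM _ _).trans_eq (by simp)

theorem exists_order_bound (b : Module.Basis ι k[X] A) (θ : A →ₐ[k[X]] PowerSeries k) :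
    ∃ c, ∀ E u, DegLE b E u → u ≠ 0 →
      ¬ (PowerSeries.X : PowerSeries k) ^ (Fintype.card ι * E + c + 1) ∣ θ u := by
  classical
  obtain ⟨c, hc⟩ := exists_degLE_mul b
  obtain ⟨E₁, hE₁⟩ := exists_degLE_family (b := b) fun j => b j
  refine ⟨Fintype.card ι * (E₁ + c), fun E u hu h0 hdvd => ?_⟩
  set M := Algebra.leftMulMatrix b u with hM
  have hdeg : M.det.natDegree ≤ Fintype.card ι * (E + E₁ + c) := by
    refine natDegree_det_le _ fun i j => ?_
    rw [hM, Algebra.leftMulMatrix_eq_repr_mul]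
    exact hc _ _ _ _ hu (hE₁ j) i
  have hdet : M.det ≠ 0 := by
    intro h
    obtain ⟨w, hw, hw0⟩ := Matrix.exists_mulVec_eq_zero_iff.2 h
    have h1 : b.repr (u * b.equivFun.symm w) = 0 := by
      ext1 i
      have := congrFun (Algebra.leftMulMatrix_mulVec_repr b u (b.equivFun.symm w)) i
      rw [← this]
      have h2 : (⇑(b.repr (b.equivFun.symm w)) : ι → k[X]) = w := b.equivFun.apply_symm_apply w
      rw [h2, ← hM, hw0]; rfl
    rw [LinearEquiv.map_eq_zero_iff, mul_eq_zero] at h1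
    rcases h1 with h1 | h1
    · exact h0 h1
    · exact hw ((LinearEquiv.map_eq_zero_iff _).1 h1)
  obtain ⟨v, hv⟩ : ∃ v, u * v = algebraMap k[X] A M.det := by
    refine ⟨b.equivFun.symm (M.adjugate.mulVec (b.repr 1)), ?_⟩
    apply b.repr.injective
    ext1 i
    have := congrFun (Algebra.leftMulMatrix_mulVec_repr b u
      (b.equivFun.symm (M.adjugate.mulVec (b.repr 1)))) i
    rw [← this]
    have h2 : (⇑(b.repr (b.equivFun.symm (M.adjugate.mulVec (b.repr 1)))) : ι → k[X])
      = M.adjugate.mulVec (b.repr 1) := b.equivFun.apply_symm_apply _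
    rw [h2, ← hM, Matrix.mulVec_mulVec, Matrix.mul_adjugate, Algebra.algebraMap_eq_smul_one,
      map_smul, Matrix.smul_mulVec, Matrix.one_mulVec]
    rfl
  have h3 : (PowerSeries.X : PowerSeries k) ^ (Fintype.card ι * E + Fintype.card ι * (E₁ + c) + 1) ∣
      (M.det : PowerSeries k) := by
    have : (M.det : PowerSeries k) = θ u * θ v := by
      rw [← map_mul, hv, AlgHom.commutes]; rfl
    rw [this]
    exact hdvd.mul_right _
  rw [PowerSeries.X_pow_dvd_iff] at h3
  apply hdet
  rw [← leadingCoeff_eq_zero, leadingCoeff, ← Polynomial.coeff_coe]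
  apply h3
  have : Fintype.card ι * (E + E₁ + c) = Fintype.card ι * E + Fintype.card ι * (E₁ + c) := by ring
  omega

end Order

section FrobeniusPower

theorem add_pow_card_pow (k : Type*) {B : Type*} [Field k] [Fintype k] [CommRing B] [Algebra k B]
    (a : ℕ) (x y : B) :
    (x + y) ^ Fintype.card k ^ a = x ^ Fintype.card k ^ a + y ^ Fintype.card k ^ a := by
  have h : ∀ z : B, (FiniteField.frobeniusAlgHom k B ^ a) z = z ^ Fintype.card k ^ a := fun z => by
    rw [AlgHom.coe_pow, FiniteField.coe_frobeniusAlgHom, pow_iterate]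
  rw [← h, ← h, ← h, map_add]

theorem sum_pow_card_pow (k : Type*) {B κ : Type*} [Field k] [Fintype k] [CommRing B] [Algebra k B]
    (a : ℕ) (s : Finset κ) (x : κ → B) :
    (∑ i ∈ s, x i) ^ Fintype.card k ^ a = ∑ i ∈ s, x i ^ Fintype.card k ^ a := by
  have h : ∀ z : B, (FiniteField.frobeniusAlgHom k B ^ a) z = z ^ Fintype.card k ^ a := fun z => by
    rw [AlgHom.coe_pow, FiniteField.coe_frobeniusAlgHom, pow_iterate]
  simp_rw [← h, map_sum]

/-- Power series whose nontrivial constant combinations have order less than `N` are linearly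
independent over the `N`-th powers. -/
theorem eq_zero_of_sum_mul_pow_eq_zero {k κ : Type*} [Field k] [Fintype k] [Fintype κ] (a : ℕ)
    (s : κ → PowerSeries k)
    (hs : ∀ u : κ → k, (PowerSeries.X : PowerSeries k) ^ Fintype.card k ^ a ∣
      ∑ i, PowerSeries.C (u i) * s i → u = 0)
    (f : κ → PowerSeries k) (hf : ∑ i, s i * f i ^ Fintype.card k ^ a = 0) : f = 0 := by
  set N := Fintype.card k ^ a with hN
  have hN0 : N ≠ 0 := pow_ne_zero _ Fintype.card_ne_zero
  have key : ∀ j : ℕ, ∀ i, (PowerSeries.X : PowerSeries k) ^ j ∣ f i := by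
    intro j
    induction j with
    | zero => simp
    | succ j ih =>
      choose g hg using ih
      have h1 : ∑ i, s i * g i ^ N = 0 := by
        have h2 : (PowerSeries.X : PowerSeries k) ^ (j * N) * ∑ i, s i * g i ^ N = 0 := by
          rw [← hf, Finset.mul_sum]
          refine Finset.sum_congr rfl fun i _ => ?_
          rw [hg i, mul_pow, ← pow_mul]; ring
        exact (mul_eq_zero.1 h2).resolve_left (pow_ne_zero _ PowerSeries.X_ne_zero)
      have h3 : ∀ i, ∃ r, g i ^ N = PowerSeries.C (PowerSeries.constantCoeff (g i)) +
          PowerSeries.X ^ N * r := by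
        intro i
        obtain ⟨r, hr⟩ := PowerSeries.X_dvd_iff.2
          (show PowerSeries.constantCoeff (g i - PowerSeries.C (PowerSeries.constantCoeff (g i))) = 0
            by simp)
        refine ⟨r ^ N, ?_⟩
        conv_lhs => rw [← add_sub_cancel (PowerSeries.C (PowerSeries.constantCoeff (g i))) (g i), hr]
        rw [hN, add_pow_card_pow k, ← map_pow, FiniteField.pow_card_pow, mul_pow]
      choose r hr using h3
      have h4 := hs (fun i => PowerSeries.constantCoeff (g i)) ⟨- ∑ i, s i * r i, by
        rw [mul_neg, Finset.mul_sum, eq_neg_iff_add_eq_zero, ← Finset.sum_add_distrib, ← h1]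
        refine Finset.sum_congr rfl fun i _ => ?_
        rw [hr]; ring⟩
      intro i
      rw [hg i, pow_succ]
      exact mul_dvd_mul_left _ (PowerSeries.X_dvd_iff.2 (congrFun h4 i))
  funext i
  ext n
  exact PowerSeries.X_pow_dvd_iff.1 (key (n + 1) i) n (Nat.lt_succ_self n)

end FrobeniusPower

section Stepanov

variable {k A ι : Type*} [Field k] [CommRing A] [Algebra k[X] A] [Fintype ι]

/-- The element of degree at most `D` with prescribed coefficients in its coordinates. -/
noncomputable def polyComb (b : Module.Basis ι k[X] A) (D : ℕ) (c : ι × Fin (D + 1) → k) : A :=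
  ∑ j, (∑ a : Fin (D + 1), C (c (j, a)) * X ^ (a : ℕ)) • b j

theorem polyComb_sub (b : Module.Basis ι k[X] A) (D : ℕ) (c c' : ι × Fin (D + 1) → k) :
    polyComb b D (c - c') = polyComb b D c - polyComb b D c' := by
  simp only [polyComb, Pi.sub_apply, C_sub, sub_mul, Finset.sum_sub_distrib, sub_smul]

theorem repr_polyComb (b : Module.Basis ι k[X] A) (D : ℕ) (c : ι × Fin (D + 1) → k) (j : ι) :
    b.repr (polyComb b D c) j = ∑ a : Fin (D + 1), C (c (j, a)) * X ^ (a : ℕ) := by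
  rw [polyComb, b.repr_sum_self]

theorem degLE_polyComb (b : Module.Basis ι k[X] A) (D : ℕ) (c : ι × Fin (D + 1) → k) :
    DegLE b D (polyComb b D c) := by
  intro j
  rw [repr_polyComb]
  exact natDegree_sum_le_of_forall_le _ _ fun a _ =>
    (natDegree_C_mul_X_pow_le _ _).trans (Nat.lt_succ_iff.1 a.2)

theorem eq_zero_of_polyComb_eq_zero (b : Module.Basis ι k[X] A) (D : ℕ) (c : ι × Fin (D + 1) → k)
    (h : polyComb b D c = 0) : c = 0 := by
  funext ⟨j, a⟩
  have h1 := congrArg (fun p => p.coeff (a : ℕ)) (repr_polyComb b D c j)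
  simp only [h, map_zero, Finsupp.coe_zero, Pi.zero_apply, coeff_zero, finsetSum_coeff,
    coeff_C_mul, coeff_X_pow, Fin.val_inj, mul_ite, mul_one, mul_zero, Finset.sum_ite_eq,
    Finset.mem_univ, if_true] at h1
  exact h1.symm

theorem polyComb_eq_sum (b : Module.Basis ι k[X] A) (D : ℕ) (c : ι × Fin (D + 1) → k) :
    polyComb b D c = ∑ i : ι × Fin (D + 1), C (c i) • ((X ^ (i.2 : ℕ) : k[X]) • b i.1) := by
  rw [polyComb, Fintype.sum_prod_type]
  refine Finset.sum_congr rfl fun j _ => ?_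
  rw [Finset.sum_smul]
  exact Finset.sum_congr rfl fun a _ => mul_smul _ _ _

theorem stepanov_parameters (h c c₂ cT : ℕ) (hh : 0 < h) :
    ∃ C N₀ : ℕ, ∀ N, N₀ ≤ N → ∃ E D : ℕ, h * E + c₂ + 1 ≤ N ∧
      N * (E + c) + (D + cT) + c + 1 < h * ((E + 1) * (D + 1)) ∧
      h * (E + N * (D + c) + c) ≤ N ^ 2 + C * N := by
  obtain ⟨K, hK⟩ : ∃ K, K = 2 * (c + 1) + 2 := ⟨_, rfl⟩
  refine ⟨h * (1 + K + 2 * c), 2 * c₂ + K + cT + c + h + 2, fun N hN => ?_⟩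
  obtain ⟨e, r, he, hr⟩ : ∃ e r, N = c₂ + 1 + (h * e + r) ∧ r < h :=
    ⟨(N - c₂ - 1) / h, (N - c₂ - 1) % h, by rw [Nat.div_add_mod]; omega, Nat.mod_lt _ hh⟩
  obtain ⟨d, r', hd, hr'⟩ : ∃ d r, N = h * d + r ∧ r < h :=
    ⟨N / h, N % h, by rw [Nat.div_add_mod], Nat.mod_lt _ hh⟩
  have hdN : d ≤ N := by nlinarith
  have heN : e ≤ N := by nlinarith
  refine ⟨e, d + K, by omega, ?_, ?_⟩
  · have h1 : N + h * K ≤ h * (d + K + 1) := by nlinarith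
    have h2 : N ≤ h * (e + 1) + c₂ := by nlinarith
    have h3 : (e + 1) * (N + h * K) ≤ h * ((e + 1) * (d + K + 1)) := by
      calc (e + 1) * (N + h * K) ≤ (e + 1) * (h * (d + K + 1)) := Nat.mul_le_mul_left _ h1
        _ = _ := by ring
    have h4 : N * K ≤ 2 * (h * (e + 1) * K) := by
      have : N ≤ 2 * (h * (e + 1)) := by omega
      nlinarith
    have h5 : N * K = 2 * (N * (c + 1)) + 2 * N := by rw [hK]; ring
    have h6 : (e + 1) * (N + h * K) = N * e + N + h * (e + 1) * K := by ring
    have h7 : N * (e + c) = N * e + N * c := by ring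
    have h8 : N * (c + 1) = N * c + N := by ring
    omega
  · have h1 : h * (N * d) ≤ N ^ 2 := by nlinarith
    have h2 : h * e ≤ h * N := Nat.mul_le_mul_left _ heN
    have h3 : h * c ≤ h * c * N := Nat.le_mul_of_pos_right _ (by omega)
    nlinarith

theorem stepanov_bound [Fintype k] [IsDomain A] [Nonempty ι] (b : Module.Basis ι k[X] A)
    (θ : A →ₐ[k[X]] PowerSeries k) (hθ : Function.Injective θ) (T : A →ₗ[k[X]] A) :
    ∃ C N₀ : ℕ, ∀ a, N₀ ≤ Fintype.card k ^ a → ∀ M : k[X],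
      (∀ u : A, ∃ v, u ^ (Fintype.card k ^ a) ^ 2 - T u = M • v) →
      (∀ u : A, (∃ v, u ^ Fintype.card k ^ a = M • v) → ∃ v, u = M • v) →
      Fintype.card ι * M.natDegree ≤
        (Fintype.card k ^ a) ^ 2 + C * Fintype.card k ^ a := by
  classical
  obtain ⟨c, hc⟩ := exists_degLE_mul b
  obtain ⟨c₁, hc₁⟩ := exists_degLE_family (b := b) fun j => b j
  obtain ⟨cT, hcT⟩ := exists_degLE_map b T
  obtain ⟨c₂, hc₂⟩ := exists_order_bound b θ
  obtain ⟨C', N₀, hpar⟩ := stepanov_parameters (Fintype.card ι) c c₂ cT Fintype.card_pos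
  refine ⟨C', N₀, fun a ha M hM hred => ?_⟩
  set N := Fintype.card k ^ a with hN
  have hN0 : N ≠ 0 := pow_ne_zero _ Fintype.card_ne_zero
  obtain ⟨E, D, hE, hcount, hfin⟩ := hpar N ha
  let s : ι × Fin (E + 1) → A := fun i => (X ^ (i.2 : ℕ) : k[X]) • b i.1
  have hs : ∀ i, DegLE b E (s i) := by
    intro i j
    simp only [s, map_smul, Finsupp.smul_apply, Module.Basis.repr_self, smul_eq_mul]
    by_cases hij : i.1 = j
    · simpa [hij] using Nat.lt_succ_iff.1 i.2.2
    · simp [hij]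
  let H : (ι × Fin (E + 1) → ι × Fin (D + 1) → k) → A :=
    fun x => ∑ i, s i ^ N * T (polyComb b D (x i))
  have hHdeg : ∀ x, DegLE b (N * (E + c) + (D + cT) + c) (H x) := fun x =>
    DegLE.sum _ fun i _ => hc _ _ _ _ ((hs i).pow hc hN0) (hcT _ _ (degLE_polyComb b D _))
  obtain ⟨x, y, hxy, hcoef⟩ := Fintype.exists_ne_map_eq_of_card_lt
    (fun x : ι × Fin (E + 1) → ι × Fin (D + 1) → k =>
      fun i : ι × Fin (N * (E + c) + (D + cT) + c + 1) => (b.repr (H x) i.1).coeff i.2) (by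
        simp only [Fintype.card_pi, Finset.prod_const, Finset.card_univ, Fintype.card_prod,
          Fintype.card_fin]
        rw [← pow_mul]
        refine Nat.pow_lt_pow_right Fintype.one_lt_card ?_
        calc _ < Fintype.card ι * (Fintype.card ι * ((E + 1) * (D + 1))) :=
              Nat.mul_lt_mul_of_pos_left hcount Fintype.card_pos
          _ = _ := by ring)
  have hHxy : H x = H y := by
    apply b.repr.injective
    ext i n
    rcases lt_or_ge n (N * (E + c) + (D + cT) + c + 1) with hn | hn
    · exact congrFun hcoef (i, ⟨n, hn⟩)
    · rw [coeff_eq_zero_of_natDegree_lt ((hHdeg x i).trans_lt hn),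
        coeff_eq_zero_of_natDegree_lt ((hHdeg y i).trans_lt hn)]
  have hz : ∑ i, s i ^ N * T (polyComb b D (x i - y i)) = 0 := by
    simp only [polyComb_sub, map_sub, mul_sub, Finset.sum_sub_distrib]
    exact sub_eq_zero.2 hHxy
  set w : ι × Fin (E + 1) → A := fun i => polyComb b D (x i - y i) with hw
  let W : A := ∑ i, s i * w i ^ N
  let _ : Algebra k A := Algebra.compHom A (C : k →+* k[X])
  have hW : ∃ v, W ^ N = M • v := by
    choose v hv using fun i => hM (w i)
    refine ⟨∑ i, s i ^ N * v i, ?_⟩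
    calc W ^ N = ∑ i, (s i * w i ^ N) ^ N := by rw [hN]; exact sum_pow_card_pow k a _ _
      _ = ∑ i, (s i ^ N * T (w i) + M • (s i ^ N * v i)) := by
        refine Finset.sum_congr rfl fun i _ => ?_
        rw [← mul_smul_comm, ← hv i, mul_pow, ← pow_mul, ← sq]; ring
      _ = _ := by rw [Finset.sum_add_distrib, hz, zero_add, Finset.smul_sum]
  obtain ⟨v, hv⟩ := hred W hW
  have hWdeg : DegLE b (E + N * (D + c) + c) W :=
    DegLE.sum _ fun i _ => hc _ _ _ _ (hs i) ((degLE_polyComb b D _).pow hc hN0)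
  have hW0 : W ≠ 0 := by
    intro h0
    have h1 := eq_zero_of_sum_mul_pow_eq_zero a (fun i => θ (s i)) (fun u hu => by
      apply eq_zero_of_polyComb_eq_zero b E u
      by_contra hne
      refine hc₂ E _ (degLE_polyComb b E u) hne ((pow_dvd_pow _ hE).trans ?_)
      rw [polyComb_eq_sum, map_sum]
      convert hu using 2 with i
      rw [map_smul, Algebra.smul_def]
      congr 1
      exact Polynomial.coe_C _) (fun i => θ (w i)) (by
        rw [← map_zero θ, ← h0, map_sum]
        exact Finset.sum_congr rfl fun i _ => by rw [map_mul, map_pow])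
    apply hxy
    funext i
    have h2 : w i = 0 := hθ ((congrFun h1 i).trans (map_zero θ).symm)
    exact sub_eq_zero.1 (eq_zero_of_polyComb_eq_zero b D _ h2)
  exact (Nat.mul_le_mul_left _ (natDegree_le_of_eq_smul hWdeg hW0 hv)).trans hfin

end Stepanov

section Reduced

variable {k A ι κ : Type*} [Field k] [Fintype k] [CommRing A] [Algebra k[X] A] [Fintype ι]
  [DecidableEq ι] [Fintype κ]

theorem exists_pow_det_smul_mem_span (Y : Matrix ι ι A) (B : Matrix ι ι k[X])
    (hY : Y.map (fun u => u ^ Fintype.card k) = B.map (algebraMap k[X] A) * Y)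
    (hgen : Algebra.adjoin k[X] (Set.range fun ij : ι × ι => Y ij.1 ij.2) = ⊤) (u : A) :
    ∃ e : ℕ, B.det ^ e • u ∈
      Submodule.span k[X] (Set.range fun u : A => u ^ Fintype.card k) := by
  set U := Submodule.span k[X] (Set.range fun u : A => u ^ Fintype.card k) with hU
  have hmul : U * U ≤ U := by
    rw [hU, Submodule.span_mul_span]
    refine Submodule.span_mono ?_
    rintro _ ⟨_, ⟨x, rfl⟩, _, ⟨y, rfl⟩, rfl⟩
    exact ⟨x * y, mul_pow _ _ _⟩
  have hu : u ∈ Algebra.adjoin k[X] (Set.range fun ij : ι × ι => Y ij.1 ij.2) := by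
    rw [hgen]; trivial
  induction hu using Algebra.adjoin_induction with
  | mem x hx =>
    obtain ⟨⟨i, j⟩, rfl⟩ := hx
    refine ⟨1, ?_⟩
    have h1 : (B.det • Y) = B.adjugate.map (algebraMap k[X] A) *
        Y.map (fun u => u ^ Fintype.card k) := by
      rw [hY, ← mul_assoc, ← Matrix.map_mul, Matrix.adjugate_mul]
      ext i j
      simp [Matrix.mul_apply, Algebra.smul_def, Matrix.algebraMap_matrix_apply]
    have h2 := congrFun (congrFun h1 i) j
    rw [Matrix.smul_apply] at h2
    rw [pow_one, h2, Matrix.mul_apply]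
    refine Submodule.sum_mem _ fun l _ => ?_
    rw [Matrix.map_apply, Matrix.map_apply, ← Algebra.smul_def]
    exact Submodule.smul_mem _ _ (Submodule.subset_span ⟨_, rfl⟩)
  | algebraMap r =>
    refine ⟨0, ?_⟩
    rw [pow_zero, one_smul, Algebra.algebraMap_eq_smul_one]
    exact Submodule.smul_mem _ _ (Submodule.subset_span ⟨1, one_pow _⟩)
  | add x y _ _ hx hy =>
    obtain ⟨e, he⟩ := hx
    obtain ⟨f, hf⟩ := hy
    refine ⟨e + f, ?_⟩
    rw [smul_add]
    refine Submodule.add_mem _ ?_ ?_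
    · rw [add_comm, pow_add, mul_smul]; exact Submodule.smul_mem _ _ he
    · rw [pow_add, mul_smul]; exact Submodule.smul_mem _ _ hf
  | mul x y _ _ hx hy =>
    obtain ⟨e, he⟩ := hx
    obtain ⟨f, hf⟩ := hy
    refine ⟨e + f, ?_⟩
    rw [pow_add, ← smul_mul_smul_comm]
    exact hmul (Submodule.mul_mem_mul he hf)

theorem dvd_of_dvd_pow_card (b : Module.Basis κ k[X] A) (Y : Matrix ι ι A) (B : Matrix ι ι k[X])
    (hY : Y.map (fun u => u ^ Fintype.card k) = B.map (algebraMap k[X] A) * Y)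
    (hgen : Algebra.adjoin k[X] (Set.range fun ij : ι × ι => Y ij.1 ij.2) = ⊤)
    {M : k[X]} (hM : Squarefree M) (hcop : IsCoprime B.det M) (a : ℕ) (u : A)
    (hu : ∃ v, u ^ Fintype.card k ^ a = M • v) : ∃ v, u = M • v := by
  classical
  let _ : Algebra k A := Algebra.compHom A (C : k →+* k[X])
  have hfrob : ∀ u : A, u ^ Fintype.card k =
      ∑ j, (b.repr u j) ^ Fintype.card k • b j ^ Fintype.card k := by
    intro u
    conv_lhs => rw [← b.sum_repr u]
    have := sum_pow_card_pow k 1 Finset.univ fun j => b.repr u j • b j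
    simp only [pow_one] at this
    rw [this]
    exact Finset.sum_congr rfl fun j _ => smul_pow _ _ _
  set P : Matrix κ κ k[X] := fun j l => b.repr (b j ^ Fintype.card k) l with hP
  have hdetP : ∃ e, P.det ∣ B.det ^ e := by
    choose e he using fun j => exists_pow_det_smul_mem_span Y B hY hgen (b j)
    have hle : Submodule.span k[X] (Set.range fun u : A => u ^ Fintype.card k) ≤
        Submodule.span k[X] (Set.range fun j => b j ^ Fintype.card k) := by
      rw [Submodule.span_le]
      rintro _ ⟨u, rfl⟩
      change u ^ Fintype.card k ∈ _
      rw [hfrob]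
      exact Submodule.sum_mem _ fun j _ => Submodule.smul_mem _ _ (Submodule.subset_span ⟨j, rfl⟩)
    choose P' hP' using fun j => (Submodule.mem_span_range_iff_exists_fun k[X]).1 (hle (he j))
    refine ⟨∑ j, e j, (Matrix.of P').det, ?_⟩
    rw [mul_comm, ← Matrix.det_mul, ← Finset.prod_pow_eq_pow_sum, ← Matrix.det_diagonal]
    congr 1
    ext1 i l
    have := congrFun (congrArg (fun v => (b.repr v : κ → k[X])) (hP' i)) l
    simp only [map_sum, map_smul, Finsupp.coe_smul, Finsupp.finsetSum_apply, Pi.smul_apply,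
      Module.Basis.repr_self, smul_eq_mul] at this
    rw [Matrix.mul_apply, Matrix.diagonal_apply]
    simp only [Matrix.of_apply, hP]
    rw [this, Finsupp.single_apply]
    split_ifs <;> simp
  obtain ⟨e, he⟩ := hdetP
  have hcopP : IsCoprime P.det M := (hcop.pow_left (m := e)).of_isCoprime_of_dvd_left he
  have core : ∀ u : A, (∃ v, u ^ Fintype.card k = M • v) → ∃ v, u = M • v := by
    rintro u ⟨v, hv⟩
    have h1 : Matrix.vecMul (fun j => b.repr u j ^ Fintype.card k) P = M • ⇑(b.repr v) := by
      ext1 l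
      have := congrFun (congrArg (fun v => (b.repr v : κ → k[X])) ((hfrob u).symm.trans hv)) l
      simpa [Matrix.vecMul, dotProduct, hP] using this
    have h2 : ∀ j, M ∣ b.repr u j := by
      intro j
      have h3 := congrFun (congrArg (fun w => Matrix.vecMul w P.adjugate) h1) j
      simp only [Matrix.vecMul_vecMul, Matrix.mul_adjugate, Matrix.vecMul_smul,
        Matrix.vecMul_one, Matrix.smul_vecMul, Pi.smul_apply, smul_eq_mul] at h3
      have h4 : M ∣ P.det * b.repr u j ^ Fintype.card k := ⟨_, h3⟩
      exact (hM.dvd_pow_iff_dvd Fintype.card_ne_zero).1 (hcopP.symm.dvd_of_dvd_mul_left h4)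
    choose w hw using h2
    refine ⟨∑ j, w j • b j, ?_⟩
    conv_lhs => rw [← b.sum_repr u]
    rw [Finset.smul_sum]
    exact Finset.sum_congr rfl fun j _ => by rw [hw j, mul_smul]
  induction a generalizing u with
  | zero => simpa using hu
  | succ a ih =>
    refine core u (ih _ ?_)
    rwa [← pow_mul, ← pow_succ']

end Reduced

section Translation

variable {k A ι κ : Type*} [Field k] [CommRing A] [Algebra k[X] A] [Fintype ι] [DecidableEq ι]

/-- Evaluation of polynomials at the entries of the translate `g Y`. -/
noncomputable def evalTranslate (Y : Matrix ι ι A) (g : Matrix ι ι k) :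
    MvPolynomial (ι × ι) k[X] →ₐ[k[X]] A :=
  MvPolynomial.aeval fun ij => ((g.map C).map (algebraMap k[X] A) * Y) ij.1 ij.2

/-- The matrices `g` such that `Y ↦ g Y` respects all algebraic relations between the entries
of `Y`. -/
def relationStabilizer (Y : Matrix ι ι A) : Set (Matrix ι ι k) :=
  {g | ∀ p, evalTranslate Y (1 : Matrix ι ι k) p = 0 → evalTranslate Y g p = 0}

theorem evalTranslate_one_X (Y : Matrix ι ι A) (ij : ι × ι) :
    evalTranslate Y (1 : Matrix ι ι k) (MvPolynomial.X ij) = Y ij.1 ij.2 := by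
  simp [evalTranslate]

theorem evalTranslate_one_surjective (Y : Matrix ι ι A)
    (hgen : Algebra.adjoin k[X] (Set.range fun ij : ι × ι => Y ij.1 ij.2) = ⊤) :
    Function.Surjective (evalTranslate Y (1 : Matrix ι ι k)) := by
  rw [Algebra.adjoin_range_eq_range_aeval] at hgen
  intro u
  obtain ⟨p, hp⟩ : u ∈ (MvPolynomial.aeval (R := k[X]) fun ij : ι × ι => Y ij.1 ij.2).range := by
    rw [hgen]; trivial
  refine ⟨p, ?_⟩
  rw [← hp]
  change _ = MvPolynomial.aeval _ p
  simp [evalTranslate]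

theorem mul_mem_relationStabilizer (Y : Matrix ι ι A) {g g' : Matrix ι ι k}
    (hg : g ∈ relationStabilizer Y) (hg' : g' ∈ relationStabilizer Y) :
    g' * g ∈ relationStabilizer Y := by
  let σ : MvPolynomial (ι × ι) k[X] →ₐ[k[X]] MvPolynomial (ι × ι) k[X] :=
    MvPolynomial.aeval fun ij => ∑ l, MvPolynomial.C (C (g' ij.1 l)) * MvPolynomial.X (l, ij.2)
  have hσ : ∀ g₁ : Matrix ι ι k, ∀ p, evalTranslate Y g₁ (σ p) = evalTranslate Y (g' * g₁) p := by
    intro g₁ p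
    rw [← AlgHom.comp_apply]
    congr 1
    apply MvPolynomial.algHom_ext
    intro ij
    simp only [σ, evalTranslate, AlgHom.comp_apply, MvPolynomial.aeval_X, map_sum, map_mul,
      MvPolynomial.aeval_C]
    rw [Matrix.map_mul, Matrix.map_mul, mul_assoc]
    simp [Matrix.mul_apply]
  intro p hp
  rw [← hσ]
  apply hg
  rw [hσ, mul_one]
  exact hg' p hp

theorem card_le_of_subset_relationStabilizer [Fintype κ] [IsDomain A] (b : Module.Basis κ k[X] A)
    (θ : A →ₐ[k[X]] PowerSeries k) (Y : Matrix ι ι A)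
    (hgen : Algebra.adjoin k[X] (Set.range fun ij : ι × ι => Y ij.1 ij.2) = ⊤)
    (hone : ∀ i j, PowerSeries.constantCoeff (θ (Y i j)) = (1 : Matrix ι ι k) i j)
    (S : Finset (Matrix ι ι k)) (hS : ∀ g ∈ S, g ∈ relationStabilizer Y) :
    S.card ≤ Fintype.card κ := by
  have hsurj := evalTranslate_one_surjective Y hgen
  let χ : S → A →ₐ[k[X]] PowerSeries k := fun g =>
    θ.comp (AlgHom.liftOfSurjective (evalTranslate Y (1 : Matrix ι ι k)) hsurj
      (evalTranslate Y g.1) fun p hp => hS g.1 g.2 p hp)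
  have hχ : ∀ g p, χ g (evalTranslate Y (1 : Matrix ι ι k) p) = θ (evalTranslate Y g.1 p) := by
    intro g p
    have h := AlgHom.liftOfSurjective_apply (evalTranslate Y (1 : Matrix ι ι k)) hsurj
      (evalTranslate Y g.1) (fun p hp => hS g.1 g.2 p hp) p
    exact congrArg θ h
  have hcoeff : ∀ g i j, PowerSeries.constantCoeff (χ g (Y i j)) = g.1 i j := by
    intro g i j
    have h1 := hχ g (MvPolynomial.X (i, j))
    rw [evalTranslate_one_X] at h1
    rw [h1, evalTranslate, MvPolynomial.aeval_X, Matrix.mul_apply, map_sum, map_sum]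
    simp only [map_mul, hone, Matrix.map_apply, AlgHom.commutes]
    have : ∀ c : k, PowerSeries.constantCoeff (algebraMap k[X] (PowerSeries k) (C c)) = c := by
      intro c
      change PowerSeries.constantCoeff ((C c : k[X]) : PowerSeries k) = c
      rw [Polynomial.coe_C, PowerSeries.constantCoeff_C]
    simp only [this]
    rw [← Matrix.mul_apply, mul_one]
  have hinj : Function.Injective fun g : S => ((χ g : A →* PowerSeries k)) := by
    intro g g' h
    apply Subtype.ext
    ext i j
    rw [← hcoeff g i j, ← hcoeff g' i j]
    exact congrArg PowerSeries.constantCoeff (DFunLike.congr_fun h (Y i j))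
  have hli := (linearIndependent_monoidHom A (PowerSeries k)).comp _ hinj
  have hli' : LinearIndependent (PowerSeries k) fun g : S => fun j => χ g (b j) := by
    rw [Fintype.linearIndependent_iff] at hli ⊢
    intro c hc
    apply hli c
    funext u
    have h1 : ∀ j, ∑ g, c g * χ g (b j) = 0 := fun j => by
      simpa using congrFun hc j
    simp only [Function.comp_apply, Finset.sum_apply, Pi.smul_apply, smul_eq_mul, Pi.zero_apply]
    change ∑ g, c g * χ g u = 0
    rw [← b.sum_repr u]
    simp only [map_sum, map_smul, Finset.mul_sum]
    rw [Finset.sum_comm]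
    refine Finset.sum_eq_zero fun j _ => ?_
    simp only [mul_smul_comm]
    rw [← Finset.smul_sum, h1, smul_zero]
  simpa using hli'.fintype_card_le_finrank

/-- `Y ↦ Y ^ n` agrees with `Y ↦ g Y` modulo `M`. -/
structure FrobeniusCongr (Y : Matrix ι ι A) (n : ℕ) (g : Matrix ι ι k) (M : k[X]) : Prop where
  scalar : ∀ p : k[X], M ∣ p ^ n - p
  entry : ∀ i j, ∃ v, Y i j ^ n - ((g.map C).map (algebraMap k[X] A) * Y) i j = M • v

theorem FrobeniusCongr.evalTranslate [Fintype k] {Y : Matrix ι ι A} {a : ℕ} {g : Matrix ι ι k}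
    {M : k[X]} (h : FrobeniusCongr Y (Fintype.card k ^ a) g M) (p : MvPolynomial (ι × ι) k[X]) :
    ∃ v, evalTranslate Y (1 : Matrix ι ι k) p ^ Fintype.card k ^ a - evalTranslate Y g p =
      M • v := by
  let _ : Algebra k A := Algebra.compHom A (C : k →+* k[X])
  induction p using MvPolynomial.induction_on with
  | C r =>
    obtain ⟨v, hv⟩ := h.scalar r
    refine ⟨algebraMap k[X] A v, ?_⟩
    rw [← MvPolynomial.algebraMap_eq, AlgHom.commutes, AlgHom.commutes, ← map_pow, ← map_sub, hv,
      map_mul, Algebra.smul_def]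
  | add p q hp hq =>
    obtain ⟨v, hv⟩ := hp
    obtain ⟨w, hw⟩ := hq
    refine ⟨v + w, ?_⟩
    rw [map_add, map_add, add_pow_card_pow k, smul_add, ← hv, ← hw]
    ring
  | mul_X p ij hp =>
    obtain ⟨v, hv⟩ := hp
    obtain ⟨w, hw⟩ := h.entry ij.1 ij.2
    refine ⟨v * Y ij.1 ij.2 ^ Fintype.card k ^ a + _root_.evalTranslate Y g p * w, ?_⟩
    rw [map_mul, map_mul, mul_pow, evalTranslate_one_X, smul_add, ← smul_mul_assoc,
      ← mul_smul_comm, ← hv, ← hw]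
    simp only [_root_.evalTranslate, MvPolynomial.aeval_X]
    ring

theorem natDegree_le_of_notMem_relationStabilizer [Fintype k] [Fintype κ]
    (b : Module.Basis κ k[X] A) (Y : Matrix ι ι A) {g : Matrix ι ι k}
    (hg : g ∉ relationStabilizer Y) :
    ∃ C : ℕ, ∀ a M, FrobeniusCongr Y (Fintype.card k ^ a) g M → M.natDegree ≤ C := by
  simp only [relationStabilizer, Set.mem_ofPred_eq, not_forall] at hg
  obtain ⟨p, hp, hp'⟩ := hg
  obtain ⟨E, hE⟩ := exists_degLE (b := b) (evalTranslate Y g p)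
  refine ⟨E, fun a M h => ?_⟩
  obtain ⟨v, hv⟩ := h.evalTranslate p
  rw [hp, zero_pow (pow_ne_zero _ Fintype.card_ne_zero), zero_sub, neg_eq_iff_eq_neg,
    ← smul_neg] at hv
  exact natDegree_le_of_eq_smul hE hp' hv

theorem card_mul_natDegree_le [Fintype k] [Fintype κ] [Nonempty κ] [IsDomain A]
    (b : Module.Basis κ k[X] A)
    (θ : A →ₐ[k[X]] PowerSeries k) (hθ : Function.Injective θ) (Y : Matrix ι ι A)
    (B : Matrix ι ι k[X])
    (hY : Y.map (fun u => u ^ Fintype.card k) = B.map (algebraMap k[X] A) * Y)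
    (hgen : Algebra.adjoin k[X] (Set.range fun ij : ι × ι => Y ij.1 ij.2) = ⊤)
    (g : Matrix ι ι k) :
    ∃ C N₀ : ℕ, ∀ a, N₀ ≤ Fintype.card k ^ a → ∀ M : k[X], Squarefree M → IsCoprime B.det M →
      FrobeniusCongr Y ((Fintype.card k ^ a) ^ 2) g M →
      Fintype.card κ * M.natDegree ≤ (Fintype.card k ^ a) ^ 2 + C * Fintype.card k ^ a := by
  choose l hl using evalTranslate_one_surjective Y hgen
  let T : A →ₗ[k[X]] A := b.constr k[X] fun j => evalTranslate Y g (l (b j))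
  obtain ⟨C, N₀, hC⟩ := stepanov_bound b θ hθ T
  refine ⟨C, N₀, fun a ha M hM hcop hfrob => hC a ha M (fun u => ?_)
    fun u hu => dvd_of_dvd_pow_card b Y B hY hgen hM hcop a u hu⟩
  rw [← pow_mul] at hfrob ⊢
  obtain ⟨v, hv⟩ := hfrob.evalTranslate (∑ j, b.repr u j • l (b j))
  refine ⟨v, ?_⟩
  rw [← hv]
  simp only [map_sum, map_smul, hl]
  rw [b.sum_repr]
  congr 1
  conv_lhs => rw [← b.sum_repr u]
  simp only [map_sum, map_smul, T, Module.Basis.constr_basis]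

end Translation

section Solution

variable {k ι : Type*} [Field k] [Fintype k] [Fintype ι]

theorem isIntegral_of_frobenius_solution {A : Type*} [CommRing A] [Algebra k[X] A]
    (B : Matrix ι ι k[X]) (Y : Matrix ι ι A)
    (hY : Y.map (fun u => u ^ Fintype.card k) = B.map (algebraMap k[X] A) * Y) (i j : ι) :
    IsIntegral k[X] (Y i j) := by
  let _ : Algebra k A := Algebra.compHom A (C : k →+* k[X])
  let N : Submodule k[X] A := Submodule.span k[X] (Set.range fun ij : ι × ι => Y ij.1 ij.2)
  have hfin : Module.Finite k[X] N := Module.Finite.span_of_finite _ (Set.finite_range _)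
  have hpow : ∀ u ∈ N, u ^ Fintype.card k ∈ N := by
    intro u hu
    induction hu using Submodule.span_induction with
    | mem x hx =>
      obtain ⟨⟨a, b⟩, rfl⟩ := hx
      have := congrFun (congrFun hY a) b
      simp only [Matrix.map_apply, Matrix.mul_apply] at this
      simp only [this]
      refine N.sum_mem fun l _ => ?_
      rw [← Algebra.smul_def]
      exact N.smul_mem _ (Submodule.subset_span ⟨(l, b), rfl⟩)
    | zero => rw [zero_pow Fintype.card_ne_zero]; exact N.zero_mem
    | add x y _ _ hx hy =>
      have := add_pow_card_pow k 1 x y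
      rw [pow_one] at this
      rw [this]
      exact N.add_mem hx hy
    | smul c x _ hx =>
      rw [_root_.smul_pow]
      exact N.smul_mem _ hx
  have hmem : ∀ m, Y i j ^ Fintype.card k ^ m ∈ N := by
    intro m
    induction m with
    | zero =>
      rw [pow_zero, pow_one]
      exact Submodule.subset_span ⟨(i, j), rfl⟩
    | succ m ih => rw [pow_succ, pow_mul]; exact hpow _ ih
  have hN : IsNoetherian k[X] N := isNoetherian_of_isNoetherianRing_of_finite _ _
  let w : ℕ → N := fun m => ⟨Y i j ^ Fintype.card k ^ m, hmem m⟩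
  let S : ℕ →o Submodule k[X] N :=
    ⟨fun m => Submodule.span k[X] (w '' Set.Iio m), fun a b h =>
      Submodule.span_mono (Set.image_mono (Set.Iio_subset_Iio h))⟩
  obtain ⟨m, hm⟩ := monotone_stabilizes_iff_noetherian.mpr hN S
  have h1 : w m ∈ S m := by
    rw [hm (m + 1) (by omega)]
    exact Submodule.subset_span ⟨m, by simp, rfl⟩
  have h2 : ∃ p : k[X][X], p.degree < (Fintype.card k ^ m : ℕ) ∧ aeval (Y i j) p = w m := by
    have h3 : ∀ v ∈ S m, ∃ p : k[X][X], p.degree < (Fintype.card k ^ m : ℕ) ∧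
        aeval (Y i j) p = v := by
      intro v hv
      induction hv using Submodule.span_induction with
      | mem x hx =>
        obtain ⟨a, ha, rfl⟩ := hx
        refine ⟨X ^ Fintype.card k ^ a, ?_, by simp [w]⟩
        rw [degree_X_pow]
        exact_mod_cast Nat.pow_lt_pow_right Fintype.one_lt_card ha
      | zero => exact ⟨0, by rw [degree_zero]; exact WithBot.bot_lt_coe _, by simp⟩
      | add x y _ _ hx hy =>
        obtain ⟨p, hp, hp'⟩ := hx
        obtain ⟨r, hr, hr'⟩ := hy
        exact ⟨p + r, (degree_add_le _ _).trans_lt (max_lt hp hr), by simp [hp', hr']⟩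
      | smul c x _ hx =>
        obtain ⟨p, hp, hp'⟩ := hx
        exact ⟨c • p, (degree_smul_le _ _).trans_lt hp, by simp [hp']⟩
    exact h3 _ h1
  obtain ⟨p, hp, hp'⟩ := h2
  refine ⟨X ^ Fintype.card k ^ m - p, monic_X_pow_sub hp, ?_⟩
  rw [← aeval_def, map_sub, hp']
  simp [w]

variable [DecidableEq ι]

theorem PowerSeries.coeff_pow_card (f : PowerSeries k) (n : ℕ) :
    PowerSeries.coeff n (f ^ Fintype.card k) =
      if Fintype.card k ∣ n then PowerSeries.coeff (n / Fintype.card k) f else 0 := by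
  have hc : 1 < Fintype.card k := Fintype.one_lt_card
  have hdvd : (PowerSeries.X : PowerSeries k) ^ (n + 1) ∣ f - (f.trunc (n + 1) : k[X]) := by
    rw [PowerSeries.X_pow_dvd_iff]
    intro m hm
    simp [Polynomial.coeff_coe, PowerSeries.coeff_trunc, hm]
  obtain ⟨g, hg⟩ := hdvd
  have h1 : f ^ Fintype.card k = ((f.trunc (n + 1) ^ Fintype.card k : k[X]) : PowerSeries k) +
      (PowerSeries.X ^ (n + 1) * g) ^ Fintype.card k := by
    have := add_pow_card_pow k 1 ((f.trunc (n + 1) : k[X]) : PowerSeries k)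
      (PowerSeries.X ^ (n + 1) * g)
    rw [pow_one] at this
    rw [Polynomial.coe_pow, ← this, ← hg, add_sub_cancel]
  have h2 : PowerSeries.coeff n ((PowerSeries.X ^ (n + 1) * g) ^ Fintype.card k) = 0 := by
    have : (PowerSeries.X : PowerSeries k) ^ (n + 1) ∣
        (PowerSeries.X ^ (n + 1) * g) ^ Fintype.card k :=
      (dvd_mul_right _ _).trans (dvd_pow_self _ (by omega))
    exact PowerSeries.X_pow_dvd_iff.mp this n (by omega)
  rw [h1, map_add, h2, add_zero, Polynomial.coeff_coe, ← FiniteField.expand_card,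
    Polynomial.coeff_expand (by omega)]
  split_ifs with h
  · rw [PowerSeries.coeff_trunc, if_pos]
    have := Nat.div_le_self n (Fintype.card k)
    omega
  · rfl

/-- The coefficients of the power series solution of `Y ^ (card k) = B Y`, `Y(0) = 1`. -/
noncomputable def frobeniusSolutionCoeff (B : Matrix ι ι k[X]) : ℕ → Matrix ι ι k
  | 0 => 1
  | n + 1 => (if _h : 1 < Fintype.card k ∧ Fintype.card k ∣ n + 1 then
        frobeniusSolutionCoeff B ((n + 1) / Fintype.card k) else 0) -
      ∑ i : Fin (n + 1), B.map (fun p => p.coeff (n + 1 - i)) * frobeniusSolutionCoeff B i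
  decreasing_by
    · exact Nat.div_lt_self n.succ_pos (by tauto)
    · exact i.2

theorem exists_frobenius_solution (B : Matrix ι ι k[X])
    (hB : B.map (fun p => p.coeff 0) = 1) :
    ∃ Y : Matrix ι ι (PowerSeries k),
      Y.map (fun u => u ^ Fintype.card k) = B.map (algebraMap k[X] (PowerSeries k)) * Y ∧
      ∀ i j, PowerSeries.constantCoeff (Y i j) = (1 : Matrix ι ι k) i j := by
  refine ⟨Matrix.of fun i j => PowerSeries.mk fun n => frobeniusSolutionCoeff B n i j, ?_, ?_⟩
  · ext i j n
    rw [Matrix.map_apply, Matrix.of_apply, PowerSeries.coeff_pow_card, Matrix.mul_apply, map_sum]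
    simp only [PowerSeries.coeff_mk, Matrix.map_apply, Matrix.of_apply, PowerSeries.coeff_mul]
    have hco : ∀ (p : k[X]) m, PowerSeries.coeff m (algebraMap k[X] (PowerSeries k) p) =
      p.coeff m := fun p m => Polynomial.coeff_coe p m
    simp only [hco]
    rw [Finset.sum_comm, Finset.Nat.sum_antidiagonal_eq_sum_range_succ
      (fun a b => ∑ l, (B i l).coeff a * frobeniusSolutionCoeff B b l j),
      ← Finset.sum_range_reflect, Finset.sum_range_succ]
    have h0 : ∑ l, (B i l).coeff (n + 1 - 1 - n) *
        frobeniusSolutionCoeff B (n - (n + 1 - 1 - n)) l j = frobeniusSolutionCoeff B n i j := by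
      have e1 : n + 1 - 1 - n = 0 := by omega
      rw [e1, Nat.sub_zero]
      have : (B.map (fun p => p.coeff 0) * frobeniusSolutionCoeff B n) i j =
          frobeniusSolutionCoeff B n i j := by rw [hB, Matrix.one_mul]
      rwa [Matrix.mul_apply] at this
    rw [h0]
    cases n with
    | zero => simp
    | succ n =>
      conv_rhs => rw [frobeniusSolutionCoeff]
      rw [Matrix.sub_apply, Matrix.sum_apply, Finset.sum_range]
      simp only [Matrix.mul_apply, Matrix.map_apply]
      have : ∀ x : Fin (n + 1), n + 1 - (n + 1 + 1 - 1 - (x : ℕ)) = x := fun x => by omega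
      simp only [this]
      have h3 : ∀ x : Fin (n + 1), n + 1 + 1 - 1 - (x : ℕ) = n + 1 - x := fun x => by omega
      simp only [h3, add_sub_cancel]
      have hc : 1 < Fintype.card k := Fintype.one_lt_card
      by_cases h : Fintype.card k ∣ n + 1
      · simp [h, hc]
      · simp [h]
  · intro i j
    rw [← PowerSeries.coeff_zero_eq_constantCoeff_apply, Matrix.of_apply, PowerSeries.coeff_mk,
      frobeniusSolutionCoeff]

/-- A finite free `k[X]`-domain of power series over which the Frobenius equation
`Y ^ (card k) = B Y` has a solution. -/
theorem exists_frobenius_cover (B : Matrix ι ι k[X]) (hB : B.map (fun p => p.coeff 0) = 1) :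
    ∃ (A : Subalgebra k[X] (PowerSeries k)) (h : ℕ) (_ : Module.Basis (Fin (h + 1)) k[X] A)
      (Y : Matrix ι ι A),
      Y.map (fun u => u ^ Fintype.card k) = B.map (algebraMap k[X] A) * Y ∧
      Algebra.adjoin k[X] (Set.range fun ij : ι × ι => Y ij.1 ij.2) = ⊤ ∧
      ∀ i j, PowerSeries.constantCoeff (A.val (Y i j)) = (1 : Matrix ι ι k) i j := by
  obtain ⟨Y, hY, hone⟩ := exists_frobenius_solution B hB
  let A := Algebra.adjoin k[X] (Set.range fun ij : ι × ι => Y ij.1 ij.2)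
  have hfin : Module.Finite k[X] A := by
    refine Module.Finite.of_fg (N := Subalgebra.toSubmodule A) ?_
    refine fg_adjoin_of_finite (Set.finite_range _) ?_
    rintro _ ⟨ij, rfl⟩
    exact isIntegral_of_frobenius_solution B Y hY _ _
  have htf : Module.IsTorsionFree k[X] (PowerSeries k) := by
    refine ⟨fun r hr u v huv => ?_⟩
    have hr0 : algebraMap k[X] (PowerSeries k) r ≠ 0 := by
      change (r : PowerSeries k) ≠ 0
      rw [Ne, Polynomial.coe_eq_zero_iff]
      exact hr.ne_zero
    simp only [Algebra.smul_def] at huv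
    exact mul_left_cancel₀ hr0 huv
  have hfree : Module.Free k[X] A := Module.free_of_finite_type_torsion_free'
  have hpos : 0 < Module.finrank k[X] A := Module.finrank_pos
  obtain ⟨h, hh⟩ := Nat.exists_eq_succ_of_ne_zero hpos.ne'
  refine ⟨A, h, (Module.finBasis k[X] A).reindex (finCongr hh),
    Matrix.of fun i j => ⟨Y i j, Algebra.subset_adjoin ⟨(i, j), rfl⟩⟩, ?_, ?_, fun i j => hone i j⟩
  · refine Matrix.ext fun i j => ?_
    apply Subtype.coe_injective
    have := congrFun (congrFun hY i) j
    simp only [Matrix.map_apply, Matrix.mul_apply] at this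
    simp only [Matrix.map_apply, Matrix.mul_apply, Matrix.of_apply]
    rw [AddSubmonoidClass.coe_finsetSum]
    exact this
  · have := Algebra.adjoin_adjoin_coe_preimage (R := k[X])
      (s := Set.range fun ij : ι × ι => Y ij.1 ij.2)
    rw [← this]
    congr 1
    ext x
    constructor
    · rintro ⟨ij, rfl⟩
      exact ⟨ij, rfl⟩
    · rintro ⟨ij, h⟩
      exact ⟨ij, Subtype.ext h⟩

end Solution

section FrobeniusProduct

variable {F ι : Type*} [Field F] [Fintype ι] [DecidableEq ι]

/-- The homogenization of `f`, evaluated at `(α, β)`. -/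
noncomputable def homEval {R S : Type*} [CommSemiring R] [Semiring S] [Algebra R S] (α β : S)
    (n : ℕ) (f : R[X]) : S :=
  ∑ i ∈ Finset.range (n + 1), f.coeff i • (α ^ i * β ^ (n - i))

theorem homEval_X_sub_C_mul {R S : Type*} [CommRing R] [Ring S] [Algebra R S] {α β : S}
    (hαβ : Commute α β) (n : ℕ) (f : R[X]) (hf : f.natDegree ≤ n) (c : R) :
    homEval α β (n + 1) ((X - C c) * f) = (α - c • β) * homEval α β n f := by
  have h1 : homEval α β (n + 1) (X * f) = α * homEval α β n f := by
    rw [homEval, homEval, Finset.sum_range_succ']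
    simp only [coeff_X_mul, coeff_X_mul_zero, zero_smul, add_zero, Finset.mul_sum]
    refine Finset.sum_congr rfl fun i _ => ?_
    rw [Nat.add_sub_add_right, pow_succ', mul_smul_comm, mul_assoc]
  have h2 : homEval α β (n + 1) f = β * homEval α β n f := by
    rw [homEval, homEval, Finset.sum_range_succ, coeff_eq_zero_of_natDegree_lt (by omega), zero_smul,
      add_zero, Finset.mul_sum]
    refine Finset.sum_congr rfl fun i hi => ?_
    rw [Finset.mem_range] at hi
    rw [Nat.succ_sub (by omega), mul_smul_comm, (hαβ.pow_left i).symm.left_comm, pow_succ']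
  rw [sub_mul, sub_mul, ← h1, smul_mul_assoc, ← h2]
  simp only [homEval, coeff_sub, coeff_C_mul, sub_smul, Finset.sum_sub_distrib, Finset.smul_sum,
    mul_smul]

theorem homEval_map {B : Type*} [CommRing B] [Algebra F B] (α β : Matrix ι ι F) (n : ℕ) (f : F[X]) :
    (homEval α β n f).map (algebraMap F B) = homEval (α.map (algebraMap F B))
      (β.map (algebraMap F B)) n (f.map (algebraMap F B)) := by
  have h : ∀ Z : Matrix ι ι F, Z.map (algebraMap F B) = (algebraMap F B).mapMatrix Z := fun _ => rfl
  simp only [homEval, h, map_sum, coeff_map]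
  refine Finset.sum_congr rfl fun i _ => ?_
  rw [← map_pow, ← map_pow, ← map_mul]
  ext a b
  rw [RingHom.mapMatrix_apply, Matrix.map_apply, Matrix.smul_apply, Matrix.smul_apply, smul_eq_mul,
    map_mul, RingHom.mapMatrix_apply, Matrix.map_apply, smul_eq_mul]

variable [Fintype F] (α β : Matrix ι ι F)

/-- The product of the `α - x ^ (q ^ i) β` for `i < n`. -/
noncomputable def frobProd {B : Type*} [CommRing B] [Algebra F B] (x : B) : ℕ → Matrix ι ι B
  | 0 => 1
  | n + 1 => (α.map (algebraMap F B) - x ^ Fintype.card F ^ n • β.map (algebraMap F B)) *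
      frobProd x n

variable {B B' : Type*} [CommRing B] [Algebra F B] [CommRing B'] [Algebra F B']

theorem frobProd_map (σ : B →ₐ[F] B') (x : B) (n : ℕ) :
    (frobProd α β x n).map σ = frobProd α β (σ x) n := by
  induction n with
  | zero => ext i j; by_cases h : i = j <;> simp [frobProd, Matrix.one_apply, h]
  | succ n ih =>
    rw [frobProd, Matrix.map_mul, ih, frobProd]
    congr 1
    ext i j
    simp

theorem commute_frobProd {D : Matrix ι ι B} (hα : Commute D (α.map (algebraMap F B)))
    (hβ : Commute D (β.map (algebraMap F B))) (x : B) (n : ℕ) : Commute D (frobProd α β x n) := by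
  induction n with
  | zero => exact Commute.one_right D
  | succ n ih => exact (hα.sub_right (hβ.smul_right _)).mul_right ih

theorem frobProd_add (x : B) (m n : ℕ) :
    frobProd α β x (m + n) = frobProd α β (x ^ Fintype.card F ^ n) m * frobProd α β x n := by
  induction m with
  | zero => rw [zero_add, frobProd, one_mul]
  | succ m ih =>
    rw [Nat.succ_add, frobProd, ih, frobProd, mul_assoc, ← pow_mul, ← pow_add, add_comm n m]

theorem frobProd_map_frobenius (x : B) (m n : ℕ) :
    (frobProd α β x m).map (fun u => u ^ Fintype.card F ^ n) =
      frobProd α β (x ^ Fintype.card F ^ n) m := by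
  have h : ∀ z : B, (FiniteField.frobeniusAlgHom F B ^ n) z = z ^ Fintype.card F ^ n := fun z => by
    rw [AlgHom.coe_pow, FiniteField.coe_frobeniusAlgHom, pow_iterate]
  rw [← h x, ← frobProd_map]
  congr 1
  ext z
  exact (h z).symm

theorem frobProd_mul_of_pow_eq {x : B} {d : ℕ} (hx : x ^ Fintype.card F ^ d = x) (j : ℕ) :
    frobProd α β x (d * j) = frobProd α β x d ^ j := by
  induction j with
  | zero => rw [mul_zero, frobProd, pow_zero]
  | succ j ih => rw [Nat.mul_succ, frobProd_add, hx, ih, pow_succ]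

theorem det_frobProd_ne_zero {L : Type*} [Field L] [Algebra F L] (x : L)
    (hx : (frobProd α β x 1).det ≠ 0) (n : ℕ) : (frobProd α β x n).det ≠ 0 := by
  have h : ∀ m, ∀ z : L, (FiniteField.frobeniusAlgHom F L ^ m) z = z ^ Fintype.card F ^ m :=
    fun m z => by rw [AlgHom.coe_pow, FiniteField.coe_frobeniusAlgHom, pow_iterate]
  induction n with
  | zero => simp [frobProd]
  | succ n ih =>
    rw [add_comm n 1, frobProd_add, Matrix.det_mul, ← h, ← frobProd_map]
    refine mul_ne_zero ?_ ih
    have := (AlgHom.map_det (FiniteField.frobeniusAlgHom F L ^ n) (frobProd α β x 1)).symm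
    rw [AlgHom.mapMatrix_apply] at this
    rw [this, h]
    exact pow_ne_zero _ hx

variable {α β}

theorem homEval_prod_X_sub_C {L : Type*} [Field L] [Algebra F L] (hαβ : Commute α β) (x : L)
    (n : ℕ) :
    homEval (α.map (algebraMap F L)) (β.map (algebraMap F L)) n
      (∏ i ∈ Finset.range n, (X - C (x ^ Fintype.card F ^ i))) = frobProd α β x n := by
  have h : Commute (α.map (algebraMap F L)) (β.map (algebraMap F L)) :=
    hαβ.map ((algebraMap F L).mapMatrix : Matrix ι ι F →+* Matrix ι ι L)
  induction n with
  | zero => simp [homEval, frobProd]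
  | succ n ih =>
    rw [Finset.prod_range_succ, mul_comm, homEval_X_sub_C_mul h, ih, frobProd]
    rw [natDegree_prod_of_monic _ _ fun i _ => monic_X_sub_C _]
    simp only [natDegree_X_sub_C, Finset.sum_const, Finset.card_range, smul_eq_mul, mul_one, le_refl]

theorem Irreducible.map_adjoinRoot_eq_prod {P : F[X]} [Fact (Irreducible P)] (hP : P.Monic) :
    P.map (algebraMap F (AdjoinRoot P)) = ∏ i ∈ Finset.range P.natDegree,
      (X - C (AdjoinRoot.root P ^ Fintype.card F ^ i)) := by
  have hirr : Irreducible P := Fact.out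
  have h : ∀ m, ∀ z : AdjoinRoot P, (FiniteField.frobeniusAlgHom F (AdjoinRoot P) ^ m) z =
      z ^ Fintype.card F ^ m :=
    fun m z => by rw [AlgHom.coe_pow, FiniteField.coe_frobeniusAlgHom, pow_iterate]
  have hfin : Module.Finite F (AdjoinRoot P) := (AdjoinRoot.powerBasis hP.ne_zero).finite
  have hrank : Module.finrank F (AdjoinRoot P) = P.natDegree :=
    (AdjoinRoot.powerBasis hP.ne_zero).finrank
  have : Finite (AdjoinRoot P) := Module.finite_of_finite F
  refine (eq_of_monic_of_dvd_of_natDegree_le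
    (monic_prod_of_monic _ _ fun i _ => monic_X_sub_C _) (hP.map _) ?_ ?_)
  · have hinj : Function.Injective fun i : Fin P.natDegree =>
        AdjoinRoot.root P ^ Fintype.card F ^ (i : ℕ) := by
      intro i j hij
      have := (FiniteField.bijective_frobeniusAlgHom_pow F (AdjoinRoot P)).1
      rw [hrank] at this
      apply this
      apply AdjoinRoot.algHom_ext
      simpa only [h] using hij
    rw [Finset.prod_range]
    refine Finset.prod_dvd_of_coprime ?_ fun i _ => ?_
    · intro i _ j _ hij
      exact pairwise_coprime_X_sub_C hinj hij
    · rw [dvd_iff_isRoot, IsRoot, eval_map_algebraMap, ← h, aeval_algHom_apply, AdjoinRoot.aeval_eq,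
        AdjoinRoot.mk_self, map_zero]
  · rw [natDegree_prod_of_monic _ _ fun i _ => monic_X_sub_C _]
    simp only [natDegree_X_sub_C, Finset.sum_const, Finset.card_range, smul_eq_mul,
      mul_one, natDegree_map, le_refl]

theorem root_pow_card_pow_natDegree {P : F[X]} [Fact (Irreducible P)] (hP : P.Monic) :
    AdjoinRoot.root P ^ Fintype.card F ^ P.natDegree = AdjoinRoot.root P := by
  have hfin : Module.Finite F (AdjoinRoot P) := (AdjoinRoot.powerBasis hP.ne_zero).finite
  have hrank : Module.finrank F (AdjoinRoot P) = P.natDegree :=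
    (AdjoinRoot.powerBasis hP.ne_zero).finrank
  have : Finite (AdjoinRoot P) := Module.finite_of_finite F
  have := Fintype.ofFinite (AdjoinRoot P)
  rw [← hrank, ← Module.card_eq_pow_finrank, FiniteField.pow_card]

theorem frobProd_congr_of_homEval_pow_eq (hαβ : Commute α β) {P : F[X]} (hirr : Irreducible P)
    (hP : P.Monic) {n : ℕ} (hn : P.natDegree ∣ n) {g : Matrix ι ι F}
    (hg : homEval α β P.natDegree P ^ (n / P.natDegree) = g) (i j : ι) :
    P ∣ frobProd α β (X : F[X]) n i j - C (g i j) := by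
  have : Fact (Irreducible P) := ⟨hirr⟩
  obtain ⟨e, rfl⟩ := hn
  rw [Nat.mul_div_cancel_left _ hirr.natDegree_pos] at hg
  rw [← AdjoinRoot.mk_eq_zero, map_sub, sub_eq_zero]
  have h1 := congrFun (congrFun (frobProd_map α β (AdjoinRoot.mkₐ P) X (P.natDegree * e)) i) j
  rw [Matrix.map_apply] at h1
  change _ = AdjoinRoot.of P (g i j)
  refine h1.trans ?_
  change frobProd α β (AdjoinRoot.root P) (P.natDegree * e) i j = _
  rw [frobProd_mul_of_pow_eq α β (root_pow_card_pow_natDegree hP), ← homEval_prod_X_sub_C hαβ,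
    ← Irreducible.map_adjoinRoot_eq_prod hP, ← homEval_map, ← hg]
  change (((algebraMap F (AdjoinRoot P)).mapMatrix _) ^ e) i j = _
  rw [← map_pow]
  rfl

end FrobeniusProduct

section IrreducibleFactors

open scoped Classical in
/-- The monic irreducible polynomials of degree dividing `n`. -/
noncomputable def monicIrreducibles (F : Type*) [Field F] [Fintype F] (n : ℕ) : Finset F[X] :=
  (UniqueFactorizationMonoid.normalizedFactors (X ^ Fintype.card F ^ n - X : F[X])).toFinset

variable {F : Type*} [Field F] [Fintype F]

theorem mem_monicIrreducibles {n : ℕ} (hn : n ≠ 0) {P : F[X]} :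
    P ∈ monicIrreducibles F n ↔ Irreducible P ∧ P.Monic ∧ P.natDegree ∣ n := by
  classical
  have h0 : (X ^ Fintype.card F ^ n - X : F[X]) ≠ 0 :=
    FiniteField.X_pow_card_pow_sub_X_ne_zero _ hn Fintype.one_lt_card
  rw [monicIrreducibles, Multiset.mem_toFinset]
  refine (Polynomial.mem_normalizedFactors_iff h0).trans ?_
  refine and_congr_right fun h => and_congr_right fun _ => ?_
  rw [h.natDegree_dvd_iff_dvd_X_pow_card_pow_sub_X, Nat.card_eq_fintype_card]

theorem squarefree_X_pow_card_pow_sub_X {k : Type*} [Field k] [Algebra F k] {n : ℕ} (hn : n ≠ 0) :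
    Squarefree (X ^ Fintype.card F ^ n - X : k[X]) := by
  obtain ⟨p, hp⟩ := CharP.exists F
  have hk : CharP k p := charP_of_injective_algebraMap (algebraMap F k).injective p
  refine (galois_poly_separable p _ ?_).squarefree
  exact dvd_pow (by rw [← CharP.cast_eq_zero_iff F p, FiniteField.cast_card_eq_zero]) hn

theorem prod_monicIrreducibles {n : ℕ} (hn : n ≠ 0) :
    ∏ P ∈ monicIrreducibles F n, P = X ^ Fintype.card F ^ n - X := by
  classical
  have h0 : (X ^ Fintype.card F ^ n - X : F[X]) ≠ 0 :=
    FiniteField.X_pow_card_pow_sub_X_ne_zero _ hn Fintype.one_lt_card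
  have hsq := squarefree_X_pow_card_pow_sub_X (F := F) (k := F) hn
  have hmon : (X ^ Fintype.card F ^ n - X : F[X]).Monic := by
    refine monic_X_pow_sub ?_
    rw [degree_X]
    exact_mod_cast Nat.one_lt_pow hn Fintype.one_lt_card
  have hnodup := (UniqueFactorizationMonoid.squarefree_iff_nodup_normalizedFactors h0).mp hsq
  have h := leadingCoeff_mul_prod_normalizedFactors (X ^ Fintype.card F ^ n - X : F[X])
  rw [hmon.leadingCoeff, C_1, one_mul] at h
  rw [monicIrreducibles, Finset.prod, Multiset.toFinset_val, hnodup.dedup, Multiset.map_id']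
  convert h

theorem sum_natDegree_monicIrreducibles {n : ℕ} (hn : n ≠ 0) :
    ∑ P ∈ monicIrreducibles F n, P.natDegree = Fintype.card F ^ n := by
  have h := congrArg natDegree (prod_monicIrreducibles (F := F) hn)
  rw [natDegree_prod_of_monic _ _ fun P hP => ((mem_monicIrreducibles hn).mp hP).2.1] at h
  rw [h, FiniteField.X_pow_card_pow_sub_X_natDegree_eq _ hn Fintype.one_lt_card]

variable {ι : Type*} [Fintype ι] [DecidableEq ι]

open scoped Classical in
/-- The monic irreducible polynomials of degree dividing `n` with Frobenius class `g`. -/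
noncomputable def frobClass (α β : Matrix ι ι F) (g : Matrix ι ι F) (n : ℕ) : Finset F[X] :=
  (monicIrreducibles F n).filter fun P => homEval α β P.natDegree P ^ (n / P.natDegree) = g

theorem mem_frobClass {α β g : Matrix ι ι F} {n : ℕ} (hn : n ≠ 0) {P : F[X]} :
    P ∈ frobClass α β g n ↔ (Irreducible P ∧ P.Monic ∧ P.natDegree ∣ n) ∧
      homEval α β P.natDegree P ^ (n / P.natDegree) = g := by
  classical
  rw [frobClass, Finset.mem_filter, mem_monicIrreducibles hn]

theorem natDegree_prod_frobClass (α β g : Matrix ι ι F) {n : ℕ} (hn : n ≠ 0) :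
    (∏ P ∈ frobClass α β g n, P).natDegree = ∑ P ∈ frobClass α β g n, P.natDegree :=
  natDegree_prod_of_monic _ _ fun _ hP => ((mem_frobClass hn).mp hP).1.2.1

theorem prod_frobClass_dvd (α β g : Matrix ι ι F) {n : ℕ} (hn : n ≠ 0) :
    ∏ P ∈ frobClass α β g n, P ∣ X ^ Fintype.card F ^ n - X := by
  classical
  rw [← prod_monicIrreducibles hn]
  exact Finset.prod_dvd_prod_of_subset _ _ _ (Finset.filter_subset _ _)

theorem prod_frobClass_dvd_frobProd {α β : Matrix ι ι F} (hαβ : Commute α β) (g : Matrix ι ι F)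
    {n : ℕ} (hn : n ≠ 0) (i j : ι) :
    ∏ P ∈ frobClass α β g n, P ∣ frobProd α β (X : F[X]) n i j - C (g i j) := by
  refine Finset.prod_dvd_of_coprime ?_ fun P hP => ?_
  · intro P hP P' hP' hne
    have h1 := ((mem_frobClass hn).mp hP).1
    have h2 := ((mem_frobClass hn).mp hP').1
    refine (h1.1.coprime_iff_not_dvd).mpr fun h => hne ?_
    exact eq_of_monic_of_associated h1.2.1 h2.2.1 (h1.1.associated_of_dvd h2.1 h)
  · obtain ⟨⟨h1, h2, h3⟩, h4⟩ := (mem_frobClass hn).mp hP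
    exact frobProd_congr_of_homEval_pow_eq hαβ h1 h2 h3 h4 i j

end IrreducibleFactors

section FrobeniusClasses

variable {F ι k : Type*} [Field F] [Fintype F] [Fintype ι] [DecidableEq ι] [Field k]
  [Algebra F k] {α β : Matrix ι ι F}

theorem aeval_dvd_frobProd_sub (x : k[X]) {n : ℕ} {M : F[X]} {g : Matrix ι ι F} {i j : ι}
    (hM : M ∣ frobProd α β (X : F[X]) n i j - C (g i j)) :
    aeval x M ∣ frobProd α β x n i j - C (algebraMap F k (g i j)) := by
  have h := map_dvd (aeval x) hM
  have h1 := congrFun (congrFun (frobProd_map α β (aeval x : F[X] →ₐ[F] k[X]) X n) i) j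
  rw [Matrix.map_apply, aeval_X] at h1
  rw [map_sub, h1, aeval_C] at h
  exact h

theorem isCoprime_det_of_dvd_sub {Γ : Matrix ι ι k[X]} {g : Matrix ι ι k} (hg : g.det ≠ 0)
    {M : k[X]} (hM : ∀ i j, M ∣ Γ i j - C (g i j)) : IsCoprime Γ.det M := by
  have h : (Ideal.Quotient.mk (Ideal.span {M})).mapMatrix Γ =
      (Ideal.Quotient.mk (Ideal.span {M})).mapMatrix (C.mapMatrix g) := by
    ext i j
    simp only [RingHom.mapMatrix_apply, Matrix.map_apply]
    rw [Ideal.Quotient.eq, Ideal.mem_span_singleton]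
    exact hM i j
  have h1 := congrArg Matrix.det h
  rw [← RingHom.map_det, ← RingHom.map_det, Ideal.Quotient.eq, Ideal.mem_span_singleton,
    ← RingHom.map_det] at h1
  obtain ⟨w, hw⟩ := h1
  refine ⟨C (g.det)⁻¹, -(w * C (g.det)⁻¹), ?_⟩
  have h2 : C (g.det)⁻¹ * C g.det = (1 : k[X]) := by rw [← C_mul, inv_mul_cancel₀ hg, C_1]
  rw [← h2, eq_add_of_sub_eq hw]
  ring

variable [Fintype k]

theorem aeval_dvd_X_pow_card_pow_sub_X (x₀ : k) {n j : ℕ}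
    (hn : Fintype.card F ^ n = Fintype.card k ^ j) {M : F[X]}
    (hM : M ∣ X ^ Fintype.card F ^ n - X) :
    aeval (X + C x₀ : k[X]) M ∣ X ^ Fintype.card k ^ j - X := by
  have h := map_dvd (aeval (X + C x₀ : k[X])) hM
  rw [map_sub, map_pow, aeval_X, hn, add_pow_card_pow k, ← C_pow, FiniteField.pow_card_pow] at h
  convert h using 1
  ring

theorem X_pow_card_pow_sub_X_dvd (j : ℕ) (p : k[X]) :
    (X : k[X]) ^ Fintype.card k ^ j - X ∣ p ^ Fintype.card k ^ j - p := by
  have h : ∀ z : k[X], (FiniteField.frobeniusAlgHom k k[X] ^ j) z = z ^ Fintype.card k ^ j :=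
    fun z => by rw [AlgHom.coe_pow, FiniteField.coe_frobeniusAlgHom, pow_iterate]
  have h1 : p ^ Fintype.card k ^ j = aeval (X ^ Fintype.card k ^ j : k[X]) p := by
    rw [← h, ← h, aeval_algHom_apply, aeval_X_left_apply]
  have h2 := sub_dvd_eval_sub (X ^ Fintype.card k ^ j) X (p.map (algebraMap k k[X]))
  rwa [eval_map_algebraMap, eval_map_algebraMap, aeval_X_left_apply, ← h1] at h2

/-- The twisted powers of a solution of `Y ^ (card k) = Γ c Y`. -/
theorem map_pow_card_pow_eq {A : Type*} [CommRing A] [Algebra k[X] A] {r : ℕ}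
    (hr : Fintype.card k = Fintype.card F ^ r) (x : k[X]) (c : Matrix ι ι k)
    (hcα : Commute c (α.map (algebraMap F k))) (hcβ : Commute c (β.map (algebraMap F k)))
    (Y : Matrix ι ι A)
    (hY : Y.map (fun u => u ^ Fintype.card k) =
      (frobProd α β x r * c.map C).map (algebraMap k[X] A) * Y) (j : ℕ) :
    Y.map (fun u => u ^ Fintype.card k ^ j) =
      (frobProd α β x (r * j) * (c ^ j).map C).map (algebraMap k[X] A) * Y := by
  let _ : Algebra k A := Algebra.compHom A (C : k →+* k[X])
  have hC : ∀ Z : Matrix ι ι F, Z.map (algebraMap F k[X]) = C.mapMatrix (Z.map (algebraMap F k)) :=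
    fun Z => rfl
  induction j with
  | zero =>
    have h1 : (1 : Matrix ι ι k).map C = (1 : Matrix ι ι k[X]) := map_one C.mapMatrix
    have h2 : (1 : Matrix ι ι k[X]).map (algebraMap k[X] A) = 1 :=
      map_one (algebraMap k[X] A).mapMatrix
    rw [pow_zero, pow_zero, mul_zero, frobProd, h1, one_mul, h2, one_mul]
    ext i j
    simp
  | succ j ih =>
    let φ : A →+* A := (FiniteField.frobeniusAlgHom k A : A →+* A)
    have h1 : Y.map (fun u => u ^ Fintype.card k ^ (j + 1)) =
        (Y.map (fun u => u ^ Fintype.card k ^ j)).map φ := by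
      ext a b
      simp only [Matrix.map_apply]
      rw [pow_succ, pow_mul]
      rfl
    have h2 : ∀ Z : Matrix ι ι k[X], (Z.map (algebraMap k[X] A)).map φ =
        (Z.map (fun u => u ^ Fintype.card k)).map (algebraMap k[X] A) := by
      intro Z
      ext a b
      simp only [Matrix.map_apply, map_pow]
      rfl
    have h3 : ((c ^ j).map C).map (fun u : k[X] => u ^ Fintype.card k) = (c ^ j).map C := by
      ext a b : 2
      simp only [Matrix.map_apply]
      rw [← C_pow, FiniteField.pow_card]
    have h4 : (frobProd α β x (r * j) * (c ^ j).map C).map (fun u => u ^ Fintype.card k) =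
        frobProd α β (x ^ Fintype.card F ^ r) (r * j) * (c ^ j).map C := by
      have h5 := map_mul ((FiniteField.frobeniusAlgHom k k[X]).toRingHom.mapMatrix)
        (frobProd α β x (r * j)) ((c ^ j).map C)
      refine h5.trans ?_
      congr 1
      rw [← frobProd_map_frobenius, ← hr]
      rfl
    have h5 : Commute ((c ^ j).map C) (frobProd α β x r) := by
      refine commute_frobProd α β ?_ ?_ x r
      · rw [hC]; exact (hcα.pow_left j).map C.mapMatrix
      · rw [hC]; exact (hcβ.pow_left j).map C.mapMatrix
    have h6 : (c ^ (j + 1)).map C = (c ^ j).map C * c.map C := by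
      rw [pow_succ, Matrix.map_mul]
    have h7 : (Y.map φ : Matrix ι ι A) = Y.map (fun u => u ^ Fintype.card k) := rfl
    have h8 : frobProd α β (x ^ Fintype.card F ^ r) (r * j) * (c ^ j).map C *
        (frobProd α β x r * c.map C) =
        frobProd α β (x ^ Fintype.card F ^ r) (r * j) * frobProd α β x r *
          ((c ^ j).map C * c.map C) := by
      rw [mul_assoc, mul_assoc, ← mul_assoc ((c ^ j).map C), h5.eq, mul_assoc]
    rw [h1, ih, Matrix.map_mul, h2, h4, h7, hY, ← mul_assoc, ← Matrix.map_mul, h6, Nat.mul_succ,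
      frobProd_add, h8]

theorem exists_frobClass_bounds (hαβ : Commute α β) (x₀ : k) (hx₀ : (frobProd α β x₀ 1).det ≠ 0) :
    ∃ (s h : ℕ) (S : Set (Matrix ι ι F)), 0 < s ∧ 0 < h ∧ (∀ g ∈ S, ∀ g' ∈ S, g * g' ∈ S) ∧
      (∀ T : Finset (Matrix ι ι F), (∀ g ∈ T, g ∈ S) → T.card ≤ h) ∧
      (∀ g, g.det ≠ 0 → g ∉ S → ∃ C, ∀ a, 0 < a →
        ∑ P ∈ frobClass α β g (2 * s * a), P.natDegree ≤ C) ∧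
      ∀ g, g.det ≠ 0 → ∃ C N, ∀ a, N ≤ a →
        h * ∑ P ∈ frobClass α β g (2 * s * a), P.natDegree ≤
          (Fintype.card F ^ (s * a)) ^ 2 + C * Fintype.card F ^ (s * a) := by
  have hfin : Module.Finite F k := Module.Finite.of_finite
  obtain ⟨r, hr0, hr⟩ : ∃ r, 0 < r ∧ Fintype.card k = Fintype.card F ^ r :=
    ⟨Module.finrank F k, Module.finrank_pos, Module.card_eq_pow_finrank⟩
  obtain ⟨u, hu⟩ : IsUnit (frobProd α β x₀ r) := by
    rw [Matrix.isUnit_iff_isUnit_det, isUnit_iff_ne_zero]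
    exact det_frobProd_ne_zero α β x₀ hx₀ r
  have hmapc : Commute (α.map (algebraMap F k)) (β.map (algebraMap F k)) :=
    hαβ.map ((algebraMap F k).mapMatrix : Matrix ι ι F →+* Matrix ι ι k)
  have hcα : Commute ((u⁻¹ : (Matrix ι ι k)ˣ) : Matrix ι ι k) (α.map (algebraMap F k)) := by
    apply Commute.units_inv_left
    rw [hu]
    exact (commute_frobProd α β (Commute.refl _) hmapc x₀ r).symm
  have hcβ : Commute ((u⁻¹ : (Matrix ι ι k)ˣ) : Matrix ι ι k) (β.map (algebraMap F k)) := by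
    apply Commute.units_inv_left
    rw [hu]
    exact (commute_frobProd α β hmapc.symm (Commute.refl _) x₀ r).symm
  let c : Matrix ι ι k := (u⁻¹ : (Matrix ι ι k)ˣ)
  let x : k[X] := X + C x₀
  let B : Matrix ι ι k[X] := frobProd α β x r * c.map C
  have hB : B.map (fun p => p.coeff 0) = 1 := by
    have h1 := frobProd_map α β ((aeval (0 : k)).restrictScalars F : k[X] →ₐ[F] k) x r
    have h2 := map_mul ((aeval (0 : k) : k[X] →ₐ[k] k).toRingHom.mapMatrix)
      (frobProd α β x r) (c.map C)
    have h3 : B.map (fun p => p.coeff 0) = B.map (aeval (0 : k)) := by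
      ext i j
      rw [Matrix.map_apply, Matrix.map_apply, coeff_zero_eq_aeval_zero]
    rw [h3]
    refine h2.trans ?_
    have h4 : (aeval (0 : k) : k[X] →ₐ[k] k).toRingHom.mapMatrix (c.map C) = c := by
      ext i j
      simp
    have h5 : (aeval (0 : k) : k[X] →ₐ[k] k).toRingHom.mapMatrix (frobProd α β x r) =
        frobProd α β x₀ r := by
      refine h1.trans ?_
      congr 1
      simp [x]
    rw [h4, h5, ← hu, Units.mul_inv]
  obtain ⟨A, h, b, Y, hY, hgen, hone⟩ := exists_frobenius_cover B hB
  let e := orderOf u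
  have he : 0 < e := orderOf_pos u
  have hce : ∀ j, c ^ (e * j) = 1 := by
    intro j
    rw [pow_mul, ← Units.val_pow_eq_pow_val, inv_pow, pow_orderOf_eq_one]
    simp
  let M : Matrix ι ι F → ℕ → k[X] := fun g a =>
    aeval x (∏ P ∈ frobClass α β g (r * (e * a)), P)
  have hcard : ∀ j, Fintype.card F ^ (r * j) = Fintype.card k ^ j := fun j => by
    rw [hr, pow_mul]
  have hn0 : ∀ {a}, 0 < a → r * (e * a) ≠ 0 := fun ha => by positivity
  have hMdeg : ∀ g {a}, 0 < a →
      (M g a).natDegree = ∑ P ∈ frobClass α β g (r * (e * a)), P.natDegree := by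
    intro g a ha
    rw [← natDegree_prod_frobClass α β g (hn0 ha)]
    have : M g a = ((∏ P ∈ frobClass α β g (r * (e * a)), P).map (algebraMap F k)).comp
        (X + C x₀) := by
      rw [comp, eval₂_map]
      rfl
    rw [this, natDegree_comp, natDegree_X_add_C, mul_one, natDegree_map]
  have hMdvd : ∀ g {a}, 0 < a → M g a ∣ X ^ Fintype.card k ^ (e * a) - X := fun g a ha =>
    aeval_dvd_X_pow_card_pow_sub_X x₀ (hcard _) (prod_frobClass_dvd α β g (hn0 ha))
  have hMent : ∀ g {a}, 0 < a → ∀ i j, M g a ∣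
      frobProd α β x (r * (e * a)) i j - C ((g.map (algebraMap F k)) i j) := fun g a ha i j =>
    aeval_dvd_frobProd_sub x (prod_frobClass_dvd_frobProd hαβ g (hn0 ha) i j)
  have hMsq : ∀ g {a}, 0 < a → Squarefree (M g a) := by
    intro g a ha
    have hea : e * a ≠ 0 := by positivity
    exact (squarefree_X_pow_card_pow_sub_X (F := k) (k := k) hea).squarefree_of_dvd (hMdvd g ha)
  have hMcop : ∀ g {a}, g.det ≠ 0 → 0 < a → IsCoprime B.det (M g a) := by
    intro g a hg ha
    have h1 : (g.map (algebraMap F k)).det ≠ 0 := by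
      have := RingHom.map_det (algebraMap F k) g
      rw [RingHom.mapMatrix_apply] at this
      rw [← this]
      exact (_root_.map_ne_zero _).mpr hg
    have h2 := isCoprime_det_of_dvd_sub h1 (hMent g ha)
    obtain ⟨j, hj⟩ := Nat.exists_eq_succ_of_ne_zero (show e * a ≠ 0 by positivity)
    rw [hj, Nat.mul_succ, frobProd_add, Matrix.det_mul] at h2
    rw [Matrix.det_mul]
    refine IsCoprime.mul_left h2.of_mul_left_right ?_
    have h3 : IsUnit (c.map C).det := by
      have h4 : IsUnit ((C : k →+* k[X]).mapMatrix c) := (Units.isUnit u⁻¹).map _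
      exact (Matrix.isUnit_iff_isUnit_det _).mp h4
    obtain ⟨v, hv⟩ := h3.exists_left_inv
    exact ⟨v, 0, by rw [hv, zero_mul, add_zero]⟩
  have hMfrob : ∀ g {a}, 0 < a →
      FrobeniusCongr Y (Fintype.card k ^ (e * a)) (g.map (algebraMap F k)) (M g a) := by
    intro g a ha
    refine ⟨fun p => (hMdvd g ha).trans (X_pow_card_pow_sub_X_dvd _ _), fun i j => ?_⟩
    have h1 := map_pow_card_pow_eq hr x c hcα hcβ Y hY (e * a)
    have h2 : (1 : Matrix ι ι k).map C = (1 : Matrix ι ι k[X]) := map_one C.mapMatrix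
    rw [hce, h2, mul_one] at h1
    have h3 := congrFun (congrFun h1 i) j
    rw [Matrix.map_apply] at h3
    choose w hw using fun l => hMent g ha i l
    refine ⟨∑ l, w l • Y l j, ?_⟩
    rw [h3, Matrix.mul_apply, Matrix.mul_apply, ← Finset.sum_sub_distrib, Finset.smul_sum]
    refine Finset.sum_congr rfl fun l _ => ?_
    rw [smul_smul, ← hw, ← sub_mul, Algebra.smul_def]
    simp only [Matrix.map_apply, map_sub]
  have hinj : Function.Injective fun g : Matrix ι ι F => g.map (algebraMap F k) :=
    Matrix.map_injective (algebraMap F k).injective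
  refine ⟨r * e, h + 1, {g | g.map (algebraMap F k) ∈ relationStabilizer Y}, by positivity,
    by positivity, ?_, ?_, ?_, ?_⟩
  · intro g hg g' hg'
    rw [Set.mem_ofPred_eq, Matrix.map_mul]
    exact mul_mem_relationStabilizer Y hg' hg
  · intro T hT
    rw [← Finset.card_map ⟨_, hinj⟩]
    have := card_le_of_subset_relationStabilizer b A.val Y hgen hone (T.map ⟨_, hinj⟩) ?_
    · simpa using this
    · intro g hg
      obtain ⟨g', hg', rfl⟩ := Finset.mem_map.mp hg
      exact hT g' hg'
  · intro g hg hgS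
    obtain ⟨C, hC⟩ := natDegree_le_of_notMem_relationStabilizer b Y hgS
    refine ⟨C, fun a ha => ?_⟩
    have h1 := hC _ _ (hMfrob g (a := 2 * a) (by positivity))
    rw [hMdeg g (by positivity)] at h1
    convert h1 using 3
    ring
  · intro g hg
    obtain ⟨C, N₀, hC⟩ := card_mul_natDegree_le b A.val Subtype.val_injective Y B hY hgen
      (g.map (algebraMap F k))
    refine ⟨C, N₀ + 1, fun a ha => ?_⟩
    have ha0 : 0 < a := by omega
    have h0 : N₀ ≤ Fintype.card k ^ (e * a) := by
      have h1 : e * a < Fintype.card k ^ (e * a) := Nat.lt_pow_self Fintype.one_lt_card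
      have h2 : a ≤ e * a := Nat.le_mul_of_pos_left a he
      omega
    have h1 := hC (e * a) h0 (M g (2 * a)) (hMsq g (by positivity))
      (hMcop g hg (by positivity)) (by
        have := hMfrob g (a := 2 * a) (by positivity)
        rwa [← pow_mul, show e * a * 2 = e * (2 * a) by ring])
    rw [hMdeg g (by positivity), Fintype.card_fin, ← hcard] at h1
    rw [show 2 * (r * e) * a = r * (e * (2 * a)) by ring, mul_assoc r e a]
    exact h1

end FrobeniusClasses

section Equidistribution

theorem equidistribution_of_upper_bounds {γ : Type*} [DecidableEq γ] (G H : Finset γ) (hHG : H ⊆ G)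
    (h : ℕ) (h0 : 0 < h) (hH : H.card ≤ h) (x : ℝ) (hx : 1 < x) (d : γ → ℕ → ℝ)
    (hd : ∀ g a, 0 ≤ d g a)
    (h1 : ∀ g ∈ G, g ∉ H → ∃ C : ℝ, ∀ a, 0 < a → d g a ≤ C)
    (h2 : ∀ g ∈ G, ∃ (C : ℝ) (N : ℕ), ∀ a, N ≤ a → h * d g a ≤ (x ^ a) ^ 2 + C * x ^ a)
    (h3 : ∃ D : ℝ, ∀ a, 0 < a → (x ^ a) ^ 2 - D ≤ ∑ g ∈ G, d g a) :
    h = H.card ∧ ∃ (C : ℝ) (N : ℕ), ∀ a, N ≤ a → ∀ g ∈ G,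
      |d g a - if g ∈ H then (x ^ a) ^ 2 / h else 0| ≤ C * x ^ a := by
  obtain ⟨D, hD⟩ := h3
  choose! C₁ hC₁ using h1
  choose! C₂ N hC₂ using h2
  let C : ℝ := |D| + ∑ g ∈ G, (|C₁ g| + |C₂ g|)
  let N' : ℕ := 1 + ∑ g ∈ G, N g
  have hle : ∀ g ∈ G, |C₁ g| + |C₂ g| ≤ ∑ g ∈ G, (|C₁ g| + |C₂ g|) := fun g hg =>
    Finset.single_le_sum (f := fun g => |C₁ g| + |C₂ g|) (fun _ _ => by positivity) hg
  have hCD : D ≤ C := by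
    have : 0 ≤ ∑ g ∈ G, (|C₁ g| + |C₂ g|) := Finset.sum_nonneg fun _ _ => by positivity
    linarith [le_abs_self D]
  have hC0 : 0 ≤ C := by positivity
  have hC1 : ∀ g ∈ G, C₁ g ≤ C := fun g hg => by
    linarith [hle g hg, le_abs_self (C₁ g), abs_nonneg D, abs_nonneg (C₂ g)]
  have hC2 : ∀ g ∈ G, C₂ g ≤ C := fun g hg => by
    linarith [hle g hg, le_abs_self (C₂ g), abs_nonneg D, abs_nonneg (C₁ g)]
  have hN : ∀ g ∈ G, N g ≤ N' := fun g hg =>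
    (Finset.single_le_sum (fun _ _ => Nat.zero_le _) hg).trans (Nat.le_add_left _ _)
  have hX : ∀ a, 1 ≤ x ^ a := fun a => one_le_pow₀ hx.le
  have hh0 : (0 : ℝ) < h := by exact_mod_cast h0
  have hh1 : (1 : ℝ) ≤ h := by exact_mod_cast h0
  have b1 : ∀ a, N' ≤ a → ∀ g ∈ G \ H, d g a ≤ C * x ^ a := by
    intro a ha g hg
    rw [Finset.mem_sdiff] at hg
    have := hC₁ g hg.1 hg.2 a (by omega)
    nlinarith [hC1 g hg.1, hX a]
  have b2 : ∀ a, N' ≤ a → ∀ g ∈ G, h * d g a ≤ (x ^ a) ^ 2 + C * x ^ a := by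
    intro a ha g hg
    have := hC₂ g hg a ((hN g hg).trans ha)
    nlinarith [hC2 g hg, hX a]
  have b3 : ∀ a, N' ≤ a → h * (x ^ a) ^ 2 ≤
      h * ∑ g ∈ H, d g a + (h * C * (1 + (G \ H).card)) * x ^ a := by
    intro a ha
    have e1 := hD a (by omega)
    rw [← Finset.sum_sdiff hHG] at e1
    have e2 : ∑ g ∈ G \ H, d g a ≤ (G \ H).card * (C * x ^ a) := by
      rw [← nsmul_eq_mul]
      exact Finset.sum_le_card_nsmul _ _ _ (b1 a ha)
    have e3 : D ≤ C * x ^ a := by nlinarith [hX a]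
    have e4 : (x ^ a) ^ 2 ≤ ∑ g ∈ H, d g a + C * (1 + (G \ H).card) * x ^ a := by linarith
    nlinarith
  have b4 : ∀ a, N' ≤ a → ∀ T ⊆ G, h * ∑ g ∈ T, d g a ≤
      T.card * ((x ^ a) ^ 2 + C * x ^ a) := by
    intro a ha T hT
    rw [Finset.mul_sum, ← nsmul_eq_mul]
    exact Finset.sum_le_card_nsmul _ _ _ fun g hg => b2 a ha g (hT hg)
  let K : ℝ := h * C * (1 + (G \ H).card) + H.card * C
  have hK0 : 0 ≤ K := by positivity
  have hcard : h = H.card := by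
    by_contra hne
    have hlt : H.card + 1 ≤ h := by omega
    have hlt' : (H.card : ℝ) + 1 ≤ h := by exact_mod_cast hlt
    have hbd : ∀ a, N' ≤ a → x ^ a ≤ K := by
      intro a ha
      have e1 := b3 a ha
      have e2 := b4 a ha H hHG
      have e3 : (x ^ a) ^ 2 ≤ K * x ^ a := by
        have : (H.card + 1) * (x ^ a) ^ 2 ≤ h * (x ^ a) ^ 2 := by gcongr
        simp only [K]
        linarith
      have e4 : 0 < x ^ a := by linarith [hX a]
      rw [pow_two] at e3
      exact le_of_mul_le_mul_right e3 e4
    obtain ⟨n, hn⟩ := pow_unbounded_of_one_lt K hx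
    have e1 := hbd (max n N') (le_max_right _ _)
    have e2 : x ^ n ≤ x ^ max n N' := pow_le_pow_right₀ hx.le (le_max_left _ _)
    linarith
  refine ⟨hcard, K + C, N', fun a ha g hg => ?_⟩
  have hx0 : 0 < x ^ a := by linarith [hX a]
  split_ifs with hgH
  · have e1 := b3 a ha
    have e2 := b4 a ha (H.erase g) ((Finset.erase_subset _ _).trans hHG)
    have e3 := b2 a ha g hg
    rw [← Finset.add_sum_erase _ _ hgH, mul_add] at e1
    have e4 : ((H.erase g).card : ℝ) = h - 1 := by
      rw [Finset.card_erase_of_mem hgH, ← hcard, Nat.cast_sub h0, Nat.cast_one]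
    rw [e4] at e2
    have e5 : (x ^ a) ^ 2 - K * x ^ a ≤ h * d g a := by
      have : (H.card : ℝ) = h := by exact_mod_cast hcard.symm
      simp only [K, this]
      nlinarith [mul_nonneg hC0 hx0.le]
    have e6 : |h * d g a - (x ^ a) ^ 2| ≤ (K + C) * x ^ a := by
      rw [abs_le]
      constructor <;> nlinarith [mul_nonneg hC0 hx0.le, mul_nonneg hK0 hx0.le]
    have e7 : d g a - (x ^ a) ^ 2 / h = (h * d g a - (x ^ a) ^ 2) / h := by field_simp
    rw [e7, abs_div, abs_of_pos hh0, div_le_iff₀ hh0]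
    refine e6.trans (le_mul_of_one_le_right (by positivity) hh1)
  · rw [sub_zero, abs_of_nonneg (hd g a)]
    have := b1 a ha g (Finset.mem_sdiff.mpr ⟨hg, hgH⟩)
    nlinarith [mul_nonneg hK0 hx0.le]

variable {F ι : Type*} [Field F] [Fintype F] [Fintype ι] [DecidableEq ι] {α β : Matrix ι ι F}

open scoped Classical in
theorem exists_frobClass_equidistribution (hαβ : Commute α β) {P₀ : F[X]} (hirr : Irreducible P₀)
    (hP₀ : P₀.Monic) (hdet : (homEval α β P₀.natDegree P₀).det ≠ 0) (G : Finset (Matrix ι ι F))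
    (hG : ∀ g ∈ G, g.det ≠ 0) (hone : 1 ∈ G) (hmul : ∀ g ∈ G, ∀ g' ∈ G, g * g' ∈ G)
    (E : Finset F[X])
    (hE : ∀ P : F[X], Irreducible P → P.Monic → P ∉ E → homEval α β P.natDegree P ∈ G) :
    ∃ (s : ℕ) (H : Finset (Matrix ι ι F)), 0 < s ∧ H ⊆ G ∧ H.Nonempty ∧
      (∀ g ∈ H, ∀ g' ∈ H, g * g' ∈ H) ∧ ∃ (C : ℝ) (N : ℕ), ∀ a, N ≤ a → ∀ g ∈ G,
        |((∑ P ∈ frobClass α β g (2 * s * a), P.natDegree : ℕ) : ℝ) -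
          if g ∈ H then (((Fintype.card F : ℝ) ^ s) ^ a) ^ 2 / H.card else 0| ≤
        C * ((Fintype.card F : ℝ) ^ s) ^ a := by
  have : Fact (Irreducible P₀) := ⟨hirr⟩
  have hfin : Module.Finite F (AdjoinRoot P₀) := (AdjoinRoot.powerBasis hP₀.ne_zero).finite
  have : Finite (AdjoinRoot P₀) := Module.finite_of_finite F
  have := Fintype.ofFinite (AdjoinRoot P₀)
  have hx₀ : (frobProd α β (AdjoinRoot.root P₀) 1).det ≠ 0 := by
    have h1 : (frobProd α β (AdjoinRoot.root P₀) P₀.natDegree).det ≠ 0 := by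
      rw [← homEval_prod_X_sub_C hαβ, ← Irreducible.map_adjoinRoot_eq_prod hP₀, ← homEval_map]
      have := RingHom.map_det (algebraMap F (AdjoinRoot P₀)) (homEval α β P₀.natDegree P₀)
      rw [RingHom.mapMatrix_apply] at this
      rw [← this]
      exact (_root_.map_ne_zero _).mpr hdet
    obtain ⟨j, hj⟩ := Nat.exists_eq_succ_of_ne_zero hirr.natDegree_pos.ne'
    rw [hj, ← Nat.add_one, frobProd_add, Matrix.det_mul] at h1
    exact right_ne_zero_of_mul h1
  obtain ⟨s, h, S, hs, hh, hSmul, hScard, hS1, hS2⟩ := exists_frobClass_bounds hαβ _ hx₀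
  let H : Finset (Matrix ι ι F) := G.filter (· ∈ S)
  have hcF : 1 < Fintype.card F := Fintype.one_lt_card
  have hx : (1 : ℝ) < (Fintype.card F : ℝ) ^ s := one_lt_pow₀ (by exact_mod_cast hcF) hs.ne'
  have key : ∀ h1 h2 h3, _ := equidistribution_of_upper_bounds G H (Finset.filter_subset _ _) h hh
    (hScard H fun g hg => (Finset.mem_filter.mp hg).2) _ hx
    (fun g a => ((∑ P ∈ frobClass α β g (2 * s * a), P.natDegree : ℕ) : ℝ))
    fun g a => Nat.cast_nonneg _
  obtain ⟨e1, C, N, hCN⟩ := key (by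
    intro g hg hgH
    obtain ⟨C, hC⟩ := hS1 g (hG g hg) fun hgS => hgH (Finset.mem_filter.mpr ⟨hg, hgS⟩)
    exact ⟨C, fun a ha => by exact_mod_cast hC a ha⟩) (by
    intro g hg
    obtain ⟨C, N, hC⟩ := hS2 g (hG g hg)
    refine ⟨C, N, fun a ha => ?_⟩
    have := (Nat.cast_le (α := ℝ)).mpr (hC a ha)
    push_cast [pow_mul] at this ⊢
    exact this) (by
    refine ⟨((∑ P ∈ E, P.natDegree : ℕ) : ℝ), fun a ha => ?_⟩
    have hn : 2 * s * a ≠ 0 := by positivity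
    have hpow : ∀ g ∈ G, ∀ n, g ^ n ∈ G := by
      intro g hg n
      induction n with
      | zero => rwa [pow_zero]
      | succ n ih => rw [pow_succ]; exact hmul _ ih _ hg
    have h1 : ∑ P ∈ monicIrreducibles F (2 * s * a), P.natDegree ≤
        ∑ P ∈ E, P.natDegree + ∑ g ∈ G, ∑ P ∈ frobClass α β g (2 * s * a), P.natDegree := by
      rw [← Finset.sum_biUnion]
      · refine (Finset.sum_le_sum_of_subset (t := E ∪ G.biUnion fun g =>
          frobClass α β g (2 * s * a)) ?_).trans ?_
        · intro P hP
          have hP' := (mem_monicIrreducibles hn).mp hP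
          by_cases hPE : P ∈ E
          · exact Finset.mem_union_left _ hPE
          · refine Finset.mem_union_right _ (Finset.mem_biUnion.mpr
              ⟨_, hpow _ (hE P hP'.1 hP'.2.1 hPE) _, (mem_frobClass hn).mpr ⟨hP', rfl⟩⟩)
        · exact le_of_add_le_left (Finset.sum_union_inter (s₁ := E) (f := natDegree)).le
      · intro g _ g' _ hne
        rw [Function.onFun, Finset.disjoint_left]
        intro P hP hP'
        exact hne (((mem_frobClass hn).mp hP).2.symm.trans ((mem_frobClass hn).mp hP').2)
    rw [sum_natDegree_monicIrreducibles hn] at h1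
    have h2 : (((Fintype.card F : ℝ) ^ s) ^ a) ^ 2 = ((Fintype.card F ^ (2 * s * a) : ℕ) : ℝ) := by
      push_cast
      ring
    rw [h2, sub_le_iff_le_add]
    have h3 : ((Fintype.card F ^ (2 * s * a) : ℕ) : ℝ) ≤ _ := Nat.cast_le.mpr h1
    refine h3.trans (le_of_eq ?_)
    push_cast
    ring)
  refine ⟨s, H, hs, Finset.filter_subset _ _, ?_, ?_, C, N, ?_⟩
  · rw [← Finset.card_pos]
    omega
  · intro g hg g' hg'
    rw [Finset.mem_filter] at hg hg' ⊢
    exact ⟨hmul g hg.1 g' hg'.1, hSmul g hg.2 g' hg'.2⟩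
  · rw [e1] at hCN
    exact hCN

end Equidistribution

section Characters

variable {F : Type*} [Field F]

/-- `lam` is a character of `G_{l,Q}`, as a function on monic polynomials. -/
structure IsShortIntervalCharacter (l : ℕ) (Q : F[X]) (lam : F[X] → ℂ) : Prop where
  map_mul : ∀ f g : F[X], f.Monic → g.Monic → lam (f * g) = lam f * lam g
  map_not_coprime : ∀ f : F[X], f.Monic → ¬IsCoprime f Q → lam f = 0
  norm_map : ∀ f : F[X], f.Monic → IsCoprime f Q → ‖lam f‖ = 1
  map_congr : ∀ f g : F[X], f.Monic → g.Monic → Q ∣ f - g →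
    (∀ i : ℕ, 1 ≤ i → i ≤ l → firstCoeff f i = firstCoeff g i) → lam f = lam g

theorem coeff_reverse_eq_firstCoeff (f : F[X]) (i : ℕ) : f.reverse.coeff i = firstCoeff f i := by
  rw [coeff_reverse, firstCoeff]
  split_ifs with h
  · rw [revAt_le h]
  · rw [revAt_eq_self_of_lt (by omega), coeff_eq_zero_of_natDegree_lt (by omega)]

/-- The residues of `f` modulo `Q` and of the reversal of `f` modulo `X ^ (l + 1)`. -/
noncomputable def residuePair (l : ℕ) (Q f : F[X]) : AdjoinRoot Q × AdjoinRoot (X ^ (l + 1) : F[X]) :=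
  (AdjoinRoot.mk Q f, AdjoinRoot.mk (X ^ (l + 1)) f.reverse)

theorem residuePair_one (l : ℕ) (Q : F[X]) : residuePair l Q 1 = 1 := by
  have : (1 : F[X]).reverse = 1 := by rw [← C_1, reverse_C]
  rw [residuePair, this, _root_.map_one, _root_.map_one]
  rfl

theorem residuePair_mul (l : ℕ) (Q f g : F[X]) :
    residuePair l Q (f * g) = residuePair l Q f * residuePair l Q g := by
  rw [residuePair, reverse_mul_of_domain, _root_.map_mul, _root_.map_mul]
  rfl

theorem residuePair_pow (l : ℕ) (Q f : F[X]) (n : ℕ) :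
    residuePair l Q (f ^ n) = residuePair l Q f ^ n := by
  induction n with
  | zero => rw [pow_zero, pow_zero, residuePair_one]
  | succ n ih => rw [pow_succ f n, residuePair_mul, ih, ← pow_succ]

theorem homEval_algHom {R S T : Type*} [CommSemiring R] [Semiring S] [Semiring T] [Algebra R S]
    [Algebra R T] (φ : S →ₐ[R] T) (α β : S) (n : ℕ) (f : R[X]) :
    homEval (φ α) (φ β) n f = φ (homEval α β n f) := by
  simp only [homEval, map_sum, map_smul, _root_.map_mul, _root_.map_pow]

theorem homEval_one_right {R S : Type*} [CommSemiring R] [CommSemiring S] [Algebra R S] (α : S)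
    (f : R[X]) : homEval α 1 f.natDegree f = aeval α f := by
  simp only [homEval, one_pow, mul_one, aeval_eq_sum_range]

theorem homEval_one_left {R S : Type*} [CommSemiring R] [CommSemiring S] [Algebra R S] (β : S)
    (f : R[X]) : homEval 1 β f.natDegree f = aeval β f.reverse := by
  rw [aeval_eq_sum_range' (Nat.lt_succ_of_le (reverse_natDegree_le f)), homEval,
    ← Finset.sum_range_reflect]
  refine Finset.sum_congr rfl fun i hi => ?_
  have hi' : i ≤ f.natDegree := by rw [Finset.mem_range] at hi; omega
  rw [coeff_reverse, revAt_le hi', one_pow, one_mul]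
  congr 2; omega

theorem homEval_eq_residuePair (l : ℕ) (Q f : F[X]) :
    homEval ((AdjoinRoot.root Q, 1) : AdjoinRoot Q × AdjoinRoot (X ^ (l + 1) : F[X]))
      (1, AdjoinRoot.root _) f.natDegree f = residuePair l Q f := by
  refine Prod.ext ?_ ?_
  · have := homEval_algHom (AlgHom.fst F (AdjoinRoot Q) (AdjoinRoot (X ^ (l + 1) : F[X])))
      (AdjoinRoot.root Q, 1) (1, AdjoinRoot.root _) f.natDegree f
    refine this.symm.trans ?_
    simp only [AlgHom.fst_apply]
    rw [homEval_one_right, AdjoinRoot.aeval_eq]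
    rfl
  · have := homEval_algHom (AlgHom.snd F (AdjoinRoot Q) (AdjoinRoot (X ^ (l + 1) : F[X])))
      (AdjoinRoot.root Q, 1) (1, AdjoinRoot.root _) f.natDegree f
    refine this.symm.trans ?_
    simp only [AlgHom.snd_apply]
    rw [homEval_one_left, AdjoinRoot.aeval_eq]
    rfl

theorem isUnit_residuePair (l : ℕ) {Q f : F[X]} (hf : f.Monic) (hfQ : IsCoprime f Q) :
    IsUnit (residuePair l Q f) := by
  rw [Prod.isUnit_iff]
  constructor
  · obtain ⟨a, b, hab⟩ := hfQ
    refine IsUnit.of_mul_eq_one (AdjoinRoot.mk Q a) ?_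
    have := congrArg (AdjoinRoot.mk Q) hab
    rw [_root_.map_add, _root_.map_mul, _root_.map_mul, AdjoinRoot.mk_self, mul_zero, add_zero,
      _root_.map_one, mul_comm] at this
    exact this
  · have hX : IsCoprime (X : F[X]) f.reverse := by
      refine irreducible_X.coprime_iff_not_dvd.mpr fun h => ?_
      rw [X_dvd_iff, coeff_zero_reverse, hf.leadingCoeff] at h
      exact one_ne_zero h
    obtain ⟨a, b, hab⟩ := (hX.pow_left (m := l + 1)).symm
    refine IsUnit.of_mul_eq_one (AdjoinRoot.mk _ a) ?_
    have := congrArg (AdjoinRoot.mk (X ^ (l + 1) : F[X])) hab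
    rw [_root_.map_add, _root_.map_mul, _root_.map_mul, AdjoinRoot.mk_self, mul_zero, add_zero,
      _root_.map_one, mul_comm] at this
    exact this

theorem IsShortIntervalCharacter.eq_of_residuePair_eq {l : ℕ} {Q : F[X]} {lam : F[X] → ℂ}
    (h : IsShortIntervalCharacter l Q lam) {f g : F[X]} (hf : f.Monic) (hg : g.Monic)
    (hfg : residuePair l Q f = residuePair l Q g) : lam f = lam g := by
  rw [residuePair, residuePair, Prod.mk.injEq, AdjoinRoot.mk_eq_mk, AdjoinRoot.mk_eq_mk,
    X_pow_dvd_iff] at hfg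
  refine h.map_congr f g hf hg hfg.1 fun i _ hi => ?_
  have := hfg.2 i (by omega)
  rwa [coeff_sub, sub_eq_zero, coeff_reverse_eq_firstCoeff, coeff_reverse_eq_firstCoeff] at this

theorem IsShortIntervalCharacter.map_one {l : ℕ} {Q : F[X]} {lam : F[X] → ℂ}
    (h : IsShortIntervalCharacter l Q lam) : lam 1 = 1 := by
  have h1 := h.map_mul 1 1 monic_one monic_one
  have h2 := h.norm_map 1 monic_one isCoprime_one_left
  have h3 : lam 1 ≠ 0 := fun h0 => by rw [h0, norm_zero] at h2; exact zero_ne_one h2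
  rw [mul_one] at h1
  exact mul_left_cancel₀ h3 (by rw [← h1, mul_one])

theorem IsShortIntervalCharacter.map_pow {l : ℕ} {Q : F[X]} {lam : F[X] → ℂ}
    (h : IsShortIntervalCharacter l Q lam) {f : F[X]} (hf : f.Monic) (n : ℕ) :
    lam (f ^ n) = lam f ^ n := by
  induction n with
  | zero => rw [pow_zero, pow_zero, h.map_one]
  | succ n ih => rw [pow_succ, h.map_mul _ _ (hf.pow n) hf, ih, pow_succ]

theorem IsShortIntervalCharacter.norm_le_one {l : ℕ} {Q : F[X]} {lam : F[X] → ℂ}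
    (h : IsShortIntervalCharacter l Q lam) {f : F[X]} (hf : f.Monic) : ‖lam f‖ ≤ 1 := by
  by_cases hQ : IsCoprime f Q
  · exact (h.norm_map f hf hQ).le
  · rw [h.map_not_coprime f hf hQ, norm_zero]
    exact zero_le_one

theorem exists_monic_irreducible_isCoprime {Q : F[X]} (hQ : Q ≠ 0) :
    ∃ P : F[X], Irreducible P ∧ P.Monic ∧ IsCoprime P Q := by
  have h1 : ¬IsUnit (X * Q + 1) := by
    intro hu
    have h2 := natDegree_eq_zero_of_isUnit hu
    have h3 : (X * Q + 1).natDegree = Q.natDegree + 1 := by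
      rw [← C_1, natDegree_add_C, natDegree_X_mul hQ]
    omega
  obtain ⟨P, hmon, hirr, hdvd⟩ := exists_monic_irreducible_factor _ h1
  refine ⟨P, hirr, hmon, hirr.coprime_iff_not_dvd.mpr fun h => hirr.not_isUnit ?_⟩
  exact isUnit_of_dvd_one ((dvd_add_right (h.mul_left X)).mp hdvd)

variable [Fintype F]

/-- The coefficients of `u * (log L)'(u)`, where `L` is the `L`-function of `lam`. -/
noncomputable def charPowerSum (lam : F[X] → ℂ) (n : ℕ) : ℂ :=
  ∑ P ∈ monicIrreducibles F n, (P.natDegree : ℂ) * lam P ^ (n / P.natDegree)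

theorem average_eq_zero_or_one {M : Type*} [Monoid M] {H : Finset M} (hne : H.Nonempty)
    (hunit : ∀ g ∈ H, IsUnit g) (hmul : ∀ g ∈ H, ∀ g' ∈ H, g * g' ∈ H) (χ : M → ℂ)
    (hχ : ∀ g ∈ H, ∀ g' ∈ H, χ (g * g') = χ g * χ g') :
    (∑ g ∈ H, χ g) / H.card = 0 ∨ (∑ g ∈ H, χ g) / H.card = 1 := by
  classical
  have hcard : (H.card : ℂ) ≠ 0 := by exact_mod_cast hne.card_pos.ne'
  by_cases h : ∀ g ∈ H, χ g = 1
  · right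
    rw [Finset.sum_congr rfl h, Finset.sum_const, nsmul_eq_mul, mul_one, div_self hcard]
  · left
    push Not at h
    obtain ⟨g₀, hg₀, hne⟩ := h
    have hinj : Set.InjOn (g₀ * ·) (H : Set M) := fun a _ b _ hab =>
      (hunit g₀ hg₀).mul_left_cancel hab
    have himg : H.image (g₀ * ·) = H := Finset.eq_of_subset_of_card_le
      (Finset.image_subset_iff.mpr fun g hg => hmul g₀ hg₀ g hg)
      (Finset.card_image_of_injOn hinj).ge
    have h1 : ∑ g ∈ H, χ g = χ g₀ * ∑ g ∈ H, χ g := by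
      conv_lhs => rw [← himg, Finset.sum_image hinj]
      rw [Finset.mul_sum]
      exact Finset.sum_congr rfl fun g hg => hχ g₀ hg₀ g hg
    have h2 : (χ g₀ - 1) * ∑ g ∈ H, χ g = 0 := by rw [sub_mul, ← h1, one_mul, sub_self]
    rw [(mul_eq_zero.mp h2).resolve_left (sub_ne_zero.mpr hne), zero_div]

theorem IsShortIntervalCharacter.exists_charPowerSum_bound {l : ℕ} {Q : F[X]} {lam : F[X] → ℂ}
    (h : IsShortIntervalCharacter l Q lam) (hQ : Q ≠ 0) :
    ∃ s, 0 < s ∧ ∃ c : ℂ, (c = 0 ∨ c = 1) ∧ ∃ (C : ℝ) (N : ℕ), ∀ a, N ≤ a →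
      ‖charPowerSum lam (2 * s * a) - c * (Fintype.card F : ℂ) ^ (2 * s * a)‖ ≤
        C * ((Fintype.card F : ℝ) ^ s) ^ a := by
  classical
  have hfin₁ : Module.Finite F (AdjoinRoot Q) := (AdjoinRoot.powerBasis hQ).finite
  have hfin₂ : Module.Finite F (AdjoinRoot (X ^ (l + 1) : F[X])) :=
    (AdjoinRoot.powerBasis (pow_ne_zero _ X_ne_zero)).finite
  let R := AdjoinRoot Q × AdjoinRoot (X ^ (l + 1) : F[X])
  let b := Module.finBasis F R
  let φ := Algebra.leftMulMatrix b
  have hφ : Function.Injective φ := Algebra.leftMulMatrix_injective b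
  let α := φ (AdjoinRoot.root Q, 1)
  let β := φ (1, AdjoinRoot.root _)
  let ρ : F[X] → Matrix _ _ F := fun f => φ (residuePair l Q f)
  have hρ : ∀ f, homEval α β f.natDegree f = ρ f := fun f => by
    rw [homEval_algHom, homEval_eq_residuePair]
  have hρmul : ∀ f g, ρ (f * g) = ρ f * ρ g := fun f g => by
    simp only [ρ, residuePair_mul, _root_.map_mul]
  have hρpow : ∀ f n, ρ (f ^ n) = ρ f ^ n := fun f n => by
    simp only [ρ, residuePair_pow, _root_.map_pow]
  have hρeq : ∀ f g : F[X], f.Monic → g.Monic → ρ f = ρ g → lam f = lam g :=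
    fun f g hf hg hfg => h.eq_of_residuePair_eq hf hg (hφ hfg)
  have hρunit : ∀ f : F[X], f.Monic → IsCoprime f Q → IsUnit (ρ f) :=
    fun f hf hfQ => (isUnit_residuePair l hf hfQ).map φ
  have hαβ : Commute α β := (Commute.all _ _).map φ
  let G : Finset (Matrix (Fin (Module.finrank F R)) (Fin (Module.finrank F R)) F) :=
    (Set.toFinite (ρ '' {f : F[X] | f.Monic ∧ IsCoprime f Q})).toFinset
  have hmemG : ∀ g, g ∈ G ↔ ∃ f : F[X], (f.Monic ∧ IsCoprime f Q) ∧ ρ f = g := fun g =>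
    Set.Finite.mem_toFinset _
  have hGunit : ∀ g ∈ G, IsUnit g := by
    intro g hg
    obtain ⟨f, hf, rfl⟩ := (hmemG g).mp hg
    exact hρunit f hf.1 hf.2
  obtain ⟨P₀, hirr, hP₀, hcop⟩ := exists_monic_irreducible_isCoprime hQ
  have hGmul : ∀ g ∈ G, ∀ g' ∈ G, g * g' ∈ G := by
    intro g hg g' hg'
    obtain ⟨f, hf, rfl⟩ := (hmemG g).mp hg
    obtain ⟨f', hf', rfl⟩ := (hmemG g').mp hg'
    exact (hmemG _).mpr ⟨f * f', ⟨hf.1.mul hf'.1, hf.2.mul_left hf'.2⟩, hρmul f f'⟩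
  obtain ⟨s, H, hs, hHG, hne, hHmul, C, N, hCN⟩ := exists_frobClass_equidistribution hαβ hirr hP₀
    (by rw [hρ]; exact ((Matrix.isUnit_iff_isUnit_det _).mp (hρunit _ hP₀ hcop)).ne_zero) G
    (fun g hg => ((Matrix.isUnit_iff_isUnit_det _).mp (hGunit g hg)).ne_zero)
    ((hmemG 1).mpr ⟨1, ⟨monic_one, isCoprime_one_left⟩, by
      simp only [ρ, residuePair_one, _root_.map_one]⟩) hGmul
    (UniqueFactorizationMonoid.normalizedFactors Q).toFinset (by
      intro P hP hmon hPE
      rw [hρ]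
      refine (hmemG _).mpr ⟨P, ⟨hmon, hP.coprime_iff_not_dvd.mpr fun hdvd => hPE ?_⟩, rfl⟩
      rw [Multiset.mem_toFinset]
      exact (Polynomial.mem_normalizedFactors_iff hQ).mpr ⟨hP, hmon, hdvd⟩)
  have hex : ∀ g, ∃ z : ℂ, g ∈ G → ∃ f : F[X], (f.Monic ∧ IsCoprime f Q) ∧ ρ f = g ∧ lam f = z := by
    intro g
    by_cases hg : g ∈ G
    · obtain ⟨f, hf, hfg⟩ := (hmemG g).mp hg
      exact ⟨lam f, fun _ => ⟨f, hf, hfg, rfl⟩⟩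
    · exact ⟨0, fun hg' => absurd hg' hg⟩
  choose χ hχ using hex
  have hχρ : ∀ f : F[X], f.Monic → ρ f ∈ G → χ (ρ f) = lam f := by
    intro f hf hfG
    obtain ⟨f', hf', h1, h2⟩ := hχ _ hfG
    rw [← h2]
    exact hρeq _ _ hf'.1 hf h1
  have hχmul : ∀ g ∈ H, ∀ g' ∈ H, χ (g * g') = χ g * χ g' := by
    intro g hg g' hg'
    obtain ⟨f, hf, rfl, h2⟩ := hχ _ (hHG hg)
    obtain ⟨f', hf', rfl, h2'⟩ := hχ _ (hHG hg')
    rw [← h2, ← h2', ← h.map_mul f f' hf.1 hf'.1, ← hρmul]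
    exact hχρ _ (hf.1.mul hf'.1) (by rw [hρmul]; exact hGmul _ (hHG hg) _ (hHG hg'))
  have hχnorm : ∀ g ∈ G, ‖χ g‖ ≤ 1 := by
    intro g hg
    obtain ⟨f, hf, _, h2⟩ := hχ g hg
    rw [← h2]
    exact h.norm_le_one hf.1
  refine ⟨s, hs, (∑ g ∈ H, χ g) / H.card,
    average_eq_zero_or_one hne (fun g hg => hGunit g (hHG hg)) hHmul χ hχmul,
    G.card * C, N + 1, fun a ha => ?_⟩
  have hn : 2 * s * a ≠ 0 := by
    have : 0 < a := by omega
    positivity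
  have hS : charPowerSum lam (2 * s * a) =
      ∑ g ∈ G, χ g * ((∑ P ∈ frobClass α β g (2 * s * a), P.natDegree : ℕ) : ℂ) := by
    have h1 : ∀ g ∈ G, χ g * ((∑ P ∈ frobClass α β g (2 * s * a), P.natDegree : ℕ) : ℂ) =
        ∑ P ∈ frobClass α β g (2 * s * a),
          (P.natDegree : ℂ) * lam P ^ (2 * s * a / P.natDegree) := by
      intro g hg
      rw [Nat.cast_sum, Finset.mul_sum]
      refine Finset.sum_congr rfl fun P hP => ?_
      have hP' := (mem_frobClass hn).mp hP
      rw [hρ, ← hρpow] at hP'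
      rw [← h.map_pow hP'.1.2.1, ← hχρ _ (hP'.1.2.1.pow _) (by rw [hP'.2]; exact hg), hP'.2,
        mul_comm]
    rw [Finset.sum_congr rfl h1, ← Finset.sum_biUnion, charPowerSum]
    · symm
      refine Finset.sum_subset ?_ ?_
      · intro P hP
        obtain ⟨g, _, hP⟩ := Finset.mem_biUnion.mp hP
        exact (mem_monicIrreducibles hn).mpr ((mem_frobClass hn).mp hP).1
      · intro P hP hP'
        have hP1 := (mem_monicIrreducibles hn).mp hP
        rw [h.map_not_coprime P hP1.2.1, zero_pow, mul_zero]
        · have := Nat.div_mul_cancel hP1.2.2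
          intro h0
          rw [h0, zero_mul] at this
          exact hn this.symm
        · intro hPQ
          refine hP' (Finset.mem_biUnion.mpr ⟨ρ (P ^ (2 * s * a / P.natDegree)), ?_, ?_⟩)
          · exact (hmemG _).mpr ⟨_, ⟨hP1.2.1.pow _, hPQ.pow_left⟩, rfl⟩
          · rw [mem_frobClass hn, hρ, hρpow]
            exact ⟨hP1, rfl⟩
    · intro g _ g' _ hne
      rw [Function.onFun, Finset.disjoint_left]
      intro P hP hP'
      exact hne (((mem_frobClass hn).mp hP).2.symm.trans ((mem_frobClass hn).mp hP').2)
  have hc : (∑ g ∈ H, χ g) / H.card * (Fintype.card F : ℂ) ^ (2 * s * a) =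
      ∑ g ∈ G, χ g * ((if g ∈ H then (((Fintype.card F : ℝ) ^ s) ^ a) ^ 2 / H.card else 0 : ℝ) : ℂ)
      := by
    rw [← Finset.sum_subset hHG fun g _ hg => by rw [if_neg hg, Complex.ofReal_zero, mul_zero],
      div_mul_eq_mul_div, Finset.sum_mul, Finset.sum_div]
    refine Finset.sum_congr rfl fun g hg => ?_
    rw [if_pos hg]
    push_cast
    ring
  rw [hS, hc, ← Finset.sum_sub_distrib]
  refine (norm_sum_le _ _).trans ?_
  rw [mul_assoc (G.card : ℝ), ← nsmul_eq_mul]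
  refine Finset.sum_le_card_nsmul _ _ _ fun g hg => ?_
  rw [← mul_sub, norm_mul]
  refine (mul_le_of_le_one_left (norm_nonneg _) (hχnorm g hg)).trans ?_
  refine le_trans (le_of_eq ?_) (hCN a (by omega) g hg)
  rw [← Real.norm_eq_abs, ← Complex.norm_real]
  push_cast
  rfl

end Characters

section MonicSums

variable {F : Type*} [Field F]

theorem coeff_monicPoly_of_lt {n : ℕ} (x : Fin n → F) (i : Fin n) :
    (monicPoly F n x).coeff i = x i := by
  rw [monicPoly, coeff_add, coeff_X_pow, if_neg i.2.ne, zero_add, finsetSum_coeff,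
    Finset.sum_eq_single i]
  · rw [coeff_C_mul_X_pow, if_pos rfl]
  · intro j _ hj
    rw [coeff_C_mul_X_pow, if_neg fun h => hj (Fin.ext h.symm)]
  · exact fun h => absurd (Finset.mem_univ i) h

theorem monicPoly_injective (n : ℕ) : Function.Injective (monicPoly F n) := fun x y h =>
  funext fun i => by rw [← coeff_monicPoly_of_lt x, h, coeff_monicPoly_of_lt]

theorem degree_sum_C_mul_X_pow_lt {n : ℕ} (x : Fin n → F) :
    (∑ i : Fin n, C (x i) * X ^ (i : ℕ)).degree < (n : WithBot ℕ) := by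
  refine (degree_sum_le _ _).trans_lt ((Finset.sup_lt_iff (WithBot.bot_lt_coe n)).mpr fun i _ => ?_)
  exact (degree_C_mul_X_pow_le _ _).trans_lt (Nat.cast_lt.mpr i.2)

theorem monic_monicPoly {n : ℕ} (x : Fin n → F) : (monicPoly F n x).Monic :=
  monic_X_pow_add (degree_sum_C_mul_X_pow_lt x)

theorem natDegree_monicPoly {n : ℕ} (x : Fin n → F) : (monicPoly F n x).natDegree = n := by
  refine natDegree_eq_of_degree_eq_some ?_
  rw [monicPoly, degree_add_eq_left_of_degree_lt, degree_X_pow]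
  rw [degree_X_pow]
  exact degree_sum_C_mul_X_pow_lt x

theorem monicPoly_coeff {f : F[X]} (hf : f.Monic) :
    monicPoly F f.natDegree (fun i => f.coeff i) = f := by
  conv_rhs => rw [hf.as_sum]
  rw [monicPoly, Fin.sum_univ_eq_sum_range fun i => C (f.coeff i) * X ^ i]

theorem polyMu_mul_of_not_dvd {a P : F[X]} (ha : Squarefree a) (hP : Irreducible P) (hPa : ¬P ∣ a) :
    polyMu (a * P) = -polyMu a := by
  classical
  have h1 : Squarefree (a * P) :=
    squarefree_mul_iff.mpr ⟨((hP.coprime_iff_not_dvd.mpr hPa).symm).isRelPrime, ha, hP.squarefree⟩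
  rw [polyMu, polyMu, if_pos h1, if_pos ha,
    UniqueFactorizationMonoid.normalizedFactors_mul ha.ne_zero hP.ne_zero,
    UniqueFactorizationMonoid.normalizedFactors_irreducible hP, Multiset.card_add,
    Multiset.card_singleton, pow_succ, mul_neg_one]

variable [Fintype F]

open scoped Classical in
/-- The monic polynomials of degree `n`. -/
noncomputable def monicsOfDegree (F : Type*) [Field F] [Fintype F] (n : ℕ) : Finset F[X] :=
  Finset.univ.image (monicPoly F n)

theorem mem_monicsOfDegree {n : ℕ} {f : F[X]} :
    f ∈ monicsOfDegree F n ↔ f.Monic ∧ f.natDegree = n := by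
  classical
  rw [monicsOfDegree, Finset.mem_image]
  constructor
  · rintro ⟨x, _, rfl⟩
    exact ⟨monic_monicPoly x, natDegree_monicPoly x⟩
  · rintro ⟨h, rfl⟩
    exact ⟨_, Finset.mem_univ _, monicPoly_coeff h⟩

theorem sum_monicPoly (n : ℕ) (w : F[X] → ℂ) :
    ∑ x : Fin n → F, w (monicPoly F n x) = ∑ f ∈ monicsOfDegree F n, w f := by
  classical
  rw [monicsOfDegree, Finset.sum_image fun _ _ _ _ h => monicPoly_injective n h]

theorem monicsOfDegree_zero : monicsOfDegree F 0 = {1} := by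
  ext f
  rw [mem_monicsOfDegree, Finset.mem_singleton]
  constructor
  · rintro ⟨h, h0⟩
    exact h.natDegree_eq_zero.mp h0
  · rintro rfl
    exact ⟨monic_one, natDegree_one⟩

/-- The coefficients of the `L`-function of `lam`. -/
noncomputable def charSum (lam : F[X] → ℂ) (n : ℕ) : ℂ := ∑ f ∈ monicsOfDegree F n, lam f

/-- The coefficients of the inverse of the `L`-function of `lam`. -/
noncomputable def moebiusCharSum (lam : F[X] → ℂ) (n : ℕ) : ℂ :=
  ∑ f ∈ monicsOfDegree F n, (polyMu f : ℂ) * lam f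

variable {l : ℕ} {Q : F[X]} {lam : F[X] → ℂ}

open scoped Classical in
theorem IsShortIntervalCharacter.sum_filter_dvd (h : IsShortIntervalCharacter l Q lam) {a : F[X]}
    (ha : a.Monic) {n : ℕ} (hn : a.natDegree ≤ n) :
    ∑ f ∈ monicsOfDegree F n with a ∣ f, lam f = lam a * charSum lam (n - a.natDegree) := by
  rw [charSum, Finset.mul_sum]
  symm
  refine Finset.sum_bij (fun g _ => a * g) ?_ ?_ ?_ ?_
  · intro g hg
    rw [mem_monicsOfDegree] at hg
    rw [Finset.mem_filter, mem_monicsOfDegree, ha.natDegree_mul hg.1]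
    exact ⟨⟨ha.mul hg.1, by omega⟩, dvd_mul_right _ _⟩
  · intro g _ g' _ hgg
    exact mul_left_cancel₀ ha.ne_zero hgg
  · intro f hf
    rw [Finset.mem_filter, mem_monicsOfDegree] at hf
    obtain ⟨⟨hf1, hf2⟩, g, rfl⟩ := hf
    have hg := ha.of_mul_monic_left hf1
    rw [ha.natDegree_mul hg] at hf2
    exact ⟨g, mem_monicsOfDegree.mpr ⟨hg, by omega⟩, rfl⟩
  · intro g hg
    rw [mem_monicsOfDegree] at hg
    rw [h.map_mul a g ha hg.1]

open scoped Classical in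
theorem sum_polyMu_dvd {n : ℕ} {f : F[X]} (hf : f ∈ monicsOfDegree F n) (hn : n ≠ 0) :
    ∑ i ∈ Finset.range (n + 1), ∑ a ∈ monicsOfDegree F i with a ∣ f, polyMu a = 0 := by
  rw [mem_monicsOfDegree] at hf
  have hu : ¬IsUnit f := fun hu => hn (by rw [← hf.2, natDegree_eq_zero_of_isUnit hu])
  obtain ⟨P, hmon, hirr, hdvd⟩ := exists_monic_irreducible_factor _ hu
  rw [← Finset.sum_biUnion]
  swap
  · intro i _ j _ hij
    rw [Function.onFun, Finset.disjoint_left]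
    intro a ha ha'
    rw [Finset.mem_filter, mem_monicsOfDegree] at ha ha'
    exact hij (ha.1.2.symm.trans ha'.1.2)
  have hmem : ∀ a : F[X], a ∈ ((Finset.range (n + 1)).biUnion fun i =>
      (monicsOfDegree F i).filter (· ∣ f)) ↔ a.Monic ∧ a ∣ f := by
    intro a
    simp only [Finset.mem_biUnion, Finset.mem_filter, mem_monicsOfDegree, Finset.mem_range]
    constructor
    · rintro ⟨i, _, h⟩
      exact ⟨h.1.1, h.2⟩
    · rintro ⟨h1, h2⟩
      have := natDegree_le_of_dvd h2 hf.1.ne_zero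
      exact ⟨a.natDegree, by omega, ⟨h1, rfl⟩, h2⟩
  rw [← Finset.sum_filter_of_ne (p := Squarefree) fun a _ h => by
    by_contra hsq
    rw [polyMu, if_neg hsq] at h
    exact h rfl]
  rw [← Finset.sum_filter_add_sum_filter_not _ (P ∣ ·)]
  rw [add_comm, ← eq_neg_iff_add_eq_zero, ← Finset.sum_neg_distrib]
  refine Finset.sum_bij (fun a _ => a * P) ?_ ?_ ?_ ?_
  · intro a ha
    rw [Finset.mem_filter, Finset.mem_filter, hmem] at ha ⊢
    obtain ⟨⟨⟨h1, h2⟩, h3⟩, h4⟩ := ha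
    have hc := (hirr.coprime_iff_not_dvd.mpr h4).symm
    exact ⟨⟨⟨h1.mul hmon, hc.mul_dvd h2 hdvd⟩,
      squarefree_mul_iff.mpr ⟨hc.isRelPrime, h3, hirr.squarefree⟩⟩, dvd_mul_left _ _⟩
  · intro a _ b _ hab
    exact mul_right_cancel₀ hmon.ne_zero hab
  · intro b hb
    rw [Finset.mem_filter, Finset.mem_filter, hmem] at hb
    obtain ⟨⟨⟨h1, h2⟩, h3⟩, a, rfl⟩ := hb
    refine ⟨a, ?_, mul_comm _ _⟩
    rw [Finset.mem_filter, Finset.mem_filter, hmem]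
    refine ⟨⟨⟨hmon.of_mul_monic_left h1, (dvd_mul_left _ _).trans h2⟩,
      (squarefree_mul_iff.mp h3).2.2⟩, fun hPa => ?_⟩
    exact hirr.not_isUnit ((squarefree_mul_iff.mp h3).1 dvd_rfl hPa)
  · intro a ha
    rw [Finset.mem_filter, Finset.mem_filter] at ha
    rw [polyMu_mul_of_not_dvd ha.1.2 hirr ha.2, neg_neg]

theorem IsShortIntervalCharacter.sum_moebiusCharSum_mul (h : IsShortIntervalCharacter l Q lam)
    {n : ℕ} (hn : n ≠ 0) :
    ∑ i ∈ Finset.range (n + 1), moebiusCharSum lam i * charSum lam (n - i) = 0 := by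
  classical
  have h1 : ∀ i ∈ Finset.range (n + 1), moebiusCharSum lam i * charSum lam (n - i) =
      ∑ f ∈ monicsOfDegree F n, ∑ a ∈ monicsOfDegree F i with a ∣ f, lam f * (polyMu a : ℂ) := by
    intro i hi
    have hi' : i ≤ n := by rw [Finset.mem_range] at hi; omega
    have h2 : ∀ a ∈ monicsOfDegree F i, (polyMu a : ℂ) * lam a * charSum lam (n - i) =
        ∑ f ∈ monicsOfDegree F n, if a ∣ f then lam f * (polyMu a : ℂ) else 0 := by
      intro a ha
      rw [mem_monicsOfDegree] at ha
      have := h.sum_filter_dvd ha.1 (ha.2.trans_le hi')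
      rw [ha.2] at this
      rw [← Finset.sum_filter, ← Finset.sum_mul, this]
      ring
    rw [moebiusCharSum, Finset.sum_mul, Finset.sum_congr rfl h2, Finset.sum_comm]
    exact Finset.sum_congr rfl fun f _ => (Finset.sum_filter _ _).symm
  rw [Finset.sum_congr rfl h1, Finset.sum_comm]
  refine Finset.sum_eq_zero fun f hf => ?_
  have h3 : ∀ i ∈ Finset.range (n + 1),
      ∑ a ∈ monicsOfDegree F i with a ∣ f, lam f * (polyMu a : ℂ) =
      lam f * ((∑ a ∈ monicsOfDegree F i with a ∣ f, polyMu a : ℤ) : ℂ) := by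
    intro i _
    rw [Int.cast_sum, Finset.mul_sum]
  rw [Finset.sum_congr rfl h3, ← Finset.mul_sum, ← Int.cast_sum, sum_polyMu_dvd hf hn, Int.cast_zero,
    mul_zero]

theorem IsShortIntervalCharacter.charSum_zero (h : IsShortIntervalCharacter l Q lam) :
    charSum lam 0 = 1 := by
  rw [charSum, monicsOfDegree_zero, Finset.sum_singleton, h.map_one]

theorem IsShortIntervalCharacter.moebiusCharSum_zero (h : IsShortIntervalCharacter l Q lam) :
    moebiusCharSum lam 0 = 1 := by
  classical
  rw [moebiusCharSum, monicsOfDegree_zero, Finset.sum_singleton, h.map_one, polyMu,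
    if_pos squarefree_one, UniqueFactorizationMonoid.normalizedFactors_one, Multiset.card_zero,
    pow_zero, Int.cast_one, mul_one]

end MonicSums

section LogarithmicDerivative

variable {F : Type*} [Field F]

open scoped Classical in
theorem card_filter_pow_div_dvd {f P : F[X]} (hf : f.Monic) (hmon : P.Monic) (hirr : Irreducible P) :
    (((Finset.Icc 1 f.natDegree).filter fun j => P.natDegree ∣ j ∧ P ^ (j / P.natDegree) ∣ f).card) =
      (UniqueFactorizationMonoid.normalizedFactors f).count P := by
  have hd := hirr.natDegree_pos
  have h1 : ∀ a, P ^ a ∣ f ↔ a ≤ (UniqueFactorizationMonoid.normalizedFactors f).count P := by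
    intro a
    rw [pow_dvd_iff_le_emultiplicity,
      UniqueFactorizationMonoid.emultiplicity_eq_count_normalizedFactors hirr hf.ne_zero,
      hmon.normalize_eq_self, Nat.cast_le]
  have h2 : ((Finset.Icc 1 f.natDegree).filter fun j => P.natDegree ∣ j ∧ P ^ (j / P.natDegree) ∣ f) =
      (Finset.Icc 1 ((UniqueFactorizationMonoid.normalizedFactors f).count P)).image
        (P.natDegree * ·) := by
    ext j
    rw [Finset.mem_filter, Finset.mem_image, Finset.mem_Icc]
    constructor
    · rintro ⟨⟨hj, _⟩, ⟨i, rfl⟩, h⟩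
      rw [Nat.mul_div_cancel_left _ hd, h1] at h
      exact ⟨i, Finset.mem_Icc.mpr ⟨pos_of_mul_pos_right hj (Nat.zero_le _), h⟩, rfl⟩
    · rintro ⟨i, hi, rfl⟩
      rw [Finset.mem_Icc] at hi
      have h3 := (h1 i).mpr hi.2
      have h4 := natDegree_le_of_dvd h3 hf.ne_zero
      rw [natDegree_pow, mul_comm] at h4
      rw [Nat.mul_div_cancel_left _ hd]
      exact ⟨⟨Nat.mul_pos hd hi.1, h4⟩, dvd_mul_right _ _, h3⟩
  rw [h2, Finset.card_image_of_injective _ fun a b hab => Nat.eq_of_mul_eq_mul_left hd hab, Nat.card_Icc,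
    Nat.add_sub_cancel]

variable [Fintype F] {l : ℕ} {Q : F[X]} {lam : F[X] → ℂ}

theorem IsShortIntervalCharacter.norm_charPowerSum_le (h : IsShortIntervalCharacter l Q lam)
    {n : ℕ} (hn : n ≠ 0) : ‖charPowerSum lam n‖ ≤ (Fintype.card F : ℝ) ^ n := by
  have h1 : (Fintype.card F : ℝ) ^ n = ∑ P ∈ monicIrreducibles F n, (P.natDegree : ℝ) := by
    rw [← Nat.cast_pow, ← sum_natDegree_monicIrreducibles hn, Nat.cast_sum]
  rw [h1]
  refine norm_sum_le_of_le _ fun P hP => ?_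
  have hP' := (mem_monicIrreducibles hn).mp hP
  rw [norm_mul, Complex.norm_natCast, norm_pow]
  exact mul_le_of_le_one_right (Nat.cast_nonneg _)
    (pow_le_one₀ (norm_nonneg _) (h.norm_le_one hP'.2.1))

open scoped Classical in
theorem sum_natDegree_pow_dvd {n : ℕ} {f : F[X]} (hf : f ∈ monicsOfDegree F n) :
    ∑ j ∈ Finset.Icc 1 n, ∑ P ∈ monicIrreducibles F j with P ^ (j / P.natDegree) ∣ f, P.natDegree =
      n := by
  obtain ⟨hmon, rfl⟩ := mem_monicsOfDegree.mp hf
  have h1 : ∀ P, P ∈ (UniqueFactorizationMonoid.normalizedFactors f).toFinset ↔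
      Irreducible P ∧ P.Monic ∧ P ∣ f := fun P => by
    rw [Multiset.mem_toFinset]
    exact Polynomial.mem_normalizedFactors_iff hmon.ne_zero
  rw [Finset.sum_comm' (t' := (UniqueFactorizationMonoid.normalizedFactors f).toFinset)
    (s' := fun P => (Finset.Icc 1 f.natDegree).filter fun j =>
      P.natDegree ∣ j ∧ P ^ (j / P.natDegree) ∣ f)]
  · have h2 := congrArg natDegree (leadingCoeff_mul_prod_normalizedFactors f)
    rw [hmon.leadingCoeff, C_1, one_mul, natDegree_multiset_prod_of_monic,
      Finset.sum_multiset_map_count] at h2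
    · refine Eq.trans (Finset.sum_congr rfl fun P hP => ?_) h2
      rw [h1] at hP
      rw [Finset.sum_const, card_filter_pow_div_dvd hmon hP.2.1 hP.1]
    · intro P hP
      exact ((h1 P).mp (Multiset.mem_toFinset.mpr hP)).2.1
  · intro j P
    rw [Finset.mem_filter, Finset.mem_filter, h1]
    constructor
    · rintro ⟨hj, hP, hdvd⟩
      have hj' : j ≠ 0 := by rw [Finset.mem_Icc] at hj; omega
      rw [mem_monicIrreducibles hj'] at hP
      refine ⟨⟨hj, hP.2.2, hdvd⟩, hP.1, hP.2.1, (dvd_pow_self P ?_).trans hdvd⟩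
      exact (Nat.div_pos (Nat.le_of_dvd (Nat.pos_of_ne_zero hj') hP.2.2) hP.1.natDegree_pos).ne'
    · rintro ⟨⟨hj, hd, hdvd⟩, hirr, hP, _⟩
      have hj' : j ≠ 0 := by rw [Finset.mem_Icc] at hj; omega
      exact ⟨hj, (mem_monicIrreducibles hj').mpr ⟨hirr, hP, hd⟩, hdvd⟩

theorem IsShortIntervalCharacter.sum_charPowerSum_mul (h : IsShortIntervalCharacter l Q lam)
    (n : ℕ) : ∑ j ∈ Finset.Icc 1 n, charPowerSum lam j * charSum lam (n - j) =
      n * charSum lam n := by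
  classical
  have h1 : ∀ j ∈ Finset.Icc 1 n, charPowerSum lam j * charSum lam (n - j) =
      ∑ f ∈ monicsOfDegree F n, lam f * ((∑ P ∈ monicIrreducibles F j with
        P ^ (j / P.natDegree) ∣ f, P.natDegree : ℕ) : ℂ) := by
    intro j hj
    rw [Finset.mem_Icc] at hj
    have h2 : ∀ P ∈ monicIrreducibles F j,
        (P.natDegree : ℂ) * lam P ^ (j / P.natDegree) * charSum lam (n - j) =
        ∑ f ∈ monicsOfDegree F n,
          if P ^ (j / P.natDegree) ∣ f then lam f * (P.natDegree : ℂ) else 0 := by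
      intro P hP
      rw [mem_monicIrreducibles (by omega)] at hP
      have h3 : (P ^ (j / P.natDegree)).natDegree = j := by
        rw [natDegree_pow, Nat.div_mul_cancel hP.2.2]
      have := h.sum_filter_dvd (hP.2.1.pow (j / P.natDegree)) (h3.trans_le hj.2)
      rw [h3] at this
      rw [← Finset.sum_filter, ← Finset.sum_mul, this, h.map_pow hP.2.1]
      ring
    rw [charPowerSum, Finset.sum_mul, Finset.sum_congr rfl h2, Finset.sum_comm]
    refine Finset.sum_congr rfl fun f _ => ?_
    rw [← Finset.sum_filter, Nat.cast_sum, Finset.mul_sum]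
  rw [Finset.sum_congr rfl h1, Finset.sum_comm, charSum, Finset.mul_sum]
  refine Finset.sum_congr rfl fun f hf => ?_
  rw [← Finset.mul_sum, ← Nat.cast_sum, sum_natDegree_pow_dvd hf, mul_comm]

end LogarithmicDerivative

section Vanishing

variable {F : Type*} [Field F]

theorem exists_monic_residuePair_eq (l : ℕ) {Q : F[X]} (hQ : Q ≠ 0) {n : ℕ}
    (hn : Q.natDegree + l ≤ n) {g : F[X]} (hg : g.Monic) :
    ∃ f : F[X], (f.Monic ∧ f.natDegree = n) ∧ residuePair l Q f = residuePair l Q g := by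
  let T : F[X] := ∑ i ∈ Finset.range (l + 1), C (firstCoeff g i) * X ^ (n - i)
  let r : F[X] := (g - T) % Q
  have hr : r.degree < Q.natDegree := by
    rw [← degree_eq_natDegree hQ]
    exact EuclideanDomain.mod_lt _ hQ
  have hT : ∀ i ≤ l, T.coeff (n - i) = firstCoeff g i := by
    intro i hi
    rw [finsetSum_coeff, Finset.sum_eq_single i]
    · rw [coeff_C_mul_X_pow, if_pos rfl]
    · intro j hj hji
      rw [Finset.mem_range] at hj
      rw [coeff_C_mul_X_pow, if_neg (by omega)]
    · intro h
      rw [Finset.mem_range] at h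
      omega
  have hcoeff : ∀ i ≤ l, (T + r).coeff (n - i) = firstCoeff g i := by
    intro i hi
    rw [coeff_add, hT i hi, coeff_eq_zero_of_degree_lt, add_zero]
    exact hr.trans_le (Nat.cast_le.mpr (by omega))
  have hdeg : (T + r).natDegree ≤ n := by
    refine natDegree_add_le_of_degree_le ?_ ?_
    · refine natDegree_sum_le_of_forall_le _ _ fun i _ => (natDegree_C_mul_X_pow_le _ _).trans ?_
      omega
    · exact natDegree_le_of_degree_le (hr.le.trans (Nat.cast_le.mpr (by omega)))
  have hlead : (T + r).coeff n = 1 := by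
    have := hcoeff 0 (Nat.zero_le _)
    rw [Nat.sub_zero] at this
    rw [this, firstCoeff, if_pos (Nat.zero_le _), Nat.sub_zero]
    exact hg
  have hmon : (T + r).Monic := monic_of_natDegree_le_of_coeff_eq_one n hdeg hlead
  have hnat : (T + r).natDegree = n := natDegree_eq_of_le_of_coeff_ne_zero hdeg (by
    rw [hlead]
    exact one_ne_zero)
  refine ⟨T + r, ⟨hmon, hnat⟩, ?_⟩
  rw [residuePair, residuePair, Prod.mk.injEq, AdjoinRoot.mk_eq_mk, AdjoinRoot.mk_eq_mk,
    X_pow_dvd_iff]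
  constructor
  · have : T + r - g = -(Q * ((g - T) / Q)) := by
      have := EuclideanDomain.div_add_mod (g - T) Q
      linear_combination this
    rw [this]
    exact (dvd_mul_right _ _).neg_right
  · intro i hi
    rw [coeff_sub, coeff_reverse_eq_firstCoeff, coeff_reverse_eq_firstCoeff, firstCoeff, hnat,
      if_pos (by omega), hcoeff i (by omega), sub_self]

theorem residuePair_sub_add {l : ℕ} {Q f g h : F[X]} {n : ℕ} (hf : f.natDegree = n)
    (hg : g.natDegree = n) (hh : h.natDegree = n) (hfgh : (f - g + h).natDegree = n) :
    residuePair l Q (f - g + h) = residuePair l Q f - residuePair l Q g + residuePair l Q h := by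
  simp only [residuePair, reverse, hf, hg, hh, hfgh, reflect_add, reflect_sub, _root_.map_add,
    _root_.map_sub]
  rfl

theorem monic_sub_add {f g h : F[X]} {n : ℕ} (hf : f.Monic ∧ f.natDegree = n)
    (hg : g.Monic ∧ g.natDegree = n) (hh : h.Monic ∧ h.natDegree = n) :
    (f - g + h).Monic ∧ (f - g + h).natDegree = n := by
  have h1 : (f - g + h).natDegree ≤ n := by
    refine natDegree_add_le_of_degree_le ((natDegree_sub_le _ _).trans ?_) hh.2.le
    rw [hf.2, hg.2, max_self]
  have h2 : (f - g + h).coeff n = 1 := by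
    have e1 : f.coeff n = 1 := by rw [← hf.2]; exact hf.1
    have e2 : g.coeff n = 1 := by rw [← hg.2]; exact hg.1
    have e3 : h.coeff n = 1 := by rw [← hh.2]; exact hh.1
    rw [coeff_add, coeff_sub, e1, e2, e3, sub_self, zero_add]
  exact ⟨monic_of_natDegree_le_of_coeff_eq_one n h1 h2,
    natDegree_eq_of_le_of_coeff_ne_zero h1 (by rw [h2]; exact one_ne_zero)⟩

variable [Fintype F]

theorem IsShortIntervalCharacter.charSum_eq_zero {l : ℕ} {Q : F[X]} {lam : F[X] → ℂ}
    (h : IsShortIntervalCharacter l Q lam) (hQ : Q ≠ 0) {f₀ : F[X]} (hf₀ : f₀.Monic)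
    (hf₀Q : IsCoprime f₀ Q) (hne : lam f₀ ≠ 1) {n : ℕ} (hn : Q.natDegree + l ≤ n) :
    charSum lam n = 0 := by
  classical
  let I : Finset _ := (monicsOfDegree F n).image (residuePair l Q)
  have hmemI : ∀ g : F[X], g.Monic → residuePair l Q g ∈ I := by
    intro g hg
    obtain ⟨f, hf, hfg⟩ := exists_monic_residuePair_eq l hQ hn hg
    exact Finset.mem_image.mpr ⟨f, mem_monicsOfDegree.mpr hf, hfg⟩
  have hex : ∀ r, ∃ z : ℂ, r ∈ I → ∃ f ∈ monicsOfDegree F n, residuePair l Q f = r ∧ lam f = z := by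
    intro r
    by_cases hr : r ∈ I
    · obtain ⟨f, hf, hfr⟩ := Finset.mem_image.mp hr
      exact ⟨lam f, fun _ => ⟨f, hf, hfr, rfl⟩⟩
    · exact ⟨0, fun hr' => absurd hr' hr⟩
  choose χ hχ using hex
  have hχρ : ∀ f : F[X], f.Monic → χ (residuePair l Q f) = lam f := by
    intro f hf
    obtain ⟨f', hf', h1, h2⟩ := hχ _ (hmemI f hf)
    rw [← h2]
    exact h.eq_of_residuePair_eq (mem_monicsOfDegree.mp hf').1 hf h1
  have hinj : Set.InjOn (residuePair l Q f₀ * ·) (I : Set _) := fun a _ b _ hab =>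
    (isUnit_residuePair l hf₀ hf₀Q).mul_left_cancel hab
  have himg : I.image (residuePair l Q f₀ * ·) = I := by
    refine Finset.eq_of_subset_of_card_le (Finset.image_subset_iff.mpr fun r hr => ?_)
      (Finset.card_image_of_injOn hinj).ge
    obtain ⟨f, hf, rfl⟩ := Finset.mem_image.mp hr
    rw [← residuePair_mul]
    exact hmemI _ (hf₀.mul (mem_monicsOfDegree.mp hf).1)
  have hsum : ∑ r ∈ I, χ r = lam f₀ * ∑ r ∈ I, χ r := by
    conv_lhs => rw [← himg, Finset.sum_image hinj]
    rw [Finset.mul_sum]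
    refine Finset.sum_congr rfl fun r hr => ?_
    obtain ⟨f, hf, rfl⟩ := Finset.mem_image.mp hr
    have hf' := (mem_monicsOfDegree.mp hf).1
    rw [← residuePair_mul, hχρ _ (hf₀.mul hf'), hχρ _ hf', h.map_mul _ _ hf₀ hf']
  have hzero : ∑ r ∈ I, χ r = 0 := by
    have h2 : (lam f₀ - 1) * ∑ r ∈ I, χ r = 0 := by rw [sub_mul, ← hsum, one_mul, sub_self]
    exact (mul_eq_zero.mp h2).resolve_left (sub_ne_zero.mpr hne)
  have hfib : ∀ r ∈ I, ∀ r' ∈ I, ((monicsOfDegree F n).filter (residuePair l Q · = r)).card ≤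
      ((monicsOfDegree F n).filter (residuePair l Q · = r')).card := by
    intro r hr r' hr'
    obtain ⟨f, hf, rfl⟩ := Finset.mem_image.mp hr
    obtain ⟨f', hf', rfl⟩ := Finset.mem_image.mp hr'
    rw [mem_monicsOfDegree] at hf hf'
    refine Finset.card_le_card_of_injOn (fun g => g - f + f') ?_ ?_
    · intro g hg
      rw [Finset.mem_coe, Finset.mem_filter, mem_monicsOfDegree] at hg ⊢
      have h1 := monic_sub_add hg.1 hf hf'
      refine ⟨h1, ?_⟩
      rw [residuePair_sub_add hg.1.2 hf.2 hf'.2 h1.2, hg.2, sub_self, zero_add]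
    · intro a _ b _ hab
      exact sub_left_injective (add_left_injective _ hab)
  have h1 : charSum lam n = ∑ r ∈ I,
      ((monicsOfDegree F n).filter (residuePair l Q · = r)).card • χ r := by
    rw [← Finset.sum_comp, charSum]
    exact Finset.sum_congr rfl fun f hf => (hχρ f (mem_monicsOfDegree.mp hf).1).symm
  obtain ⟨c, hc⟩ : ∃ c : ℕ, ∀ r ∈ I,
      ((monicsOfDegree F n).filter (residuePair l Q · = r)).card = c :=
    ⟨_, fun r hr => le_antisymm (hfib r hr _ (hmemI 1 monic_one)) (hfib _ (hmemI 1 monic_one) r hr)⟩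
  rw [h1, Finset.sum_congr rfl fun r hr => by rw [hc r hr], ← Finset.smul_sum, hzero, smul_zero]

end Vanishing

section NewtonIdentities

open PowerSeries in
theorem powerSeries_X_mul_derivative_prod (m : Multiset ℂ) :
    (PowerSeries.X : ℂ⟦X⟧) *
        PowerSeries.derivative ℂ (m.map fun r => 1 - PowerSeries.C r * PowerSeries.X).prod =
      -(PowerSeries.mk fun n => if n = 0 then 0 else (m.map (· ^ n)).sum) *
        (m.map fun r => 1 - PowerSeries.C r * PowerSeries.X).prod := by
  induction m using Multiset.induction_on with
  | empty =>
    have : (PowerSeries.mk fun n => if n = 0 then 0 else ((0 : Multiset ℂ).map (· ^ n)).sum) = 0 := by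
      ext n
      simp
    rw [this, Multiset.map_zero, Multiset.prod_zero, PowerSeries.derivative_one, mul_zero, neg_zero,
      zero_mul]
  | cons r m ih =>
    have h1 : (PowerSeries.mk fun n => if n = 0 then 0 else ((r ::ₘ m).map (· ^ n)).sum) =
        (PowerSeries.mk fun n => if n = 0 then 0 else r ^ n) +
          PowerSeries.mk fun n => if n = 0 then 0 else (m.map (· ^ n)).sum := by
      ext n
      rw [map_add, PowerSeries.coeff_mk, PowerSeries.coeff_mk, PowerSeries.coeff_mk]
      split_ifs
      · rw [add_zero]
      · rw [Multiset.map_cons, Multiset.sum_cons]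
    have h2 : (PowerSeries.mk fun n => if n = 0 then 0 else r ^ n) *
        (1 - PowerSeries.C r * PowerSeries.X) = PowerSeries.C r * PowerSeries.X := by
      ext n
      rw [mul_sub, mul_one, map_sub, ← mul_assoc, PowerSeries.coeff_mk]
      cases n with
      | zero => simp
      | succ n =>
        rw [PowerSeries.coeff_succ_mul_X, PowerSeries.coeff_succ_mul_X, PowerSeries.coeff_mul_C,
          PowerSeries.coeff_mk, PowerSeries.coeff_C, if_neg n.succ_ne_zero]
        split_ifs with h
        · rw [h]; ring
        · ring
    have h3 : PowerSeries.derivative ℂ (1 - PowerSeries.C r * PowerSeries.X : ℂ⟦X⟧) =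
        -PowerSeries.C r := by
      rw [map_sub, PowerSeries.derivative_one, Derivation.leibniz, PowerSeries.derivative_X,
        PowerSeries.derivative_C, smul_eq_mul, mul_one, smul_zero, add_zero, zero_sub]
    rw [Multiset.map_cons, Multiset.prod_cons, Derivation.leibniz, h3, h1, smul_eq_mul, smul_eq_mul]
    linear_combination (1 - PowerSeries.C r * PowerSeries.X) * ih +
      (m.map fun r => 1 - PowerSeries.C r * PowerSeries.X).prod * h2

theorem coeff_mk_ite_mul_mk (s c : ℕ → ℂ) (n : ℕ) :
    PowerSeries.coeff n ((PowerSeries.mk fun n => if n = 0 then 0 else s n) * PowerSeries.mk c) =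
      ∑ j ∈ Finset.Icc 1 n, s j * c (n - j) := by
  rw [PowerSeries.coeff_mul, Finset.Nat.sum_antidiagonal_eq_sum_range_succ_mk,
    Finset.sum_range_succ', ← Finset.Ico_add_one_right_eq_Icc, Finset.sum_Ico_eq_sum_range,
    Nat.add_sub_cancel]
  simp only [PowerSeries.coeff_mk, if_pos, zero_mul, add_zero]
  refine Finset.sum_congr rfl fun j _ => ?_
  rw [if_neg j.succ_ne_zero, add_comm 1 j]

theorem coeff_X_mul_derivative_mk (c : ℕ → ℂ) (n : ℕ) :
    PowerSeries.coeff n ((PowerSeries.X : PowerSeries ℂ) *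
      PowerSeries.derivative ℂ (PowerSeries.mk c)) = n * c n := by
  cases n with
  | zero => simp
  | succ n =>
    rw [PowerSeries.coeff_succ_X_mul, PowerSeries.coeff_derivative, PowerSeries.coeff_mk]
    push_cast
    ring

theorem powerSeries_X_mul_derivative_eq {c s : ℕ → ℂ}
    (h : ∀ n, ∑ j ∈ Finset.Icc 1 n, s j * c (n - j) = n * c n) :
    (PowerSeries.X : PowerSeries ℂ) * PowerSeries.derivative ℂ (PowerSeries.mk c) =
      (PowerSeries.mk fun n => if n = 0 then 0 else s n) * PowerSeries.mk c := by
  ext n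
  rw [coeff_mk_ite_mul_mk, coeff_X_mul_derivative_mk, h]

theorem exists_inverse_roots {c : ℕ → ℂ} (h0 : c 0 = 1) {k : ℕ} (hk : ∀ n, k ≤ n → c n = 0) :
    ∃ m : Multiset ℂ, m.card ≤ k ∧ PowerSeries.mk c =
      (m.map fun r => 1 - PowerSeries.C r * PowerSeries.X).prod := by
  let L : ℂ[X] := ∑ i ∈ Finset.range k, C (c i) * X ^ i
  have hcoeff : ∀ n, L.coeff n = c n := by
    intro n
    rw [finsetSum_coeff]
    simp only [coeff_C_mul_X_pow]
    rw [Finset.sum_ite_eq]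
    split_ifs with h
    · rfl
    · exact (hk n (by rw [Finset.mem_range] at h; omega)).symm
  have hL : L ≠ 0 := by
    intro h
    have := hcoeff 0
    rw [h, h0, coeff_zero] at this
    exact zero_ne_one this
  have hdeg : L.natDegree ≤ k := natDegree_sum_le_of_forall_le _ _ fun i hi =>
    (natDegree_C_mul_X_pow_le _ _).trans (Finset.mem_range.mp hi).le
  refine ⟨L.roots.map (·⁻¹), ?_, ?_⟩
  · rw [Multiset.card_map]
    exact (card_roots' L).trans hdeg
  · have hroot : ∀ r ∈ L.roots, r ≠ 0 := by
      rintro r hr rfl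
      have := (mem_roots hL).mp hr
      rw [IsRoot.def, ← coeff_zero_eq_eval_zero, hcoeff, h0] at this
      exact one_ne_zero this
    have h1 := (IsAlgClosed.splits L).eq_prod_roots
    have h2 : (L.roots.map fun r => X - C r) =
        L.roots.map fun r => C (-r) * (1 - C r⁻¹ * X) := by
      refine Multiset.map_congr rfl fun r hr => ?_
      have : (C r * C r⁻¹ : ℂ[X]) = 1 := by
        rw [← C_mul, mul_inv_cancel₀ (hroot r hr), C_1]
      rw [C_neg]
      linear_combination -X * this
    rw [h2, Multiset.prod_map_mul, ← mul_assoc] at h1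
    have h3 : (L.roots.map fun r => C (-r)).prod = C (L.roots.map fun r => -r).prod := by
      rw [map_multiset_prod, Multiset.map_map]
      rfl
    rw [h3, ← C_mul] at h1
    have h4 : L.leadingCoeff * (L.roots.map fun r => -r).prod = 1 := by
      have h5 := congrArg (eval 0) h1
      rw [← coeff_zero_eq_eval_zero, hcoeff, h0, eval_mul, eval_C, eval_multiset_prod,
        Multiset.map_map] at h5
      rw [h5]
      symm
      convert mul_one _
      refine Multiset.prod_eq_one fun x hx => ?_
      obtain ⟨r, _, rfl⟩ := Multiset.mem_map.mp hx
      simp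
    rw [h4, C_1, one_mul] at h1
    have h5 : PowerSeries.mk c = (L : PowerSeries ℂ) := by
      ext n
      rw [PowerSeries.coeff_mk, coeff_coe, hcoeff]
    rw [h5, Multiset.map_map]
    conv_lhs => rw [h1]
    rw [← coeToPowerSeries.ringHom_apply, map_multiset_prod, Multiset.map_map]
    congr 1
    refine Multiset.map_congr rfl fun r _ => ?_
    simp

theorem exists_power_sums {c s : ℕ → ℂ} (h0 : c 0 = 1) {k : ℕ} (hk : ∀ n, k ≤ n → c n = 0)
    (h : ∀ n, ∑ j ∈ Finset.Icc 1 n, s j * c (n - j) = n * c n) :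
    ∃ m : Multiset ℂ, m.card ≤ k ∧ ∀ n, n ≠ 0 → s n = -(m.map (· ^ n)).sum := by
  obtain ⟨m, hm, hc⟩ := exists_inverse_roots h0 hk
  refine ⟨m, hm, fun n hn => ?_⟩
  have h1 := powerSeries_X_mul_derivative_eq h
  rw [hc, powerSeries_X_mul_derivative_prod, ← hc] at h1
  have h2 : PowerSeries.mk c ≠ 0 := by
    intro h
    have := congrArg (PowerSeries.coeff 0) h
    rw [PowerSeries.coeff_mk, h0, map_zero] at this
    exact one_ne_zero this
  have h3 := congrArg (PowerSeries.coeff n) (mul_right_cancel₀ h2 h1)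
  rw [map_neg, PowerSeries.coeff_mk, PowerSeries.coeff_mk, if_neg hn, if_neg hn] at h3
  exact h3.symm

theorem sum_mul_inverse_series {c e s : ℕ → ℂ} (h0 : c 0 = 1) (he0 : e 0 = 1)
    (h : ∀ n, ∑ j ∈ Finset.Icc 1 n, s j * c (n - j) = n * c n)
    (he : ∀ n, n ≠ 0 → ∑ i ∈ Finset.range (n + 1), e i * c (n - i) = 0) (n : ℕ) :
    ∑ j ∈ Finset.Icc 1 n, s j * e (n - j) = -(n * e n) := by
  have h1 := powerSeries_X_mul_derivative_eq h
  have h2 : PowerSeries.mk e * PowerSeries.mk c = 1 := by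
    ext n
    rw [PowerSeries.coeff_mul, Finset.Nat.sum_antidiagonal_eq_sum_range_succ_mk,
      PowerSeries.coeff_one]
    simp only [PowerSeries.coeff_mk]
    split_ifs with hn
    · rw [hn, Finset.sum_range_one, h0, he0, one_mul]
    · exact he n hn
  have h3 := congrArg (PowerSeries.derivative ℂ) h2
  rw [PowerSeries.derivative_one, Derivation.leibniz, smul_eq_mul, smul_eq_mul] at h3
  have h4 : (PowerSeries.X : PowerSeries ℂ) * PowerSeries.derivative ℂ (PowerSeries.mk e) =
      -((PowerSeries.mk fun n => if n = 0 then 0 else s n) * PowerSeries.mk e) := by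
    have : PowerSeries.mk c ≠ 0 := right_ne_zero_of_mul_eq_one h2
    refine mul_right_cancel₀ this ?_
    linear_combination PowerSeries.X * h3 - PowerSeries.mk e * h1
  have h5 := congrArg (PowerSeries.coeff n) h4
  rw [map_neg, coeff_mk_ite_mul_mk, coeff_X_mul_derivative_mk] at h5
  rw [h5, neg_neg]

end NewtonIdentities

section PowerSumGrowth

open Filter in
theorem frequently_norm_pow_le_two_mul_re_pow (s : Finset ℂ) :
    ∃ᶠ j : ℕ in atTop, ∀ z ∈ s, ‖z‖ ^ j ≤ 2 * (z ^ j).re := by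
  have h := mapClusterPt_one_atTop_pow (G := ℂ → Circle) fun z => Circle.exp z.arg
  have hU : {g : ℂ → Circle | ∀ z ∈ s, 1 / 2 < (g z : ℂ).re} ∈ nhds (1 : ℂ → Circle) := by
    have : {g : ℂ → Circle | ∀ z ∈ s, 1 / 2 < (g z : ℂ).re} =
        ⋂ z ∈ s, {g : ℂ → Circle | 1 / 2 < (g z : ℂ).re} := by
      ext g
      simp
    rw [this, Filter.biInter_finset_mem]
    intro z _
    have hc : Continuous fun g : ℂ → Circle => (g z : ℂ).re :=
      Complex.continuous_re.comp (continuous_subtype_val.comp (continuous_apply z))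
    refine (isOpen_lt continuous_const hc).mem_nhds ?_
    simp only [Set.mem_ofPred_eq, Pi.one_apply, Circle.coe_one, Complex.one_re]
    norm_num
  refine (h.frequently hU).mono fun j hj z hz => ?_
  have h1 : 1 / 2 < ((Circle.exp z.arg ^ j : Circle) : ℂ).re := hj z hz
  have h2 : z = (‖z‖ : ℂ) * (Circle.exp z.arg : ℂ) := by
    rw [Circle.coe_exp, Complex.norm_mul_exp_arg_mul_I]
  have h3 : (z ^ j).re = ‖z‖ ^ j * ((Circle.exp z.arg ^ j : Circle) : ℂ).re := by
    conv_lhs => rw [h2]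
    rw [mul_pow, ← Complex.ofReal_pow, Complex.re_ofReal_mul, Circle.coe_pow]
  rw [h3]
  nlinarith [pow_nonneg (norm_nonneg z) j]

open Filter in
/-- If the power sums of finitely many complex numbers grow at most like `B ^ j`, then all of
these numbers have absolute value at most `B`. -/
theorem norm_le_of_norm_power_sum_le (m : Multiset ℂ) {B C : ℝ} (hB : 0 < B)
    (h : ∀ᶠ j : ℕ in atTop, ‖(m.map (· ^ j)).sum‖ ≤ C * B ^ j) {z : ℂ} (hz : z ∈ m) :
    ‖z‖ ≤ B := by
  classical
  by_contra! hlt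
  have h1 : Tendsto (fun j : ℕ => (‖z‖ / B) ^ j) atTop atTop :=
    tendsto_pow_atTop_atTop_of_one_lt ((one_lt_div hB).2 hlt)
  obtain ⟨j, hj, hj1, hj2⟩ := ((frequently_norm_pow_le_two_mul_re_pow m.toFinset).and_eventually
    (h.and (h1.eventually_gt_atTop (2 * C)))).exists
  rw [div_pow, lt_div_iff₀ (pow_pos hB j)] at hj2
  have hre : ∀ w ∈ m, ‖w‖ ^ j ≤ 2 * (w ^ j).re := fun w hw => hj w (Multiset.mem_toFinset.2 hw)
  have hsum : (m.map (· ^ j)).sum.re = (m.map fun w => (w ^ j).re).sum := by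
    rw [← Complex.coe_reAddGroupHom, map_multiset_sum, Multiset.map_map]
    rfl
  have hle : (z ^ j).re ≤ (m.map fun w => (w ^ j).re).sum := by
    refine Multiset.single_le_sum ?_ _ (Multiset.mem_map_of_mem (fun w : ℂ => (w ^ j).re) hz)
    intro x hx
    obtain ⟨w, hw, rfl⟩ := Multiset.mem_map.1 hx
    have := hre w hw
    have := pow_nonneg (norm_nonneg w) j
    linarith
  have := Complex.re_le_norm (m.map (· ^ j)).sum
  have := hre z hz
  linarith

variable {F : Type*} [Field F] [Fintype F]

namespace IsShortIntervalCharacter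

/-- The Riemann hypothesis for the characters of `G_{l,Q}`. -/
theorem norm_charPowerSum_le_mul_sqrt_pow {l : ℕ} {Q : F[X]} {lam : F[X] → ℂ}
    (h : IsShortIntervalCharacter l Q lam) (hQ : Q ≠ 0) {f₀ : F[X]} (hf₀ : f₀.Monic)
    (hf₀Q : IsCoprime f₀ Q) (hne : lam f₀ ≠ 1) {n : ℕ} (hn : n ≠ 0) :
    ‖charPowerSum lam n‖ ≤ ((Q.natDegree : ℝ) + l) * √(Fintype.card F) ^ n := by
  obtain ⟨m, hm, hpow⟩ := exists_power_sums h.charSum_zero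
    (fun n hn => h.charSum_eq_zero hQ hf₀ hf₀Q hne hn) h.sum_charPowerSum_mul
  obtain ⟨s, hs, c, hc, C, N, hb⟩ := h.exists_charPowerSum_bound hQ
  have hq1 : (1 : ℝ) < Fintype.card F := by exact_mod_cast Fintype.one_lt_card
  have hq0 : (0 : ℝ) < Fintype.card F := by linarith
  have hroot : ∀ z ∈ m, ‖z ^ (2 * s)‖ ≤ (Fintype.card F : ℝ) ^ s := by
    rcases hc with rfl | rfl
    · intro z hz
      refine norm_le_of_norm_power_sum_le (m.map (· ^ (2 * s))) (C := C) (pow_pos hq0 s) ?_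
        (Multiset.mem_map_of_mem _ hz)
      filter_upwards [Filter.eventually_ge_atTop N, Filter.eventually_ne_atTop 0] with a ha ha0
      have := hb a ha
      rw [zero_mul, sub_zero, hpow _ (by positivity), norm_neg] at this
      simpa [Multiset.map_map, Function.comp_def, ← pow_mul] using this
    · exfalso
      have hmem : (Fintype.card F : ℂ) ^ (2 * s) ∈
          (Fintype.card F : ℂ) ^ (2 * s) ::ₘ m.map (· ^ (2 * s)) := Multiset.mem_cons_self _ _
      have := norm_le_of_norm_power_sum_le
        ((Fintype.card F : ℂ) ^ (2 * s) ::ₘ m.map (· ^ (2 * s))) (C := C) (pow_pos hq0 s) ?_ hmem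
      · rw [norm_pow, Complex.norm_natCast] at this
        exact absurd this (not_le.2 (pow_lt_pow_right₀ hq1 (by omega)))
      · filter_upwards [Filter.eventually_ge_atTop N, Filter.eventually_ne_atTop 0] with a ha ha0
        have := hb a ha
        rw [one_mul, hpow _ (by positivity), ← norm_neg, neg_sub, sub_neg_eq_add] at this
        simpa [Multiset.map_map, Function.comp_def, ← pow_mul] using this
  have hroot' : ∀ z ∈ m, ‖z‖ ≤ √(Fintype.card F) := by
    intro z hz
    refine le_of_pow_le_pow_left₀ (n := 2 * s) (by omega) (Real.sqrt_nonneg _) ?_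
    rw [← norm_pow, pow_mul √_, Real.sq_sqrt hq0.le]
    exact hroot z hz
  rw [hpow n hn, norm_neg]
  have h1 : ‖(m.map (· ^ n)).sum‖ ≤ (m.map fun z : ℂ => ‖z ^ n‖).sum := by
    simpa [Multiset.map_map, Function.comp_def] using norm_multiset_sum_le (m.map (· ^ n))
  have h2 : (m.map fun z : ℂ => ‖z ^ n‖).sum ≤ m.card • √(Fintype.card F) ^ n := by
    have := Multiset.sum_le_card_nsmul (m.map fun z : ℂ => ‖z ^ n‖) (√(Fintype.card F) ^ n) ?_
    · simpa using this
    · intro x hx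
      obtain ⟨z, hz, rfl⟩ := Multiset.mem_map.1 hx
      rw [norm_pow]
      exact pow_le_pow_left₀ (norm_nonneg z) (hroot' z hz) n
  refine (h1.trans h2).trans ?_
  rw [nsmul_eq_mul]
  gcongr
  exact_mod_cast hm

end IsShortIntervalCharacter

end PowerSumGrowth

section GrowthFromLogarithmicDerivative

open Finset in
theorem sum_Icc_sum_Icc_le_mul_sum {a s : ℕ → ℝ} (ha : ∀ n, 0 ≤ a n) (hs : ∀ n, 0 ≤ s n) (d : ℕ)
    {u : ℝ} (hu : 0 ≤ u) :
    ∑ n ∈ Icc 1 d, (∑ j ∈ Icc 1 n, s j * a (n - j)) * u ^ (n - 1) ≤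
      (∑ j ∈ Icc 1 d, s j * u ^ (j - 1)) * ∑ i ∈ range (d + 1), a i * u ^ i := by
  simp_rw [sum_mul]
  rw [sum_comm' (t' := Icc 1 d) (s' := fun j => Icc j d)
    (by intro x y; simp only [mem_Icc]; omega)]
  refine sum_le_sum fun j hj => ?_
  rw [mem_Icc] at hj
  have h1 : ∑ x ∈ Icc j d, s j * a (x - j) * u ^ (x - 1) =
      s j * u ^ (j - 1) * ∑ x ∈ Icc j d, a (x - j) * u ^ (x - j) := by
    rw [mul_sum]
    refine sum_congr rfl fun x hx => ?_
    rw [mem_Icc] at hx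
    rw [show x - 1 = (j - 1) + (x - j) by omega, pow_add]
    ring
  rw [h1]
  refine mul_le_mul_of_nonneg_left ?_ (mul_nonneg (hs j) (pow_nonneg hu _))
  rw [← sum_image (s := Icc j d) (g := fun x => x - j) (f := fun i => a i * u ^ i)]
  · refine sum_le_sum_of_subset_of_nonneg ?_ fun i _ _ => mul_nonneg (ha i) (pow_nonneg hu _)
    intro i hi
    simp only [mem_image, mem_Icc, mem_range] at hi ⊢
    omega
  · intro x hx y hy hxy
    simp only [coe_Icc, Set.mem_Icc] at hx hy hxy
    omega

open Finset in
/-- A Grönwall-type inequality for the coefficients of a power series in terms of those of its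
logarithmic derivative. -/
theorem le_exp_sum_of_mul_le_sum {a s : ℕ → ℝ} (ha : ∀ n, 0 ≤ a n) (hs : ∀ n, 0 ≤ s n)
    (h0 : a 0 = 1) (h : ∀ n : ℕ, n * a n ≤ ∑ j ∈ Icc 1 n, s j * a (n - j)) (d : ℕ) :
    a d ≤ Real.exp (∑ j ∈ Icc 1 d, s j / j) := by
  let A : ℝ → ℝ := fun u => ∑ i ∈ range (d + 1), a i * u ^ i
  let S : ℝ → ℝ := fun u => ∑ j ∈ Icc 1 d, s j / j * u ^ j
  have hA : ∀ u, HasDerivAt A (∑ n ∈ Icc 1 d, n * a n * u ^ (n - 1)) u := by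
    intro u
    have h1 : HasDerivAt A (∑ i ∈ range (d + 1), a i * (i * u ^ (i - 1))) u :=
      HasDerivAt.fun_sum fun i _ => (hasDerivAt_pow i u).const_mul (a i)
    convert h1 using 1
    rw [sum_range_succ', Nat.cast_zero, zero_mul, mul_zero, add_zero, range_eq_Ico,
      sum_Ico_add' (fun i : ℕ => a i * (i * u ^ (i - 1))) 0 d 1, zero_add]
    exact sum_congr rfl fun i _ => by ring
  have hS : ∀ u, HasDerivAt S (∑ j ∈ Icc 1 d, s j * u ^ (j - 1)) u := by
    intro u
    have h1 : HasDerivAt S (∑ j ∈ Icc 1 d, s j / j * (j * u ^ (j - 1))) u :=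
      HasDerivAt.fun_sum fun j _ => (hasDerivAt_pow j u).const_mul (s j / j)
    convert h1 using 1
    refine sum_congr rfl fun j hj => ?_
    have : (j : ℝ) ≠ 0 := by
      rw [mem_Icc] at hj
      exact_mod_cast (by omega : j ≠ 0)
    field_simp
  have hG : ∀ u, HasDerivAt (fun u => A u * Real.exp (-S u))
      ((∑ n ∈ Icc 1 d, n * a n * u ^ (n - 1)) * Real.exp (-S u) +
        A u * (Real.exp (-S u) * -(∑ j ∈ Icc 1 d, s j * u ^ (j - 1)))) u :=
    fun u => (hA u).mul (hS u).neg.exp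
  have hanti : AntitoneOn (fun u => A u * Real.exp (-S u)) (Set.Icc 0 1) := by
    refine antitoneOn_of_deriv_nonpos (convex_Icc 0 1)
      (fun u _ => (hG u).continuousAt.continuousWithinAt)
      (fun u _ => (hG u).differentiableAt.differentiableWithinAt) fun u hu => ?_
    rw [interior_Icc] at hu
    rw [(hG u).deriv]
    have h1 := sum_Icc_sum_Icc_le_mul_sum ha hs d hu.1.le
    have h2 : ∑ n ∈ Icc 1 d, n * a n * u ^ (n - 1) ≤
        ∑ n ∈ Icc 1 d, (∑ j ∈ Icc 1 n, s j * a (n - j)) * u ^ (n - 1) :=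
      sum_le_sum fun n _ => mul_le_mul_of_nonneg_right (h n) (pow_nonneg hu.1.le _)
    have h3 := mul_le_mul_of_nonneg_right (h2.trans h1) (Real.exp_pos (-S u)).le
    change _ ≤ (∑ j ∈ Icc 1 d, s j * u ^ (j - 1)) * A u * Real.exp (-S u) at h3
    linarith
  have h01 := hanti (Set.left_mem_Icc.2 zero_le_one) (Set.right_mem_Icc.2 zero_le_one) zero_le_one
  have hA0 : A 0 = 1 := by
    simp only [A]
    rw [sum_range_succ']
    simp [h0]
  have hS0 : S 0 = 0 := sum_eq_zero fun j hj => by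
    rw [mem_Icc] at hj
    rw [zero_pow (by omega), mul_zero]
  have hS1 : S 1 = ∑ j ∈ Icc 1 d, s j / j := by simp [S]
  have hA1 : a d ≤ A 1 := by
    simp only [A, one_pow, mul_one]
    exact single_le_sum (fun i _ => ha i) (self_mem_range_succ d)
  simp only [hA0, hS0, hS1, neg_zero, Real.exp_zero, mul_one] at h01
  rw [Real.exp_neg, ← div_eq_mul_inv, div_le_one (Real.exp_pos _)] at h01
  exact hA1.trans h01

end GrowthFromLogarithmicDerivative

section SumOfMinima

theorem exp_one_lt_log_of_le {k : ℝ} (hk : 16 ≤ k) : Real.exp 1 < Real.log k := by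
  have h1 : Real.log 16 = 4 * Real.log 2 := by
    rw [show (16 : ℝ) = 2 ^ 4 by norm_num, Real.log_pow]
    norm_num
  have h2 := Real.log_two_gt_d9
  have h3 := Real.exp_one_lt_d9
  have h4 := Real.log_le_log (by norm_num) hk
  linarith

theorem log_log_le_two_fifths_mul_log {k : ℝ} (hk : 16 ≤ k) :
    Real.log (Real.log k) ≤ 2 / 5 * Real.log k := by
  have hL := exp_one_lt_log_of_le hk
  have he := Real.exp_one_gt_d9
  have hpos : 0 < Real.log k := by linarith
  have h1 := Real.log_le_sub_one_of_pos (div_pos hpos (Real.exp_pos 1))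
  rw [Real.log_div hpos.ne' (Real.exp_pos 1).ne', Real.log_exp] at h1
  have h2 : Real.log k / Real.exp 1 ≤ 2 / 5 * Real.log k := by
    rw [div_le_iff₀ (Real.exp_pos 1)]
    nlinarith
  linarith

open Finset in
/-- With `R = q ^ (1/2 - u)`, `y = q ^ (-u)` and `u = log log k / log k`, the sums of
`min (R ^ j) (k y ^ j) / j` are `O_q(k / log² k)`. -/
theorem sum_min_div_le {g k : ℝ} (hg : 0 < g) (hk : 16 ≤ k) {u : ℝ}
    (hu : u = Real.log (Real.log k) / Real.log k) (d : ℕ) :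
    ∑ j ∈ Icc 1 d, min (Real.exp (g * (1 / 2 - u)) ^ j) (k * Real.exp (-(g * u)) ^ j) / j ≤
      (1 / (1 - Real.exp (-(g / 10))) + (1 + g) / 2) * (k / Real.log k ^ 2) := by
  have hL := exp_one_lt_log_of_le hk
  have he := Real.exp_one_gt_d9
  set L := Real.log k with hLdef
  have hL0 : 0 < L := by linarith
  have hLL : 1 < Real.log L := (Real.lt_log_iff_exp_lt hL0).2 hL
  have hk0 : 0 < k := by linarith
  have huL : u * L = Real.log L := by rw [hu, div_mul_cancel₀ _ hL0.ne']
  have hu0 : 0 < u := by rw [hu]; positivity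
  have hu1 : u ≤ 2 / 5 := by
    rw [hu, div_le_iff₀ hL0]
    exact log_log_le_two_fifths_mul_log hk
  set R := Real.exp (g * (1 / 2 - u)) with hR
  set y := Real.exp (-(g * u)) with hy
  set ρ := Real.exp (-(g / 10)) with hρ
  have hρ1 : ρ < 1 := Real.exp_lt_one_iff.2 (by linarith)
  have hR0 : 0 < R := Real.exp_pos _
  have hR1 : 1 < R := Real.one_lt_exp_iff.2 (by nlinarith)
  have hy0 : 0 < y := Real.exp_pos _
  have hy1 : y < 1 := Real.exp_lt_one_iff.2 (by nlinarith)
  have hRρ : R⁻¹ ≤ ρ := by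
    rw [hR, hρ, ← Real.exp_neg, Real.exp_le_exp]
    nlinarith
  set n₀ := 2 * L / g with hn₀
  have hn₀0 : 0 < n₀ := by positivity
  have hgn : g * n₀ = 2 * L := by rw [hn₀]; field_simp
  have hexp : Real.exp (-(2 * Real.log L)) = 1 / L ^ 2 := by
    rw [Real.exp_neg, one_div, mul_comm, Real.exp_mul, Real.exp_log hL0]
    norm_cast
  have hRn : R ^ ⌊n₀⌋₊ ≤ k / L ^ 2 := by
    have h1 : k / L ^ 2 = Real.exp (L - 2 * Real.log L) := by
      rw [sub_eq_add_neg, Real.exp_add, hexp, hLdef, Real.exp_log hk0]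
      ring
    rw [h1, hR, ← Real.exp_nat_mul, Real.exp_le_exp]
    have h2 := Nat.floor_le hn₀0.le
    have h3 : (⌊n₀⌋₊ : ℝ) * (g * (1 / 2 - u)) ≤ n₀ * (g * (1 / 2 - u)) :=
      mul_le_mul_of_nonneg_right h2 (by nlinarith)
    have h4 : n₀ * (g * (1 / 2 - u)) = L - 2 * Real.log L := by
      rw [← huL]
      linear_combination (1 / 2 - u) * hgn
    linarith
  have hyn : y ^ (⌊n₀⌋₊ + 1) ≤ 1 / L ^ 2 := by
    rw [← hexp, hy, ← Real.exp_nat_mul, Real.exp_le_exp]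
    have h2 := (Nat.lt_floor_add_one n₀).le
    push_cast
    have h3 : n₀ * (g * u) ≤ ((⌊n₀⌋₊ : ℝ) + 1) * (g * u) :=
      mul_le_mul_of_nonneg_right h2 (by positivity)
    have h4 : n₀ * (g * u) = 2 * Real.log L := by
      rw [← huL]
      linear_combination u * hgn
    linarith
  let t : ℕ → ℝ := fun j => min (R ^ j) (k * y ^ j) / j
  have ht0 : ∀ j, 0 ≤ t j := fun j => by positivity
  have hsplit : ∑ j ∈ Icc 1 d, t j ≤
      ∑ j ∈ range (⌊n₀⌋₊ + 1), t j + ∑ i ∈ range d, t (⌊n₀⌋₊ + 1 + i) := by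
    rw [← sum_range_add]
    refine sum_le_sum_of_subset_of_nonneg ?_ fun j _ _ => ht0 j
    intro j hj
    rw [mem_Icc] at hj
    rw [mem_range]
    omega
  have hhead : ∑ j ∈ range (⌊n₀⌋₊ + 1), t j ≤ 1 / (1 - ρ) * (k / L ^ 2) := by
    calc ∑ j ∈ range (⌊n₀⌋₊ + 1), t j ≤ ∑ j ∈ range (⌊n₀⌋₊ + 1), R ^ j := by
          refine sum_le_sum fun j _ => ?_
          rcases Nat.eq_zero_or_pos j with rfl | hj
          · simp [t]
          · have : (1 : ℝ) ≤ j := by exact_mod_cast hj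
            exact (div_le_self (by positivity) this).trans (min_le_left _ _)
      _ = R ^ ⌊n₀⌋₊ * ((1 - (R⁻¹) ^ (⌊n₀⌋₊ + 1)) / (1 - R⁻¹)) := by
          rw [geom_sum_eq hR1.ne', inv_pow, pow_succ]
          have : R - 1 ≠ 0 := by linarith
          field_simp
      _ ≤ k / L ^ 2 * (1 / (1 - ρ)) := by
          have : 0 < 1 - ρ := by linarith
          have h1 : (0 : ℝ) ≤ (R⁻¹) ^ (⌊n₀⌋₊ + 1) := by positivity
          exact mul_le_mul hRn (div_le_div₀ zero_le_one (by linarith) this (by linarith))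
            (div_nonneg (sub_nonneg.2 (pow_le_one₀ (by positivity) (by linarith))) (by linarith))
            (by positivity)
      _ = _ := mul_comm _ _
  have htail : ∑ i ∈ range d, t (⌊n₀⌋₊ + 1 + i) ≤ (1 + g) / 2 * (k / L ^ 2) := by
    have hny : 2 / (1 + g) ≤ n₀ * (1 - y) := by
      have h1 : 1 + g * u ≤ y⁻¹ := by
        rw [hy, Real.exp_neg, inv_inv]
        linarith [Real.add_one_le_exp (g * u)]
      have h2 : y * (1 + g * u) ≤ 1 := by
        have := mul_le_mul_of_nonneg_left h1 hy0.le
        rwa [mul_inv_cancel₀ hy0.ne'] at this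
      have h3 : g * u ≤ (1 - y) * (1 + g) := by
        nlinarith [mul_nonneg (sub_nonneg.2 hy1.le)
          (mul_nonneg hg.le (by linarith : (0 : ℝ) ≤ 1 - u))]
      have h4 : n₀ * (g * u) = 2 * Real.log L := by
        rw [← huL]
        linear_combination u * hgn
      rw [div_le_iff₀ (by linarith)]
      nlinarith [mul_le_mul_of_nonneg_left h3 hn₀0.le]
    calc ∑ i ∈ range d, t (⌊n₀⌋₊ + 1 + i)
        ≤ ∑ i ∈ range d, k / n₀ * (y ^ (⌊n₀⌋₊ + 1) * y ^ i) := by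
          refine sum_le_sum fun i _ => ?_
          have h1 : n₀ ≤ ((⌊n₀⌋₊ + 1 + i : ℕ) : ℝ) := by
            have := (Nat.lt_floor_add_one n₀).le
            push_cast
            have : (0 : ℝ) ≤ i := Nat.cast_nonneg i
            linarith
          rw [← pow_add, div_mul_eq_mul_div]
          exact div_le_div₀ (by positivity) (min_le_right _ _) hn₀0 h1
      _ = k / n₀ * (y ^ (⌊n₀⌋₊ + 1) * ∑ i ∈ range d, y ^ i) := by
          rw [mul_sum, mul_sum]
      _ ≤ k / n₀ * (1 / L ^ 2 * (1 - y)⁻¹) := by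
          gcongr
          rw [← tsum_geometric_of_lt_one hy0.le hy1]
          exact (summable_geometric_of_lt_one hy0.le hy1).sum_le_tsum _ fun i _ => by positivity
      _ = k / L ^ 2 * (n₀ * (1 - y))⁻¹ := by
          rw [mul_inv]
          ring
      _ ≤ k / L ^ 2 * (2 / (1 + g))⁻¹ := by gcongr
      _ = _ := by rw [inv_div]; ring
  calc _ ≤ _ := hsplit
    _ ≤ _ := add_le_add hhead htail
    _ = _ := by ring

end SumOfMinima

section MoebiusCharacterSum

variable {F : Type*} [Field F] [Fintype F]

namespace IsShortIntervalCharacter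

open Finset in
theorem mul_norm_moebiusCharSum_le {l : ℕ} {Q : F[X]} {lam : F[X] → ℂ}
    (h : IsShortIntervalCharacter l Q lam) (n : ℕ) :
    n * ‖moebiusCharSum lam n‖ ≤
      ∑ j ∈ Icc 1 n, ‖charPowerSum lam j‖ * ‖moebiusCharSum lam (n - j)‖ := by
  have h1 := sum_mul_inverse_series h.charSum_zero h.moebiusCharSum_zero h.sum_charPowerSum_mul
    (fun n hn => h.sum_moebiusCharSum_mul hn) n
  have h2 : (n : ℝ) * ‖moebiusCharSum lam n‖ =
      ‖∑ j ∈ Icc 1 n, charPowerSum lam j * moebiusCharSum lam (n - j)‖ := by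
    rw [h1, norm_neg, norm_mul, Complex.norm_natCast]
  rw [h2]
  refine (norm_sum_le _ _).trans_eq (sum_congr rfl fun j _ => norm_mul _ _)

open Finset in
theorem norm_moebiusCharSum_mul_pow_le {l : ℕ} {Q : F[X]} {lam : F[X] → ℂ}
    (h : IsShortIntervalCharacter l Q lam) {r : ℝ} (hr : 0 ≤ r) (d : ℕ) :
    ‖moebiusCharSum lam d‖ * r ^ d ≤
      Real.exp (∑ j ∈ Icc 1 d, ‖charPowerSum lam j‖ * r ^ j / j) := by
  refine le_exp_sum_of_mul_le_sum (a := fun n => ‖moebiusCharSum lam n‖ * r ^ n)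
    (s := fun j => ‖charPowerSum lam j‖ * r ^ j) (fun n => by positivity) (fun n => by positivity)
    (by simp [h.moebiusCharSum_zero]) (fun n => ?_) d
  have h1 := mul_le_mul_of_nonneg_right (h.mul_norm_moebiusCharSum_le n) (pow_nonneg hr n)
  rw [mul_assoc, sum_mul] at h1
  refine h1.trans_eq (sum_congr rfl fun j hj => ?_)
  rw [mem_Icc] at hj
  rw [← Nat.add_sub_of_le hj.2, pow_add, Nat.add_sub_cancel_left]
  ring

open Finset in
theorem norm_moebiusCharSum_le {l : ℕ} {Q : F[X]} {lam : F[X] → ℂ}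
    (h : IsShortIntervalCharacter l Q lam) (hQ : Q ≠ 0) (hk : 16 ≤ Q.natDegree + l) {f₀ : F[X]}
    (hf₀ : f₀.Monic) (hf₀Q : IsCoprime f₀ Q) (hne : lam f₀ ≠ 1) (d : ℕ) :
    ‖moebiusCharSum lam d‖ ≤ (Fintype.card F : ℝ) ^ ((d : ℝ) / 2 +
      (d : ℝ) * Real.log (Real.log ((Q.natDegree : ℝ) + l)) / Real.log ((Q.natDegree : ℝ) + l) +
      (1 / (1 - Real.exp (-(Real.log (Fintype.card F) / 10))) +
        (1 + Real.log (Fintype.card F)) / 2) / Real.log (Fintype.card F) *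
          ((Q.natDegree : ℝ) + l) / Real.log ((Q.natDegree : ℝ) + l) ^ 2) := by
  have hq1 : (1 : ℝ) < Fintype.card F := by exact_mod_cast Fintype.one_lt_card
  have hq0 : (0 : ℝ) < Fintype.card F := by linarith
  have hk' : (16 : ℝ) ≤ (Q.natDegree : ℝ) + l := by exact_mod_cast hk
  set k : ℝ := (Q.natDegree : ℝ) + l
  set g : ℝ := Real.log (Fintype.card F) with hg
  have hg0 : 0 < g := Real.log_pos hq1
  have hqexp : (Fintype.card F : ℝ) = Real.exp g := (Real.exp_log hq0).symm
  obtain ⟨u, hu⟩ : ∃ u, u = Real.log (Real.log k) / Real.log k := ⟨_, rfl⟩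
  set r : ℝ := Real.exp (-(g * (1 / 2 + u))) with hr
  have hr0 : 0 < r := Real.exp_pos _
  have hqr : (Fintype.card F : ℝ) * r = Real.exp (g * (1 / 2 - u)) := by
    rw [hqexp, hr, ← Real.exp_add]
    congr 1
    ring
  have hsqr : √(Fintype.card F : ℝ) * r = Real.exp (-(g * u)) := by
    rw [hqexp, Real.sqrt_eq_rpow, ← Real.exp_mul, hr, ← Real.exp_add]
    congr 1
    ring
  have hle : ∀ j ∈ Icc 1 d, ‖charPowerSum lam j‖ * r ^ j / j ≤
      min (Real.exp (g * (1 / 2 - u)) ^ j) (k * Real.exp (-(g * u)) ^ j) / j := by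
    intro j hj
    have hj0 : j ≠ 0 := by
      rw [mem_Icc] at hj
      omega
    refine div_le_div_of_nonneg_right (le_min ?_ ?_) (Nat.cast_nonneg j)
    · rw [← hqr, mul_pow]
      exact mul_le_mul_of_nonneg_right (h.norm_charPowerSum_le hj0) (by positivity)
    · rw [← hsqr, mul_pow, ← mul_assoc]
      exact mul_le_mul_of_nonneg_right
        (h.norm_charPowerSum_le_mul_sqrt_pow hQ hf₀ hf₀Q hne hj0) (by positivity)
  have h1 := (h.norm_moebiusCharSum_mul_pow_le hr0.le d).trans
    (Real.exp_le_exp.2 ((sum_le_sum hle).trans (sum_min_div_le hg0 hk' hu d)))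
  rw [← le_div_iff₀ (pow_pos hr0 d), hr, ← Real.exp_nat_mul, ← Real.exp_sub] at h1
  refine h1.trans_eq ?_
  rw [Real.rpow_def_of_pos hq0, ← hg, mul_div_assoc (d : ℝ), ← hu]
  congr 1
  field_simp
  ring

end IsShortIntervalCharacter

end MoebiusCharacterSum

/-- There is a constant `C = C(q)` such that for every `l ≥ 0`, nonzero `Q` of degree `m`
with `m + l ≥ 16`, and every non-principal character `λ` of `G_{l,Q}`, for every `d ≥ 1`
one has `|∑_{f monic, deg f = d} μ(f) λ(f)| ≤
q^(d/2 + d·log log(m+l)/log(m+l) + C(m+l)/log²(m+l))`. -/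
theorem char_sum_estimate_nonprincipal {F : Type*} [Field F] [Fintype F] (q : ℕ)
    (hq : Fintype.card F = q) :
    ∃ C : ℝ, ∀ (l : ℕ) (Q : Polynomial F), Q ≠ 0 → 16 ≤ Q.natDegree + l →
      ∀ lam : Polynomial F → ℂ,
        (∀ f g : Polynomial F, f.Monic → g.Monic → lam (f * g) = lam f * lam g) →
        (∀ f : Polynomial F, f.Monic → ¬IsCoprime f Q → lam f = 0) →
        (∀ f : Polynomial F, f.Monic → IsCoprime f Q → ‖lam f‖ = 1) →
        (∀ f g : Polynomial F, f.Monic → g.Monic → Q ∣ f - g →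
          (∀ i : ℕ, 1 ≤ i → i ≤ l → firstCoeff f i = firstCoeff g i) → lam f = lam g) →
        ¬(∀ f : Polynomial F, f.Monic → IsCoprime f Q → lam f = 1) →
        ∀ d : ℕ, 1 ≤ d →
          ‖∑ x : Fin d → F, (polyMu (monicPoly F d x) : ℂ) * lam (monicPoly F d x)‖ ≤
            (q : ℝ) ^ ((d : ℝ) / 2 +
              (d : ℝ) * Real.log (Real.log ((Q.natDegree : ℝ) + l)) /
                Real.log ((Q.natDegree : ℝ) + l) +
              C * ((Q.natDegree : ℝ) + l) / Real.log ((Q.natDegree : ℝ) + l) ^ 2) := by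
  subst hq
  refine ⟨(1 / (1 - Real.exp (-(Real.log (Fintype.card F) / 10))) +
    (1 + Real.log (Fintype.card F)) / 2) / Real.log (Fintype.card F), ?_⟩
  intro l Q hQ hk lam hmul hcop hnorm hcongr hne d _
  push Not at hne
  obtain ⟨f₀, hf₀, hf₀Q, hf₀ne⟩ := hne
  rw [sum_monicPoly d fun f => (polyMu f : ℂ) * lam f]
  exact IsShortIntervalCharacter.norm_moebiusCharSum_le ⟨hmul, hcop, hnorm, hcongr⟩ hQ hk hf₀ hf₀Q
    hf₀ne d
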